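/- Let d ≥ 2, let f and g be elements of Diff^∞_c(ℝ^d), and suppose g is distorted in Diff^∞_c(ℝ^d). Suppose there exists a sequence (h_n)_{n≥0} in Diff^∞_c(ℝ^d), all equal to the identity outside a common compact set, such that d_r(h_n∘f∘h_n⁻¹, g) → 0 as n → ∞ for every r ∈ ℕ. Then f is distorted in Diff^∞_c(ℝ^d). -/

import Mathlib

open Filter Set

noncomputable section

/-- `f` is a `C^∞` diffeomorphism of `ℝ^d` with compact support,
i.e. an element of `Diff^∞_c(ℝ^d)`. -/
def IsCDiffCRd {d : ℕ} (f : Equiv.Perm (EuclideanSpace ℝ (Fin d))) : Prop :=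
  ContDiff ℝ (⊤ : ℕ∞) (f : EuclideanSpace ℝ (Fin d) → EuclideanSpace ℝ (Fin d)) ∧
    ContDiff ℝ (⊤ : ℕ∞) (f.symm : EuclideanSpace ℝ (Fin d) → EuclideanSpace ℝ (Fin d)) ∧
    ∃ K : Set (EuclideanSpace ℝ (Fin d)), IsCompact K ∧ ∀ x ∉ K, f x = x

/-- `g` can be written as a product of at most `m` elements of `S ∪ S⁻¹`. -/
def WordLenLe {G : Type*} [Group G] (S : Finset G) (g : G) (m : ℕ) : Prop :=
  ∃ l : List G, l.length ≤ m ∧ (∀ x ∈ l, x ∈ S ∨ x⁻¹ ∈ S) ∧ l.prod = g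

/-- The word length of `g` with respect to the finite set `S`. -/
def wordLength {G : Type*} [Group G] (S : Finset G) (g : G) : ℕ :=
  sInf {m | WordLenLe S g m}

/-- `f` is distorted in the group of elements satisfying `P`. -/
def IsDistorted {G : Type*} [Group G] (P : G → Prop) (f : G) : Prop :=
  ∃ S : Finset G, (∀ s ∈ S, P s) ∧ f ∈ Subgroup.closure (S : Set G) ∧
    Tendsto (fun n : ℕ => (wordLength S (f ^ n) : ℝ) / n) atTop (nhds 0)

/-- `d_r(f, g) < ε`, where `d_r` is the `C^r` distance on maps of `ℝ^d`, computed with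
iterated total (Fréchet) derivatives. -/
def DistLtRd {d : ℕ} (r : ℕ) (ε : ℝ)
    (f g : EuclideanSpace ℝ (Fin d) → EuclideanSpace ℝ (Fin d)) : Prop :=
  ∀ k ≤ r, ∀ x, ‖iteratedFDeriv ℝ k f x - iteratedFDeriv ℝ k g x‖ < ε

namespace DiffDistortion

open scoped ContDiff
set_option linter.unusedSectionVars false

section Calculus

variable {E F G : Type*} [NormedAddCommGroup E] [NormedSpace ℝ E]
  [NormedAddCommGroup F] [NormedSpace ℝ F] [NormedAddCommGroup G] [NormedSpace ℝ G]

/-- Smoothness over the reals. -/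
abbrev Smooth (f : E → F) : Prop := ContDiff ℝ (⊤ : ℕ∞) f

/-- The pointwise norm of the `n`-th derivative. -/
abbrev nd (n : ℕ) (f : E → F) (x : E) : ℝ := ‖iteratedFDeriv ℝ n f x‖

lemma Smooth.nat {f : E → F} (hf : Smooth f) (n : ℕ) : ContDiff ℝ n f :=
  hf.of_le (by exact_mod_cast le_top)

lemma nd_nonneg (n : ℕ) (f : E → F) (x : E) : 0 ≤ nd n f x := norm_nonneg _

lemma nd_zero (f : E → F) (x : E) : nd 0 f x = ‖f x‖ := by simp [nd]

lemma nd_one (f : E → F) (x : E) : nd 1 f x = ‖fderiv ℝ f x‖ := norm_iteratedFDeriv_one f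

lemma nd_fderiv (n : ℕ) (f : E → F) (x : E) : nd n (fderiv ℝ f) x = nd (n + 1) f x :=
  norm_iteratedFDeriv_fderiv

lemma nd_add_le {f g : E → F} (hf : Smooth f) (hg : Smooth g) (n : ℕ) (x : E) :
    nd n (fun y => f y + g y) x ≤ nd n f x + nd n g x := by
  have := iteratedFDeriv_add_apply (hf.nat n).contDiffAt (hg.nat n).contDiffAt (x := x)
  change ‖iteratedFDeriv ℝ n (f + g) x‖ ≤ _
  rw [this]; exact norm_add_le _ _

lemma nd_neg (f : E → F) (n : ℕ) (x : E) : nd n (fun y => - f y) x = nd n f x := by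
  change ‖iteratedFDeriv ℝ n (-f) x‖ = _
  rw [iteratedFDeriv_neg_apply, norm_neg]

lemma nd_const (c : F) {n : ℕ} (hn : 1 ≤ n) (x : E) : nd n (fun _ : E => c) x = 0 := by
  simp [nd, iteratedFDeriv_const_of_ne (𝕜 := ℝ) (by omega : n ≠ 0) c]

lemma nd_sub_const {f : E → F} (hf : Smooth f) (c : F) {n : ℕ} (hn : 1 ≤ n) (x : E) :
    nd n (fun y => f y - c) x = nd n f x := by
  have h : iteratedFDeriv ℝ n (f - fun _ => c) x = _ :=
    iteratedFDeriv_sub_apply (hf.nat n).contDiffAt contDiff_const.contDiffAt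
  change ‖iteratedFDeriv ℝ n (f - fun _ => c) x‖ = _
  rw [h, iteratedFDeriv_const_of_ne (𝕜 := ℝ) (by omega : n ≠ 0) c]; simp

lemma nd_const_smul {f : E → F} (hf : Smooth f) (c : ℝ) (n : ℕ) (x : E) :
    nd n (fun y => c • f y) x = |c| * nd n f x := by
  rw [nd, iteratedFDeriv_const_smul_apply' (hf.nat n).contDiffAt, norm_smul, Real.norm_eq_abs]

lemma nd_const_mul {f : E → ℝ} (hf : Smooth f) (c : ℝ) (n : ℕ) (x : E) :
    nd n (fun y => c * f y) x = |c| * nd n f x := nd_const_smul hf c n x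

lemma nd_comp_smul {f : E → F} (hf : Smooth f) (c : ℝ) (n : ℕ) (x : E) :
    nd n (fun y => f (c • y)) x = |c| ^ n * nd n f (c • x) := by
  rw [nd, iteratedFDeriv_comp_const_smul c (hf.nat n), norm_smul, norm_pow, Real.norm_eq_abs]

lemma nd_comp_add (f : E → F) (a : E) (n : ℕ) (x : E) :
    nd n (fun y => f (y + a)) x = nd n f (x + a) := by
  rw [nd, iteratedFDeriv_comp_add_right]

lemma nd_comp_sub (f : E → F) (a : E) (n : ℕ) (x : E) :
    nd n (fun y => f (y - a)) x = nd n f (x - a) := by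
  rw [nd, iteratedFDeriv_comp_sub]

lemma nd_congr {f g : E → F} {x : E} (h : f =ᶠ[nhds x] g) (n : ℕ) : nd n f x = nd n g x := by
  have := (h.iteratedFDeriv ℝ n).self_of_nhds
  simp only [nd, this]

lemma nd_eq_zero_of_eventually {f : E → F} {x : E} (h : ∀ᶠ y in nhds x, f y = 0) (n : ℕ) :
    nd n f x = 0 := by
  rw [nd_congr (g := fun _ => 0) h n]
  simp [nd]

lemma nd_clm_comp_le (L : F →L[ℝ] G) {f : E → F} (hf : Smooth f) (n : ℕ) (x : E) :
    nd n (fun y => L (f y)) x ≤ ‖L‖ * nd n f x :=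
  L.norm_iteratedFDeriv_comp_left (hf.nat n).contDiffAt le_rfl

lemma nd_comp_clm_le (L : E →L[ℝ] F) {f : F → G} (hf : Smooth f) (n : ℕ) (x : E) :
    nd n (fun y => f (L y)) x ≤ ‖L‖ ^ n * nd n f (L x) := by
  have h := L.iteratedFDeriv_comp_right (hf.nat n) x le_rfl
  change ‖iteratedFDeriv ℝ n (f ∘ L) x‖ ≤ _
  rw [h, mul_comm]
  refine (ContinuousMultilinearMap.norm_compContinuousLinearMap_le _ _).trans ?_
  simp [nd]

/-- Tame bound for the top derivative of a composition. -/
theorem nd_comp_tame {K : ℕ} (hK : 2 ≤ K) {f : F → G} {φ : E → F} (hf : Smooth f)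
    (hφ : Smooth φ) (x : E) {a b c : ℝ} (hb : 0 < b)
    (hfb : ∀ i, 1 ≤ i → i < K → nd i f (φ x) ≤ b) (hfa : nd K f (φ x) ≤ a)
    (hφ1 : ∀ i, 1 ≤ i → i < K → nd i φ x ≤ 2) (hφK : nd K φ x ≤ 2 * c) :
    nd K (f ∘ φ) x ≤ K.factorial * 2 ^ K * max b (max a (b * c)) := by
  set m : ℝ := max 1 (max (a / b) c) with hm
  have hm1 : 1 ≤ m := le_max_left _ _
  set l : ℝ := m ^ (((K - 1 : ℕ) : ℝ)⁻¹) with hl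
  have hl1 : 1 ≤ l := Real.one_le_rpow hm1 (by positivity)
  have hl0 : 0 < l := by linarith
  have hlm : l ^ (K - 1) = m := Real.rpow_inv_natCast_pow (by linarith) (by omega)
  have hlK : l ^ K = m * l := by
    conv_lhs => rw [show K = (K - 1) + 1 by omega]
    rw [pow_succ, hlm]
  have hmb : m * b = max b (max a (b * c)) := by
    rw [hm, max_mul_of_nonneg _ _ hb.le, max_mul_of_nonneg _ _ hb.le, one_mul,
      div_mul_cancel₀ _ hb.ne', mul_comm c b]
  set g : F → G := fun y => f (l⁻¹ • y) - f (φ x) with hg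
  set ψ : E → F := fun y => l • φ y with hψ
  have hfl : Smooth (fun y => f (l⁻¹ • y)) := hf.comp (contDiff_const_smul _)
  have hgs : Smooth g := hfl.sub contDiff_const
  have hψs : Smooth ψ := hφ.const_smul l
  have hψx : l⁻¹ • ψ x = φ x := by simp [hψ, smul_smul, inv_mul_cancel₀ hl0.ne']
  have hcomp : g ∘ ψ = fun y => (f ∘ φ) y - f (φ x) := by
    funext y; simp [hg, hψ, smul_smul, inv_mul_cancel₀ hl0.ne']
  have key := norm_iteratedFDeriv_comp_le (hgs.nat K) (hψs.nat K) le_rfl x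
    (C := l⁻¹ * b) (D := 2 * l) (n := K) ?_ ?_
  · rw [hcomp] at key
    have e := nd_sub_const (hf.comp hφ) (f (φ x)) (n := K) (by omega) x
    change nd K (fun y => (f ∘ φ) y - f (φ x)) x ≤ _ at key
    rw [e] at key
    refine key.trans (le_of_eq ?_)
    rw [mul_pow, hlK, ← hmb]; field_simp
  · intro i hi
    rcases Nat.eq_zero_or_pos i with rfl | hi0
    · simp only [hg, norm_iteratedFDeriv_zero, hψx, sub_self, norm_zero]; positivity
    change nd i g (ψ x) ≤ _
    rw [hg, nd_sub_const hfl _ hi0, nd_comp_smul hf, hψx, abs_of_pos (by positivity)]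
    rcases hi.lt_or_eq with h | rfl
    · calc l⁻¹ ^ i * nd i f (φ x) ≤ l⁻¹ ^ 1 * b := by
            refine mul_le_mul ?_ (hfb i hi0 h) (nd_nonneg _ _ _) (by positivity)
            exact pow_le_pow_of_le_one (by positivity) (inv_le_one_of_one_le₀ hl1) hi0
        _ = _ := by rw [pow_one]
    · have h1 : a ≤ m * b := by rw [hmb]; exact (le_max_left _ _).trans (le_max_right _ _)
      calc l⁻¹ ^ i * nd i f (φ x) ≤ l⁻¹ ^ i * (m * b) := by gcongr; exact hfa.trans h1
        _ = l⁻¹ * b := by rw [inv_pow, hlK]; have : m ≠ 0 := by linarith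
                          field_simp
  · intro i hi0 hi
    change nd i ψ x ≤ _
    rw [hψ, nd_const_smul hφ, abs_of_pos hl0]
    rcases hi.lt_or_eq with h | rfl
    · calc l * nd i φ x ≤ l * 2 := by gcongr; exact hφ1 i hi0 h
        _ = (2 * l) ^ 1 := by ring
        _ ≤ _ := pow_le_pow_right₀ (by linarith) hi0
    · have hcm : c ≤ m := (le_max_right _ _).trans (le_max_right _ _)
      calc l * nd i φ x ≤ l * (2 * m) := by gcongr; linarith
        _ = 2 ^ 1 * (m * l) := by ring
        _ ≤ 2 ^ i * (m * l) := by
          gcongr; · norm_num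
        _ = _ := by rw [mul_pow, hlK]

end Calculus

section Tame

variable {E F : Type*} [NormedAddCommGroup E] [NormedSpace ℝ E]
  [NormedAddCommGroup F] [NormedSpace ℝ F]

/-- The constant in the composition estimates. -/
def compC (K : ℕ) : ℝ := K.factorial * 2 ^ K

lemma compC_mono {i K : ℕ} (h : i ≤ K) : compC i ≤ compC K := by
  unfold compC
  gcongr
  norm_num

lemma two_le_compC {K : ℕ} (h : 1 ≤ K) : 2 ≤ compC K := by
  have := compC_mono h
  simpa [compC] using this

lemma nd_one_comp_le {G : Type*} [NormedAddCommGroup G] [NormedSpace ℝ G]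
    {f : F → G} {φ : E → F} (hf : Smooth f) (hφ : Smooth φ) (x : E) :
    nd 1 (fun y => f (φ y)) x ≤ nd 1 f (φ x) * nd 1 φ x := by
  rw [nd_one, nd_one, nd_one]
  have h : fderiv ℝ (f ∘ φ) x = _ :=
    fderiv_comp x (hf.differentiable (by simp)).differentiableAt
      (hφ.differentiable (by simp)).differentiableAt
  change ‖fderiv ℝ (f ∘ φ) x‖ ≤ _
  rw [h]
  exact ContinuousLinearMap.opNorm_comp_le _ _

lemma nd_id_one (x : E) : nd 1 (fun y : E => y) x ≤ 1 := by
  rw [nd_one, fderiv_fun_id]; exact ContinuousLinearMap.norm_id_le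

lemma nd_clm (L : E →L[ℝ] F) {i : ℕ} (hi : 2 ≤ i) (x : E) : nd i (fun y : E => L y) x = 0 := by
  obtain ⟨j, rfl⟩ : ∃ j, i = j + 1 := ⟨i - 1, by omega⟩
  rw [← nd_fderiv]
  have : fderiv ℝ (fun y : E => L y) = fun _ => L := by ext y; simp
  rw [this, nd_const _ (by omega)]

lemma nd_id {i : ℕ} (hi : 2 ≤ i) (x : E) : nd i (fun y : E => y) x = 0 :=
  nd_clm (ContinuousLinearMap.id ℝ E) hi x

lemma nd_id_add_one {w : E → E} (hw : Smooth w) (x : E) :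
    nd 1 (fun y => y + w y) x ≤ 1 + nd 1 w x :=
  (nd_add_le contDiff_id hw 1 x).trans (by gcongr; exact nd_id_one x)

lemma nd_id_add {w : E → E} (hw : Smooth w) {i : ℕ} (hi : 2 ≤ i) (x : E) :
    nd i (fun y => y + w y) x ≤ nd i w x :=
  (nd_add_le contDiff_id hw i x).trans (by rw [show nd i id x = 0 from nd_id hi x, zero_add])

lemma nd_comp_disp_tame {K : ℕ} (hK : 2 ≤ K) {f : E → F} {w : E → E} (hf : Smooth f)
    (hw : Smooth w) (x : E) {a b c : ℝ} (hb : 0 < b)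
    (hfb : ∀ i, 1 ≤ i → i < K → nd i f (x + w x) ≤ b) (hfa : nd K f (x + w x) ≤ a)
    (hw1 : ∀ i, 1 ≤ i → i < K → nd i w x ≤ 1) (hwK : nd K w x ≤ c) :
    nd K (fun y => f (y + w y)) x ≤ compC K * max b (max a (b * c)) := by
  refine nd_comp_tame hK hf (φ := fun y => y + w y) (contDiff_id.add hw) x hb hfb hfa ?_ ?_
  · intro i h1 hi
    rcases h1.lt_or_eq with h | rfl
    · exact (nd_id_add hw h x).trans ((hw1 i h1 hi).trans one_le_two)
    · exact (nd_id_add_one hw x).trans (by linarith [hw1 1 le_rfl hi])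
  · have := nd_id_add hw hK x
    linarith [nd_nonneg K w x]

lemma nd_comp_disp {n : ℕ} (hn : 1 ≤ n) {f : E → F} {w : E → E} (hf : Smooth f)
    (hw : Smooth w) (x : E) {b : ℝ} (hb : 0 < b)
    (hfb : ∀ i, 1 ≤ i → i ≤ n → nd i f (x + w x) ≤ b)
    (hw1 : ∀ i, 1 ≤ i → i ≤ n → nd i w x ≤ 1) :
    nd n (fun y => f (y + w y)) x ≤ compC n * b := by
  rcases hn.lt_or_eq with h | rfl
  · have := nd_comp_disp_tame h hf hw x (a := b) (c := 1) hb (fun i h1 hi => hfb i h1 hi.le)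
      (hfb n hn le_rfl) (fun i h1 hi => hw1 i h1 hi.le) (hw1 n hn le_rfl)
    simpa using this
  · refine (nd_one_comp_le hf (contDiff_id.add hw : Smooth fun y => y + w y) x).trans ?_
    have h1 := hfb 1 le_rfl le_rfl
    have h2 := (nd_id_add_one hw x).trans (add_le_add_right (hw1 1 le_rfl le_rfl) 1)
    calc _ ≤ b * (1 + 1) := mul_le_mul h1 h2 (nd_nonneg _ _ _) hb.le
      _ = _ := by simp [compC]; ring

/-- Derivatives of order `1 ≤ i < K` bounded by `b`, derivative of order `K` bounded by `a`. -/
def TB (K : ℕ) (b a : ℝ) (f : E → F) : Prop :=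
  ∀ x, (∀ i, 1 ≤ i → i < K → nd i f x ≤ b) ∧ nd K f x ≤ a

lemma TB.mono {K : ℕ} {b a b' a' : ℝ} {f : E → F} (h : TB K b a f) (hb : b ≤ b') (ha : a ≤ a') :
    TB K b' a' f := fun x => ⟨fun i h1 h2 => ((h x).1 i h1 h2).trans hb, (h x).2.trans ha⟩

lemma TB.plain {K : ℕ} {b : ℝ} {f : E → F} (h : TB K b b f) {i : ℕ} (hi : 1 ≤ i) (hi' : i ≤ K)
    (x : E) : nd i f x ≤ b := by
  rcases hi'.lt_or_eq with h1 | rfl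
  · exact (h x).1 i hi h1
  · exact (h x).2

lemma TB.of_plain {K : ℕ} (hK : 1 ≤ K) {b : ℝ} {f : E → F}
    (h : ∀ i, 1 ≤ i → i ≤ K → ∀ x, nd i f x ≤ b) : TB K b b f :=
  fun x => ⟨fun i h1 h2 => h i h1 h2.le x, h K hK le_rfl x⟩

lemma TB.add {K : ℕ} {b a b' a' : ℝ} {f g : E → F} (hf : Smooth f) (hg : Smooth g)
    (h : TB K b a f) (h' : TB K b' a' g) : TB K (b + b') (a + a') (fun x => f x + g x) :=
  fun x => ⟨fun i h1 h2 => (nd_add_le hf hg i x).trans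
    (add_le_add ((h x).1 i h1 h2) ((h' x).1 i h1 h2)),
    (nd_add_le hf hg K x).trans (add_le_add (h x).2 (h' x).2)⟩

lemma TB.comp_sub {K : ℕ} {b a : ℝ} {f : E → F} (h : TB K b a f) (c : E) :
    TB K b a (fun x => f (x - c)) :=
  fun x => ⟨fun i h1 h2 => by rw [nd_comp_sub]; exact (h _).1 i h1 h2,
    by rw [nd_comp_sub]; exact (h _).2⟩

lemma TB.comp_disp {K : ℕ} (hK : 2 ≤ K) {b a c : ℝ} (hb : 0 < b) (hba : b ≤ a) {f : E → F}
    {w : E → E} (hf : Smooth f) (hw : Smooth w) (h : TB K b a f) (h' : TB K 1 c w) :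
    TB K (compC K * b) (compC K * max a (b * c)) (fun x => f (x + w x)) := by
  intro x
  refine ⟨fun i h1 h2 => ?_, ?_⟩
  · refine (nd_comp_disp h1 hf hw x hb (fun j hj hj' => (h _).1 j hj (hj'.trans_lt h2))
      (fun j hj hj' => (h' _).1 j hj (hj'.trans_lt h2))).trans ?_
    gcongr
    exact compC_mono h2.le
  · refine (nd_comp_disp_tame hK hf hw x hb (h _).1 (h _).2 (h' x).1 (h' x).2).trans ?_
    refine mul_le_mul_of_nonneg_left (max_le (hba.trans (le_max_left _ _)) le_rfl) ?_
    unfold compC; positivity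

/-- Tame bound for the displacement of an inverse. -/
lemma TB.inv {K : ℕ} (hK : 2 ≤ K) {b a : ℝ} (hb : 0 < b) (hba : b ≤ a)
    (hCb : compC K * b ≤ 1 / 2) {w w' : E → E} (hw : Smooth w) (hw' : Smooth w')
    (hinv : ∀ x, w' x = - w (x + w' x)) (h : TB K b a w) :
    TB K (compC K * b) (compC K * a) w' := by
  have hC2 : 2 ≤ compC K := two_le_compC (by omega)
  have e : ∀ i x, nd i w' x = nd i (fun y => w (y + w' y)) x := by
    intro i x
    rw [← nd_neg]
    congr 2
    funext y; exact (congrArg (- ·) (hinv y)).trans (neg_neg _)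
  intro x
  have low : ∀ i, 1 ≤ i → i < K → nd i w' x ≤ compC K * b := by
    intro i
    induction i using Nat.strong_induction_on with
    | _ i ih =>
      intro h1 hi
      rcases h1.lt_or_eq with h2 | rfl
      · have key := nd_comp_disp_tame h2 hw hw' x (a := b) (c := nd i w' x) hb
          (fun j hj hj' => (h _).1 j hj (hj'.trans hi)) ((h _).1 i h1 hi)
          (fun j hj hj' => (ih j hj' hj (hj'.trans hi)).trans (by linarith)) le_rfl
        rw [← e] at key
        have hle : compC i ≤ compC K := compC_mono hi.le
        have hci : 0 ≤ compC i := by unfold compC; positivity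
        have hn := nd_nonneg i w' x
        rcases le_total (nd i w' x) 1 with hc | hc
        · have : max b (max b (b * nd i w' x)) ≤ b := by
            refine max_le le_rfl (max_le le_rfl ?_)
            nlinarith
          exact key.trans (mul_le_mul hle this (by positivity) (by linarith))
        · exfalso
          have : max b (max b (b * nd i w' x)) ≤ b * nd i w' x :=
            max_le (by nlinarith) (max_le (by nlinarith) le_rfl)
          have h3 : nd i w' x ≤ compC K * (b * nd i w' x) :=
            key.trans (mul_le_mul hle this (by positivity) (by linarith))
          nlinarith
      · have key := nd_one_comp_le hw (φ := fun y => y + w' y) (contDiff_id.add hw') x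
        rw [← e] at key
        have h3 := nd_id_add_one hw' x
        have h4 := (h (x + w' x)).1 1 le_rfl hi
        have h5 : nd 1 w' x ≤ b * (1 + nd 1 w' x) :=
          key.trans (mul_le_mul h4 h3 (nd_nonneg _ _ _) hb.le)
        have hn := nd_nonneg 1 w' x
        have : b ≤ 1 / 4 := by nlinarith
        nlinarith
  refine ⟨low, ?_⟩
  have key := nd_comp_disp_tame hK hw hw' x (a := a) (c := nd K w' x) hb (h _).1 (h _).2
    (fun i h1 h2 => (low i h1 h2).trans (by linarith)) le_rfl
  rw [← e] at key
  have hn := nd_nonneg K w' x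
  rcases le_total (b * nd K w' x) a with hc | hc
  · rwa [max_eq_left hc, max_eq_right hba] at key
  · rw [max_eq_right hc, max_eq_right (hba.trans hc)] at key
    have : nd K w' x = 0 := by nlinarith
    rw [this]; nlinarith

end Tame

section NearIdentity

variable {E : Type*} [NormedAddCommGroup E] [NormedSpace ℝ E]

lemma lipschitz_of_nd_one {F : Type*} [NormedAddCommGroup F] [NormedSpace ℝ F] {w : E → F}
    (hw : Smooth w) {c : NNReal} (h : ∀ x, nd 1 w x ≤ c) : LipschitzWith c w := by
  refine lipschitzWith_of_nnnorm_fderiv_le (hw.differentiable (by simp)) fun x => ?_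
  have := h x
  rw [nd_one] at this
  exact_mod_cast this

lemma norm_sub_le_of_nd_one {F : Type*} [NormedAddCommGroup F] [NormedSpace ℝ F] {w : E → F}
    (hw : Smooth w) {c : ℝ} (h : ∀ x, nd 1 w x ≤ c) (x y : E) :
    ‖w x - w y‖ ≤ c * ‖x - y‖ := by
  have hc : 0 ≤ c := (nd_nonneg _ _ _).trans (h x)
  have := (lipschitz_of_nd_one (c := ⟨c, hc⟩) hw h).dist_le_mul x y
  rwa [dist_eq_norm, dist_eq_norm] at this

variable [CompleteSpace E]

lemma bijective_id_add {w : E → E} (hw : Smooth w) (h : ∀ x, nd 1 w x ≤ 1 / 2) :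
    Function.Bijective fun x => x + w x := by
  rcases subsingleton_or_nontrivial E with hE | hE
  · exact ⟨Function.injective_of_subsingleton _, fun y => ⟨y, Subsingleton.elim _ _⟩⟩
  have hl : LipschitzWith (1 / 2) w := lipschitz_of_nd_one hw (by simpa using h)
  have ha : ApproximatesLinearOn (fun x => x + w x)
      ((ContinuousLinearEquiv.refl ℝ E : E ≃L[ℝ] E) : E →L[ℝ] E) univ (1 / 2) := by
    rw [ApproximatesLinearOn.approximatesLinearOn_iff_lipschitzOnWith]
    convert hl.lipschitzOnWith (s := univ) using 1
    funext x; simp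
  have hc : (1 / 2 : NNReal) < ‖(((ContinuousLinearEquiv.refl ℝ E).symm : E ≃L[ℝ] E) : E →L[ℝ] E)‖₊⁻¹ := by
    have : ‖(((ContinuousLinearEquiv.refl ℝ E).symm : E ≃L[ℝ] E) : E →L[ℝ] E)‖₊ = 1 := by
      ext; exact ContinuousLinearMap.norm_id
    rw [this]; norm_num
  exact ⟨injOn_univ.mp (ha.injOn (Or.inr hc)), ha.surjective (Or.inr hc)⟩

lemma smooth_symm_of_near_id {F : Equiv.Perm E} {w : E → E} (hF : ∀ x, F x = x + w x)
    (hw : Smooth w) (h : ∀ x, nd 1 w x ≤ 1 / 2) : Smooth F.symm := by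
  have hFs : Smooth F := by
    have : (F : E → E) = fun x => x + w x := funext hF
    rw [this]; exact contDiff_id.add hw
  have hl : LipschitzWith 2 F.symm := by
    refine LipschitzWith.of_dist_le_mul fun x y => ?_
    have h1 := hF (F.symm x)
    have h2 := hF (F.symm y)
    rw [F.apply_symm_apply] at h1 h2
    have h3 := norm_sub_le_of_nd_one hw h (F.symm x) (F.symm y)
    rw [dist_eq_norm, dist_eq_norm]
    have h4 : F.symm x - F.symm y = (x - y) - (w (F.symm x) - w (F.symm y)) := by
      conv_rhs => rw [h1, h2]
      simp only [← h1, ← h2]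
      rw [h1, h2]; simp only [← hF, Equiv.symm_apply_apply]
      rw [hF, hF]; abel
    have h5 := norm_sub_le (x - y) (w (F.symm x) - w (F.symm y))
    rw [← h4] at h5
    push_cast
    linarith
  let H : E ≃ₜ E := ⟨F, hFs.continuous, hl.continuous⟩
  have hd : ∀ x, ∃ L : E ≃L[ℝ] E, HasFDerivAt F (L : E →L[ℝ] E) x := by
    intro x
    have h1 : ‖-fderiv ℝ w x‖ < 1 := by
      have := h x; rw [nd_one] at this; rw [norm_neg]; linarith
    refine ⟨ContinuousLinearEquiv.unitsEquiv ℝ E (Units.oneSub _ h1), ?_⟩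
    have h2 : HasFDerivAt (fun x => x + w x) (ContinuousLinearMap.id ℝ E + fderiv ℝ w x) x :=
      (hasFDerivAt_id x).add (hw.differentiable (by simp) x).hasFDerivAt
    have e1 : (F : E → E) = fun x => x + w x := funext hF
    rw [e1]
    convert h2 using 1
    ext v
    simp
  choose L hL using hd
  exact H.contDiff_symm hL hFs

end NearIdentity

section Diffeo

variable {E : Type*} [NormedAddCommGroup E] [NormedSpace ℝ E]

/-- Diffeomorphisms that are the identity outside a bounded set. -/
def IsD (F : Equiv.Perm E) : Prop :=
  Smooth F ∧ Smooth F.symm ∧ ∃ R : ℝ, ∀ x, R < ‖x‖ → F x = x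

lemma IsD.one : IsD (1 : Equiv.Perm E) := ⟨contDiff_id, contDiff_id, 0, fun _ _ => rfl⟩

lemma IsD.mul {F G : Equiv.Perm E} (hF : IsD F) (hG : IsD G) : IsD (F * G) := by
  obtain ⟨h1, h2, R, h3⟩ := hF
  obtain ⟨k1, k2, R', k3⟩ := hG
  refine ⟨h1.comp k1, k2.comp h2, max R R', fun x hx => ?_⟩
  rw [Equiv.Perm.mul_apply, k3 x ((le_max_right _ _).trans_lt hx),
    h3 x ((le_max_left _ _).trans_lt hx)]

lemma IsD.inv {F : Equiv.Perm E} (hF : IsD F) : IsD F⁻¹ := by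
  obtain ⟨h1, h2, R, h3⟩ := hF
  refine ⟨h2, h1, R, fun x hx => ?_⟩
  rw [Equiv.Perm.inv_eq_iff_eq, h3 x hx]

lemma IsD.conj {F G : Equiv.Perm E} (hF : IsD F) (hG : IsD G) : IsD (F * G * F⁻¹) :=
  (hF.mul hG).mul hF.inv

/-- All derivatives of order at most `r` are bounded by `ε`. -/
def sm {F : Type*} [NormedAddCommGroup F] [NormedSpace ℝ F] (r : ℕ) (ε : ℝ) (w : E → F) : Prop :=
  ∀ i ≤ r, ∀ x, nd i w x ≤ ε

end Diffeo

section Fiber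

variable {V : Type*} [NormedAddCommGroup V] [InnerProductSpace ℝ V]

/-- The coordinate in the direction `e`. -/
def yc (e : V) : V →L[ℝ] ℝ := innerSL ℝ e

/-- The orthogonal projection along `e`. -/
def pr (e : V) : V →L[ℝ] V := ContinuousLinearMap.id ℝ V - (yc e).smulRight e

lemma pr_apply (e w : V) : pr e w = w - yc e w • e := by simp [pr]

lemma pr_add_yc (e w : V) : pr e w + yc e w • e = w := by simp [pr_apply]

variable (e : V) [he : Fact (‖e‖ = 1)]

lemma yc_self : yc e e = 1 := by simp [yc, he.out]

lemma norm_yc_le : ‖yc e‖ ≤ 1 := by rw [yc, innerSL_apply_norm, he.out]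

lemma abs_yc_le (w : V) : |yc e w| ≤ ‖w‖ := by
  simpa using (yc e).le_of_opNorm_le (norm_yc_le e) w

variable {e} in
lemma yc_add_smul (w : V) (t : ℝ) : yc e (w + t • e) = yc e w + t := by simp [yc_self]

variable {e} in
lemma pr_add_smul (w : V) (t : ℝ) : pr e (w + t • e) = pr e w := by
  rw [pr_apply, pr_apply, yc_add_smul, add_smul]; abel

variable {e} in
lemma yc_sub_smul (w : V) (t : ℝ) : yc e (w - t • e) = yc e w - t := by simp [yc_self]

variable {e} in
lemma pr_sub_smul (w : V) (t : ℝ) : pr e (w - t • e) = pr e w := by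
  rw [sub_eq_add_neg, ← neg_smul, pr_add_smul]

@[simp] lemma yc_pr (w : V) : yc e (pr e w) = 0 := by simp [pr_apply, yc_self]

@[simp] lemma pr_pr (w : V) : pr e (pr e w) = pr e w := by
  rw [pr_apply e (pr e w), yc_pr]; simp

lemma norm_pr_sq (w : V) : ‖w‖ ^ 2 = ‖pr e w‖ ^ 2 + yc e w ^ 2 := by
  have h : inner ℝ (pr e w) (yc e w • e) = 0 := by
    rw [inner_smul_right, real_inner_comm]
    have : inner ℝ e (pr e w) = 0 := yc_pr e w
    rw [this, mul_zero]
  have := norm_add_sq_real (pr e w) (yc e w • e)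
  rw [pr_add_yc, h, norm_smul, he.out] at this
  rw [this]; simp

lemma norm_pr_apply_le (w : V) : ‖pr e w‖ ≤ ‖w‖ := by
  have := norm_pr_sq e w
  exact abs_le_of_sq_le_sq' (by nlinarith [sq_nonneg (yc e w)]) (norm_nonneg _) |>.2

lemma norm_pr_le : ‖pr e‖ ≤ 1 :=
  ContinuousLinearMap.opNorm_le_bound _ zero_le_one fun w => by
    simpa using norm_pr_apply_le e w

omit he in
lemma norm_le_pr_add_yc [he : Fact (‖e‖ = 1)] (w : V) : ‖w‖ ≤ ‖pr e w‖ + |yc e w| := by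
  conv_lhs => rw [← pr_add_yc e w]
  refine (norm_add_le _ _).trans ?_
  rw [norm_smul, he.out, mul_one, Real.norm_eq_abs]

/-- The displacement of a family of permutations of the lines parallel to `e`. -/
def dis (a : V → Equiv.Perm ℝ) (w : V) : ℝ := a (pr e w) (yc e w) - yc e w

/-- The permutation of `V` induced by a family of permutations of the lines parallel to `e`. -/
def act : (V → Equiv.Perm ℝ) →* Equiv.Perm V where
  toFun a :=
    { toFun := fun w => pr e w + a (pr e w) (yc e w) • e
      invFun := fun w => pr e w + (a (pr e w)).symm (yc e w) • e
      left_inv := fun w => by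
        simp only [pr_add_smul, yc_add_smul, pr_pr, yc_pr, zero_add, Equiv.symm_apply_apply,
          pr_add_yc]
      right_inv := fun w => by
        simp only [pr_add_smul, yc_add_smul, pr_pr, yc_pr, zero_add, Equiv.apply_symm_apply,
          pr_add_yc] }
  map_one' := by ext w; simp [pr_add_yc]
  map_mul' a b := by
    ext w
    simp only [Equiv.coe_fn_mk, Equiv.Perm.mul_apply, Pi.mul_apply, pr_add_smul, yc_add_smul,
      pr_pr, yc_pr, zero_add]

lemma act_apply' (a : V → Equiv.Perm ℝ) (w : V) :
    act e a w = pr e w + a (pr e w) (yc e w) • e := rfl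

lemma act_apply (a : V → Equiv.Perm ℝ) (w : V) : act e a w = w + dis e a w • e := by
  rw [act_apply', dis, sub_smul]
  conv_rhs => enter [1]; rw [← pr_add_yc e w]
  abel

lemma act_symm_apply (a : V → Equiv.Perm ℝ) (w : V) :
    (act e a).symm w = w + dis e a⁻¹ w • e := by
  rw [← act_apply, map_inv]; rfl

lemma dis_one (w : V) : dis e 1 w = 0 := by simp [dis]

lemma dis_mul (a b : V → Equiv.Perm ℝ) (w : V) :
    dis e (a * b) w = dis e b w + dis e a (w + dis e b w • e) := by
  simp only [dis, pr_add_smul, yc_add_smul, Pi.mul_apply, Equiv.Perm.mul_apply]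
  simp

lemma dis_inv (a : V → Equiv.Perm ℝ) (w : V) :
    dis e a⁻¹ w = - dis e a (w + dis e a⁻¹ w • e) := by
  have := dis_mul e a a⁻¹ w
  rw [mul_inv_cancel, dis_one] at this
  linarith

lemma apply_pr (a : V → Equiv.Perm ℝ) (z : V) (y : ℝ) :
    a (pr e z) y = y + dis e a (pr e z + y • e) := by
  simp [dis, pr_add_smul, yc_add_smul]

/-- Fiberwise smooth families. -/
def FSm (a : V → Equiv.Perm ℝ) : Prop := Smooth (dis e a) ∧ Smooth (dis e a⁻¹)

variable {e}

lemma smooth_add_smul {u : V → ℝ} (hu : Smooth u) : Smooth fun w => w + u w • e :=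
  contDiff_id.add (hu.smul contDiff_const)

lemma FSm.one : FSm e 1 := by
  have : dis e 1 = fun _ => 0 := funext (dis_one e)
  refine ⟨?_, ?_⟩ <;> simp only [inv_one, this] <;> exact contDiff_const

lemma FSm.inv {a : V → Equiv.Perm ℝ} (h : FSm e a) : FSm e a⁻¹ := ⟨h.2, by simpa using h.1⟩

lemma FSm.mul {a b : V → Equiv.Perm ℝ} (ha : FSm e a) (hb : FSm e b) : FSm e (a * b) := by
  have key : ∀ a b : V → Equiv.Perm ℝ, Smooth (dis e a) → Smooth (dis e b) →
      Smooth (dis e (a * b)) := by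
    intro a b ha hb
    have : dis e (a * b) = fun w => dis e b w + dis e a (w + dis e b w • e) :=
      funext (dis_mul e a b)
    rw [this]
    exact hb.add (ha.comp (smooth_add_smul hb))
  exact ⟨key _ _ ha.1 hb.1, by rw [mul_inv_rev]; exact key _ _ hb.2 ha.2⟩

lemma FSm.smooth {a : V → Equiv.Perm ℝ} (h : FSm e a) :
    Smooth (act e a) ∧ Smooth (act e a).symm := by
  refine ⟨?_, ?_⟩
  · have : (act e a : V → V) = fun w => w + dis e a w • e := funext (act_apply e a)
    rw [this]; exact smooth_add_smul h.1
  · have : ((act e a).symm : V → V) = fun w => w + dis e a⁻¹ w • e := funext (act_symm_apply e a)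
    rw [this]; exact smooth_add_smul h.2

lemma FSm.isD {a : V → Equiv.Perm ℝ} (h : FSm e a) {R : ℝ}
    (hR : ∀ w, R < ‖w‖ → dis e a w = 0) : IsD (act e a) :=
  ⟨h.smooth.1, h.smooth.2, R, fun w hw => by rw [act_apply, hR w hw]; simp⟩

lemma nd_smul_e {F : Type*} [NormedAddCommGroup F] [NormedSpace ℝ F] {u : F → ℝ} (hu : Smooth u)
    (n : ℕ) (x : F) : nd n (fun y => u y • e) x ≤ nd n u x := by
  have := nd_clm_comp_le (ContinuousLinearMap.toSpanSingleton ℝ e) hu n x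
  simp only [ContinuousLinearMap.toSpanSingleton_apply,
    ContinuousLinearMap.norm_toSpanSingleton, he.out, one_mul] at this
  exact this

lemma nd_line_le {u : V → ℝ} (hu : Smooth u) (z : V) (n : ℕ) (y : ℝ) :
    nd n (fun t : ℝ => u (z + t • e)) y ≤ nd n u (z + y • e) := by
  have h1 : Smooth fun v => u (v + z) := hu.comp (contDiff_id.add contDiff_const)
  have := nd_comp_clm_le (ContinuousLinearMap.toSpanSingleton ℝ e) h1 n y
  simp only [ContinuousLinearMap.toSpanSingleton_apply,
    ContinuousLinearMap.norm_toSpanSingleton, he.out, one_pow, one_mul, nd_comp_add u z] at this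
  simpa only [add_comm] using this

lemma bijective_line {u : V → ℝ} (hu : Smooth u) (h : ∀ x, nd 1 u x ≤ 1 / 2) (z : V) :
    Function.Bijective fun y : ℝ => y + u (z + y • e) :=
  bijective_id_add (w := fun y : ℝ => u (z + y • e))
    (hu.comp (contDiff_const.add (contDiff_id.smul contDiff_const)))
    fun y => (nd_line_le hu z 1 y).trans (h _)

variable (e) in
open Classical in
/-- The family of permutations of the lines parallel to `e` with displacement `u`. -/
def fib (u : V → ℝ) (z : V) : Equiv.Perm ℝ :=
  if h : Function.Bijective fun y : ℝ => y + u (pr e z + y • e) then Equiv.ofBijective _ h else 1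

lemma fib_apply {u : V → ℝ} (hu : Smooth u) (h : ∀ x, nd 1 u x ≤ 1 / 2) (z : V) (y : ℝ) :
    fib e u z y = y + u (pr e z + y • e) := by
  rw [fib, dif_pos (bijective_line hu h _)]; rfl

lemma dis_fib {u : V → ℝ} (hu : Smooth u) (h : ∀ x, nd 1 u x ≤ 1 / 2) : dis e (fib e u) = u := by
  funext w
  rw [dis, fib_apply hu h, pr_pr, pr_add_yc]; ring

lemma FSm_fib [CompleteSpace V] {u : V → ℝ} (hu : Smooth u) (h : ∀ x, nd 1 u x ≤ 1 / 2) :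
    FSm e (fib e u) := by
  have h1 : ∀ w, act e (fib e u) w = w + u w • e := fun w => by rw [act_apply, dis_fib hu h]
  have h2 := smooth_symm_of_near_id h1 (hu.smul contDiff_const)
    fun x => (nd_smul_e hu 1 x).trans (h x)
  refine ⟨by rwa [dis_fib hu h], ?_⟩
  have : dis e (fib e u)⁻¹ = fun w => yc e ((act e (fib e u)).symm w) - yc e w := by
    funext w; rw [act_symm_apply, yc_add_smul]; ring
  rw [this]
  exact ((yc e).contDiff.comp h2).sub (yc e).contDiff

end Fiber

section StageAlgebra

lemma pinv_self {α : Type*} (a : Equiv.Perm α) (x : α) : a⁻¹ (a x) = x := a.symm_apply_apply x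

lemma pself_inv {α : Type*} (a : Equiv.Perm α) (x : α) : a (a⁻¹ x) = x := a.apply_symm_apply x

/-- The word expressing the rolled-up diffeomorphism. -/
def xword {G : Type*} [Group G] (S C₂ C₄ E s Ω : G) : G :=
  E * (Ω⁻¹ * (s * (S * s * S⁻¹))⁻¹ * Ω) * (C₂ * s * C₂⁻¹) * (C₄ * s * C₄⁻¹)

lemma commutator_prod {G : Type*} [Group G] {t g o o₁ o₂ : G}
    (h0 : Commute (g * t * g⁻¹ * t⁻¹) o) (h1 : Commute (g * t * g⁻¹ * t⁻¹) o₁)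
    (h2 : Commute (g * t * g⁻¹ * t⁻¹) o₂) (k1 : Commute (o⁻¹ * t * o * t⁻¹) o₁)
    (k2 : Commute (o⁻¹ * t * o * t⁻¹) o₂) (m : Commute (o₁ * t * o₁⁻¹ * t⁻¹) o₂) :
    (o₂ * o₁ * o⁻¹ * g) * t * (o₂ * o₁ * o⁻¹ * g)⁻¹ * t⁻¹ =
      (g * t * g⁻¹ * t⁻¹) * (o⁻¹ * t * o * t⁻¹) * (o₁ * t * o₁⁻¹ * t⁻¹) *
        (o₂ * t * o₂⁻¹ * t⁻¹) := by
  have e1 : (o₂ * o₁ * o⁻¹ * g) * t * (o₂ * o₁ * o⁻¹ * g)⁻¹ * t⁻¹ =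
      o₂ * o₁ * o⁻¹ * (g * t * g⁻¹ * t⁻¹) * t * o * o₁⁻¹ * o₂⁻¹ * t⁻¹ := by group
  rw [e1, ((h2.mul_right h1).mul_right h0.inv_right).symm.eq]
  have e2 : (g * t * g⁻¹ * t⁻¹) * (o₂ * o₁ * o⁻¹) * t * o * o₁⁻¹ * o₂⁻¹ * t⁻¹ =
    (g * t * g⁻¹ * t⁻¹) * ((o₂ * o₁) * (o⁻¹ * t * o * t⁻¹)) * t * o₁⁻¹ * o₂⁻¹ * t⁻¹ := by group
  rw [e2, (k2.mul_right k1).symm.eq]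
  have e3 : (g * t * g⁻¹ * t⁻¹) * ((o⁻¹ * t * o * t⁻¹) * (o₂ * o₁)) * t * o₁⁻¹ * o₂⁻¹ * t⁻¹ =
    (g * t * g⁻¹ * t⁻¹) * (o⁻¹ * t * o * t⁻¹) * (o₂ * (o₁ * t * o₁⁻¹ * t⁻¹)) * t * o₂⁻¹ * t⁻¹ := by
    group
  rw [e3, m.symm.eq]; group

/-- The permutation `a` fixes all points outside `I`. -/
def Sup {α : Type*} (a : Equiv.Perm α) (I : Set α) : Prop := ∀ y, y ∉ I → a y = y

lemma Sup.commute {α : Type*} {a b : Equiv.Perm α} {I J : Set α} (ha : Sup a I) (hb : Sup b J)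
    (h : Disjoint I J) : Commute a b :=
  Equiv.Perm.Disjoint.commute fun y => by
    by_cases hy : y ∈ I
    · exact Or.inr (hb y (Set.disjoint_left.mp h hy))
    · exact Or.inl (ha y hy)

lemma Sup.conj {α : Type*} {a c : Equiv.Perm α} {I J : Set α} (ha : Sup a I)
    (h : ∀ y ∈ I, c y ∈ J) : Sup (c * a * c⁻¹) J := fun y hy => by
  have : c⁻¹ y ∉ I := fun hI => hy (by simpa only [pself_inv] using h _ hI)
  rw [Equiv.Perm.mul_apply, Equiv.Perm.mul_apply, ha _ this, pself_inv]

lemma Sup.inv {α : Type*} {a : Equiv.Perm α} {I : Set α} (ha : Sup a I) : Sup a⁻¹ I :=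
  fun y hy => by rw [Equiv.Perm.inv_eq_iff_eq, ha y hy]

lemma Sup.mono {α : Type*} {a : Equiv.Perm α} {I J : Set α} (ha : Sup a I) (h : I ⊆ J) :
    Sup a J := fun y hy => ha y fun hI => hy (h hI)

/-- Translation of the line. -/
abbrev tr (t : ℝ) : Equiv.Perm ℝ := Equiv.addRight t

/-- Doubling on the line. -/
abbrev dbl : Equiv.Perm ℝ := Equiv.mulLeft₀ (2 : ℝ) two_ne_zero

lemma tr_inv_apply (t y : ℝ) : (tr t)⁻¹ y = y - t := by
  rw [Equiv.Perm.inv_eq_iff_eq]; simp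

variable {g o : Equiv.Perm ℝ} {a : ℝ}

/-- Conditions on `o` making it a translation far to the right, and trivial on the left. -/
structure HalfTr (o : Equiv.Perm ℝ) (a : ℝ) : Prop where
  left : ∀ y ≤ 0, o y = y
  right : ∀ y, 1 / 4 ≤ y → o y = y + a
  disp : ∀ y, |o y - y| ≤ 1 / 4

lemma HalfTr.sup (h : HalfTr o a) : Sup o (Ioi 0) := fun y hy => h.left y (not_lt.mp hy)

lemma HalfTr.inv_apply (h : HalfTr o a) {y : ℝ} (hy : 1 / 2 ≤ y) : o⁻¹ y = y - a := by
  obtain ⟨x, rfl⟩ := o.surjective y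
  have := abs_le.mp (h.disp x)
  have h2 := h.right x (by linarith)
  rw [pinv_self]; linarith

lemma HalfTr.a_le (h : HalfTr o a) : |a| ≤ 1 / 4 := by
  have := h.disp 1
  rwa [h.right 1 (by norm_num), add_sub_cancel_left] at this

lemma HalfTr.sup_comm (h : HalfTr o a) {t : ℝ} (ht : 0 ≤ t) :
    Sup (o * tr t * o⁻¹ * (tr t)⁻¹) (Ioo 0 (t + 1 / 2)) := fun y hy => by
  simp only [Equiv.Perm.mul_apply, tr_inv_apply]
  rcases le_or_gt y 0 with h0 | h0
  · have : o⁻¹ (y - t) = y - t := h.sup.inv _ (by simp; linarith)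
    rw [this]; simp [h.left y h0]
  · have h1 : t + 1 / 2 ≤ y := by
      by_contra hc; exact hy ⟨h0, not_le.mp hc⟩
    have h2 := abs_le.mp h.a_le
    rw [h.inv_apply (by linarith)]
    simp only [Equiv.coe_addRight]
    rcases le_or_gt (1/4) t with h3 | h3
    · rw [h.right _ (by linarith)]; ring
    · obtain ⟨x, hx⟩ := o.surjective (y - t)
      have h4 := abs_le.mp (h.disp x)
      rw [h.right _ (by linarith)]; ring

lemma HalfTr.sup_comm_inv (h : HalfTr o a) :
    Sup (o⁻¹ * tr 1 * o * (tr 1)⁻¹) (Ioo 0 2) := fun y hy => by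
  simp only [Equiv.Perm.mul_apply, tr_inv_apply]
  rcases le_or_gt y 0 with h0 | h0
  · rw [h.left _ (by linarith)]
    simpa using h.sup.inv y (by simpa using h0)
  · have h1 : 2 ≤ y := by
      by_contra hc; exact hy ⟨h0, not_le.mp hc⟩
    have h2 := abs_le.mp h.a_le
    rw [h.right _ (by linarith)]
    simp only [Equiv.coe_addRight]
    rw [h.inv_apply (by linarith)]; ring

/-- The compactly supported version of `o`. -/
def cut (o : Equiv.Perm ℝ) : Equiv.Perm ℝ := o * (tr 4 * o⁻¹ * (tr 4)⁻¹)

lemma HalfTr.sup_cut (h : HalfTr o a) : Sup (cut o) (Ioo 0 5) := fun y hy => by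
  simp only [cut, Equiv.Perm.mul_apply, tr_inv_apply]
  rcases le_or_gt y 0 with h0 | h0
  · have : o⁻¹ (y - 4) = y - 4 := h.sup.inv _ (by simp; linarith)
    rw [this]; simp [h.left y h0]
  · have h1 : 5 ≤ y := by
      by_contra hc; exact hy ⟨h0, not_le.mp hc⟩
    have h2 := abs_le.mp h.a_le
    rw [h.inv_apply (by linarith)]
    simp only [Equiv.coe_addRight]
    rw [h.right _ (by linarith)]; ring

/-- The two affine maps used to combine translations. -/
abbrev aff₂ : Equiv.Perm ℝ := tr 2 * dbl
/-- The two affine maps used to combine translations. -/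
abbrev aff₄ : Equiv.Perm ℝ := tr 4 * dbl

/-- The model of the asymptotic conjugacy. -/
def hmodel (g o : Equiv.Perm ℝ) : Equiv.Perm ℝ :=
  (aff₄ * o * aff₄⁻¹) * (aff₂ * o * aff₂⁻¹) * o⁻¹ * g

lemma tr_aff (t : ℝ) : tr 1 * (tr t * dbl) = (tr t * dbl) * tr (1 / 2) := by
  ext y; simp; ring

/-- Conditions on the first factor of the model. -/
structure Periodic₀ (g : Equiv.Perm ℝ) : Prop where
  left : ∀ y ≤ -3, g y = y
  right : ∀ y, -(5 / 2) ≤ y → g (y + 1) = g y + 1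
  disp : ∀ y, |g y - y| ≤ 1 / 4

lemma Periodic₀.sup_comm (h : Periodic₀ g) :
    Sup (g * tr 1 * g⁻¹ * (tr 1)⁻¹) (Ioo (-3) (-1)) := fun y hy => by
  simp only [Equiv.Perm.mul_apply, tr_inv_apply, Equiv.coe_addRight]
  rcases le_or_gt y (-3) with h0 | h0
  · have : g⁻¹ (y - 1) = y - 1 := by
      rw [Equiv.Perm.inv_eq_iff_eq, h.left _ (by linarith)]
    rw [this]; simp [h.left y h0]
  · have h1 : -1 ≤ y := by
      by_contra hc; exact hy ⟨h0, not_le.mp hc⟩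
    obtain ⟨x, hx⟩ := g.surjective (y - 1)
    have h4 := abs_le.mp (h.disp x)
    rw [← hx, pinv_self, h.right x (by linarith)]
    linarith

lemma hmodel_comm (hg : Periodic₀ g) (ho : HalfTr o a) :
    hmodel g o * tr 1 * (hmodel g o)⁻¹ * (tr 1)⁻¹ =
      xword (tr (1 / 2)) aff₂ aff₄ (g * tr 1 * g⁻¹ * (tr 1)⁻¹)
        (o * tr (1 / 2) * o⁻¹ * (tr (1 / 2))⁻¹) (cut o) := by
  have s1 : Sup (aff₂ * o * aff₂⁻¹) (Ioi 2) := ho.sup.conj fun y hy => by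
    simp only [mem_Ioi, Equiv.Perm.mul_apply, Equiv.coe_addRight, Equiv.mulLeft₀_apply] at hy ⊢
    linarith
  have s2 : Sup (aff₄ * o * aff₄⁻¹) (Ioi 4) := ho.sup.conj fun y hy => by
    simp only [mem_Ioi, Equiv.Perm.mul_apply, Equiv.coe_addRight, Equiv.mulLeft₀_apply] at hy ⊢
    linarith
  have c1 : (aff₂ * o * aff₂⁻¹) * tr 1 * (aff₂ * o * aff₂⁻¹)⁻¹ * (tr 1)⁻¹ =
      aff₂ * (o * tr (1 / 2) * o⁻¹ * (tr (1 / 2))⁻¹) * aff₂⁻¹ := by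
    have h := eq_mul_inv_of_mul_eq (tr_aff 2)
    rw [h]; group
  have c2 : (aff₄ * o * aff₄⁻¹) * tr 1 * (aff₄ * o * aff₄⁻¹)⁻¹ * (tr 1)⁻¹ =
      aff₄ * (o * tr (1 / 2) * o⁻¹ * (tr (1 / 2))⁻¹) * aff₄⁻¹ := by
    have h := eq_mul_inv_of_mul_eq (tr_aff 4)
    rw [h]; group
  have s1' : Sup ((aff₂ * o * aff₂⁻¹) * tr 1 * (aff₂ * o * aff₂⁻¹)⁻¹ * (tr 1)⁻¹) (Ioo 2 4) := by
    rw [c1]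
    refine (ho.sup_comm (by norm_num)).conj fun y hy => ?_
    simp only [mem_Ioo, Equiv.Perm.mul_apply, Equiv.coe_addRight, Equiv.mulLeft₀_apply] at hy ⊢
    constructor <;> linarith
  have d : ∀ {b c b' : ℝ}, c ≤ b' → Disjoint (Ioo b c) (Ioi b') := fun h =>
    Set.disjoint_left.mpr fun y hy hy' => by
      simp only [mem_Ioo, mem_Ioi] at hy hy'; linarith
  rw [hmodel, commutator_prod (hg.sup_comm.commute ho.sup (d (by norm_num)))
    (hg.sup_comm.commute s1 (d (by norm_num))) (hg.sup_comm.commute s2 (d (by norm_num)))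
    (ho.sup_comm_inv.commute s1 (d (by norm_num))) (ho.sup_comm_inv.commute s2 (d (by norm_num)))
    (s1'.commute s2 (d (by norm_num))), c1, c2, xword]
  congr 3
  have k1 : tr 1 = tr (1 / 2) * tr (1 / 2) := by ext y; simp; ring
  have k2 : (o * tr (1 / 2) * o⁻¹ * (tr (1 / 2))⁻¹) * (tr (1 / 2) *
      (o * tr (1 / 2) * o⁻¹ * (tr (1 / 2))⁻¹) * (tr (1 / 2))⁻¹) =
      o * tr 1 * o⁻¹ * (tr 1)⁻¹ := by rw [k1]; group
  have k3 : Sup (tr 4 * o⁻¹ * (tr 4)⁻¹) (Ioi 4) := ho.sup.inv.conj fun y hy => by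
    simp only [mem_Ioi, Equiv.coe_addRight] at hy ⊢; linarith
  have k4 := (ho.sup_comm_inv.commute k3 (d (by norm_num))).eq
  rw [k2, cut]
  have k5 : (o * (tr 4 * o⁻¹ * (tr 4)⁻¹))⁻¹ * (o * tr 1 * o⁻¹ * (tr 1)⁻¹)⁻¹ *
      (o * (tr 4 * o⁻¹ * (tr 4)⁻¹)) = (tr 4 * o⁻¹ * (tr 4)⁻¹)⁻¹ *
      ((o⁻¹ * tr 1 * o * (tr 1)⁻¹) * (tr 4 * o⁻¹ * (tr 4)⁻¹)) := by group
  rw [k5, k4]; group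

lemma hmodel_left (hg : Periodic₀ g) (ho : HalfTr o a) {y : ℝ} (hy : y ≤ -3) :
    hmodel g o y = y := by
  have h1 : ∀ t : ℝ, 2 ≤ t → ((tr t * dbl) * o * (tr t * dbl)⁻¹) y = y := fun t ht => by
    have : Sup ((tr t * dbl) * o * (tr t * dbl)⁻¹) (Ioi 0) := ho.sup.conj fun y hy => by
      simp only [mem_Ioi, Equiv.Perm.mul_apply, Equiv.coe_addRight, Equiv.mulLeft₀_apply] at hy ⊢
      linarith
    exact this y (by simp; linarith)
  have h2 : o⁻¹ y = y := ho.sup.inv y (by simp; linarith)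
  rw [hmodel, Equiv.Perm.mul_apply, hg.left y hy, Equiv.Perm.mul_apply, h2,
    Equiv.Perm.mul_apply, h1 2 le_rfl, h1 4 (by norm_num)]

lemma aff_conj_apply (o : Equiv.Perm ℝ) (t y : ℝ) :
    ((tr t * dbl) * o * (tr t * dbl)⁻¹) y = 2 * o ((y - t) / 2) + t := by
  have : (tr t * dbl)⁻¹ y = (y - t) / 2 := by
    rw [Equiv.Perm.inv_eq_iff_eq]; simp; ring
  rw [Equiv.Perm.mul_apply, this]; simp

lemma hmodel_disp (hg : Periodic₀ g) (ho : HalfTr o a) (y : ℝ) : |hmodel g o y - y| < 2 := by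
  rw [hmodel]
  simp only [Equiv.Perm.mul_apply (f := _ * _ * o⁻¹), Equiv.Perm.mul_apply (f := _ * _) (g := o⁻¹)]
  rw [Equiv.Perm.mul_apply, aff_conj_apply, aff_conj_apply]
  have h1 := abs_le.mp (hg.disp y)
  obtain ⟨x, hx⟩ := o.surjective (g y)
  rw [← hx, pinv_self]
  have h2 := abs_le.mp (ho.disp x)
  have h3 := abs_le.mp (ho.disp ((x - 2) / 2))
  have h4 := abs_le.mp (ho.disp ((2 * o ((x - 2) / 2) + 2 - 4) / 2))
  rw [abs_lt]
  constructor <;> linarith [h1.1, h1.2]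

lemma hmodel_right (hg : Periodic₀ g) (ho : HalfTr o a) {y : ℝ} (hy : 12 ≤ y) :
    hmodel g o y = g y + 3 * a := by
  have h1 := abs_le.mp (hg.disp y)
  have h2 := abs_le.mp ho.a_le
  rw [hmodel]
  simp only [Equiv.Perm.mul_apply (f := _ * _ * o⁻¹), Equiv.Perm.mul_apply (f := _ * _) (g := o⁻¹)]
  rw [Equiv.Perm.mul_apply, aff_conj_apply, aff_conj_apply, ho.inv_apply (by linarith),
    ho.right ((g y - a - 2) / 2) (by linarith), ho.right _ (by linarith)]
  ring

/-- The stage identity on one line. -/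
lemma stage_identity {h P : Equiv.Perm ℝ} (hg : Periodic₀ g) (ho : HalfTr o a)
    (hP : ∀ y, h (y + 1) = P (h y + 1)) :
    P = (h * (hmodel g o)⁻¹) * xword (tr (1 / 2)) aff₂ aff₄ (g * tr 1 * g⁻¹ * (tr 1)⁻¹)
        (o * tr (1 / 2) * o⁻¹ * (tr (1 / 2))⁻¹) (cut o) *
        (tr 1 * (h * (hmodel g o)⁻¹)⁻¹ * (tr 1)⁻¹) := by
  have h1 : h * tr 1 = P * (tr 1 * h) := by ext y; simpa using hP y
  have h2 : P = h * tr 1 * h⁻¹ * (tr 1)⁻¹ := by rw [h1]; group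
  rw [← hmodel_comm hg ho, h2]; group

lemma sup_htilde {h : Equiv.Perm ℝ} {M : ℝ} (hM : 12 ≤ M) (hg : Periodic₀ g) (ho : HalfTr o a)
    (h0 : ∀ y ≤ 0, h y = y) (h1 : ∀ y, M ≤ y → h y = g y + 3 * a) :
    Sup (h * (hmodel g o)⁻¹) (Ioo (-3) (M + 2)) := fun y hy => by
  rcases le_or_gt y (-3) with h2 | h2
  · have : (hmodel g o)⁻¹ y = y := by rw [Equiv.Perm.inv_eq_iff_eq, hmodel_left hg ho h2]
    rw [Equiv.Perm.mul_apply, this, h0 y (by linarith)]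
  · have h3 : M + 2 ≤ y := by
      by_contra hc; exact hy ⟨h2, not_le.mp hc⟩
    obtain ⟨x, rfl⟩ := (hmodel g o).surjective y
    have h4 := abs_lt.mp (hmodel_disp hg ho x)
    rw [Equiv.Perm.mul_apply, pinv_self, h1 x (by linarith),
      hmodel_right hg ho (by linarith)]

end StageAlgebra

section RollUp

variable {V : Type*} [NormedAddCommGroup V] [InnerProductSpace ℝ V] {e : V} [he : Fact (‖e‖ = 1)]

lemma smooth_of_locally {E F : Type*} [NormedAddCommGroup E] [NormedSpace ℝ E]
    [NormedAddCommGroup F] [NormedSpace ℝ F] {f : E → F}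
    (h : ∀ x, ∃ g : E → F, Smooth g ∧ f =ᶠ[nhds x] g) : Smooth f :=
  contDiff_iff_contDiffAt.mpr fun x => by
    obtain ⟨g, hg, hfg⟩ := h x
    exact hg.contDiffAt.congr_of_eventuallyEq hfg

variable (e) in
/-- Iterated composition displacement. -/
def Wseq (η : ℝ) (u : V → ℝ) : ℕ → V → ℝ
  | 0 => fun _ => 0
  | m + 1 => fun x => Wseq η u m (x - η • e) + u (x + Wseq η u m (x - η • e) • e)

variable {η : ℝ} {u : V → ℝ}

omit he in
lemma Wseq_succ (m : ℕ) (x : V) : Wseq e η u (m + 1) x =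
    Wseq e η u m (x - η • e) + u (x + Wseq e η u m (x - η • e) • e) := rfl

lemma Wseq_smooth (hu : Smooth u) (m : ℕ) : Smooth (Wseq e η u m) := by
  induction m with
  | zero => exact contDiff_const
  | succ m ih =>
    have h1 : Smooth fun x => Wseq e η u m (x - η • e) :=
      ih.comp (contDiff_id.sub contDiff_const)
    exact h1.add (hu.comp (smooth_add_smul h1))

lemma TB.smul_e {K : ℕ} {b a : ℝ} {f : V → ℝ} (hf : Smooth f) (h : TB K b a f) :
    TB K b a fun x => f x • e :=
  fun x => ⟨fun i h1 h2 => (nd_smul_e hf i x).trans ((h x).1 i h1 h2),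
    (nd_smul_e hf K x).trans (h x).2⟩

lemma Wseq_TB {K : ℕ} (hK : 2 ≤ K) {b a : ℝ} (hb : 0 < b) (hba : b ≤ a) (hu : Smooth u)
    (h : TB K b a u) {N : ℕ} (hN : N * (compC K * b) ≤ 1) :
    ∀ m ≤ N, TB K (m * (compC K * b)) (m * (compC K * a)) (Wseq e η u m) := by
  have hC := two_le_compC (K := K) (by omega)
  intro m
  induction m with
  | zero =>
    intro _ x
    have : ∀ i, nd i (Wseq e η u 0) x = 0 := fun i =>
      nd_eq_zero_of_eventually (Eventually.of_forall fun _ => rfl) i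
    simp [this]
  | succ m ih =>
    intro hm
    have h1 := (ih (by omega)).comp_sub (η • e)
    have hs : Smooth fun x => Wseq e η u m (x - η • e) :=
      (Wseq_smooth hu m).comp (contDiff_id.sub contDiff_const)
    have hmN : (m : ℝ) * (compC K * b) ≤ 1 := by
      refine le_trans ?_ hN
      have : (m : ℝ) ≤ N := by exact_mod_cast (by omega : m ≤ N)
      gcongr
    have h2 : TB K (compC K * b) (compC K * max a (b * (m * (compC K * a))))
        (fun x => u (x + Wseq e η u m (x - η • e) • e)) :=
      TB.comp_disp (w := fun x => Wseq e η u m (x - η • e) • e) hK hb hba hu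
        (hs.smul contDiff_const) h ((h1.mono hmN le_rfl).smul_e hs)
    have h3 : max a (b * (m * (compC K * a))) = a := by
      refine max_eq_left ?_
      calc b * (m * (compC K * a)) = (m * (compC K * b)) * a := by ring
        _ ≤ 1 * a := by gcongr; linarith
        _ = a := one_mul a
    rw [h3] at h2
    refine (h1.add hs (hu.comp (smooth_add_smul hs)) h2).mono (le_of_eq ?_) (le_of_eq ?_) <;>
      push_cast <;> ring

omit he in
lemma Wseq_abs_le {M : ℝ} (h : ∀ x, |u x| ≤ M) (m : ℕ) (x : V) : |Wseq e η u m x| ≤ m * M := by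
  induction m generalizing x with
  | zero => simp [Wseq]
  | succ m ih =>
    rw [Wseq_succ]
    refine (abs_add_le _ _).trans ?_
    push_cast
    linarith [ih (x - η • e), h (x + Wseq e η u m (x - η • e) • e)]

lemma Wseq_left (hη : 0 ≤ η) (hs : ∀ x, yc e x ≤ 0 → u x = 0) (m : ℕ) (x : V)
    (hx : yc e x ≤ 0) : Wseq e η u m x = 0 := by
  induction m generalizing x with
  | zero => rfl
  | succ m ih =>
    rw [Wseq_succ, ih (x - η • e) (by rw [yc_sub_smul]; linarith)]
    simp [hs x hx]

lemma Wseq_stable (hη : 0 ≤ η) (hs : ∀ x, yc e x ≤ 0 → u x = 0) (m : ℕ) (x : V)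
    (hx : yc e x ≤ m * η) : Wseq e η u (m + 1) x = Wseq e η u m x := by
  induction m generalizing x with
  | zero =>
    have hx' : yc e x ≤ 0 := by simpa using hx
    rw [Wseq_left hη hs _ x hx', Wseq_left hη hs _ x hx']
  | succ m ih =>
    have hx' : yc e (x - η • e) ≤ m * η := by
      rw [yc_sub_smul]; push_cast at hx; linarith
    rw [Wseq_succ, ih _ hx']
    rfl

lemma Wseq_stable_le (hη : 0 ≤ η) (hs : ∀ x, yc e x ≤ 0 → u x = 0) {m n : ℕ} (hmn : m ≤ n)
    (x : V) (hx : yc e x ≤ m * η) : Wseq e η u n x = Wseq e η u m x := by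
  induction n, hmn using Nat.le_induction with
  | base => rfl
  | succ n hn ih =>
    rw [Wseq_stable hη hs n x, ih]
    refine hx.trans ?_
    gcongr

lemma Wseq_line (m : ℕ) {z : V} (hz : ∀ t : ℝ, u (z + t • e) = 0) (t : ℝ) :
    Wseq e η u m (z + t • e) = 0 := by
  induction m generalizing t with
  | zero => rfl
  | succ m ih =>
    have : z + t • e - η • e = z + (t - η) • e := by rw [sub_smul]; abel
    rw [Wseq_succ, this, ih, zero_add, zero_smul, add_zero, hz]

variable (e) in
/-- The full solution of the conjugacy equation. -/
def Winf (η : ℝ) (u : V → ℝ) (x : V) : ℝ := Wseq e η u ⌈yc e x / η⌉₊ x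

lemma Winf_eq (hη : 0 < η) (hs : ∀ x, yc e x ≤ 0 → u x = 0) {m : ℕ} {x : V}
    (hx : yc e x ≤ m * η) : Winf e η u x = Wseq e η u m x := by
  have h1 : ⌈yc e x / η⌉₊ ≤ m := by
    rw [Nat.ceil_le, div_le_iff₀ hη]; exact hx
  rw [Winf, Wseq_stable_le hη.le hs h1 x]
  rw [← div_le_iff₀ hη]; exact Nat.le_ceil _

lemma Winf_left (hη : 0 < η) (hs : ∀ x, yc e x ≤ 0 → u x = 0) {x : V} (hx : yc e x ≤ 0) :
    Winf e η u x = 0 := by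
  rw [Winf_eq hη hs (m := 0) (by simpa using hx)]; rfl

lemma Winf_line {z : V} (hz : ∀ t : ℝ, u (z + t • e) = 0) (t : ℝ) :
    Winf e η u (z + t • e) = 0 := Wseq_line _ hz t

lemma Winf_eqn (hη : 0 < η) (hs : ∀ x, yc e x ≤ 0 → u x = 0) (x : V) :
    Winf e η u x = Winf e η u (x - η • e) + u (x + Winf e η u (x - η • e) • e) := by
  obtain ⟨m, hm⟩ := exists_nat_ge (yc e x / η)
  rw [div_le_iff₀ hη] at hm
  rw [Winf_eq hη hs (m := m) (x := x - η • e) (by rw [yc_sub_smul]; linarith),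
    Winf_eq hη hs (m := m + 1) (x := x) (by push_cast; linarith)]
  rfl

lemma Winf_eventually (hη : 0 < η) (hs : ∀ x, yc e x ≤ 0 → u x = 0) {m : ℕ} {x : V}
    (hx : yc e x < m * η) : Winf e η u =ᶠ[nhds x] Wseq e η u m := by
  filter_upwards [(yc e).continuous.isOpen_preimage _ isOpen_Iio |>.mem_nhds
    (show x ∈ (yc e) ⁻¹' Iio (m * η) from hx)] with y hy
  exact Winf_eq hη hs (le_of_lt hy)

lemma Winf_smooth (hη : 0 < η) (hu : Smooth u) (hs : ∀ x, yc e x ≤ 0 → u x = 0) :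
    Smooth (Winf e η u) := smooth_of_locally fun x => by
  obtain ⟨m, hm⟩ := exists_nat_gt (yc e x / η)
  rw [div_lt_iff₀ hη] at hm
  exact ⟨_, Wseq_smooth hu m, Winf_eventually hη hs hm⟩

/-- Standing assumptions for rolling up at one stage. -/
structure Roll (e : V) (A : ℕ) (M : ℝ) (u : V → ℝ) : Prop where
  one_le : 1 ≤ A
  smooth : Smooth u
  supp : ∀ x, u x ≠ 0 → 0 < yc e x ∧ yc e x < 4
  bound : ∀ x, |u x| ≤ M
  small : 6 * A * M ≤ 1 / 4

namespace Roll

variable {A : ℕ} {M : ℝ}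

omit he in
lemma left (h : Roll e A M u) (x : V) (hx : yc e x ≤ 0) : u x = 0 := by
  by_contra hc; exact absurd (h.supp x hc).1 (not_lt.mpr hx)

omit he in
lemma right (h : Roll e A M u) (x : V) (hx : 4 ≤ yc e x) : u x = 0 := by
  by_contra hc; exact absurd (h.supp x hc).2 (not_lt.mpr hx)

omit he in
lemma pos (h : Roll e A M u) : (0 : ℝ) < A := by exact_mod_cast h.one_le

omit he in
lemma eta_pos (h : Roll e A M u) : 0 < (A : ℝ)⁻¹ := inv_pos.mpr h.pos

lemma induct_shift (h : Roll e A M u) {p : V → Prop} (h0 : ∀ x, yc e x < 6 → p x)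
    (h1 : ∀ x, 5 ≤ yc e x → p (x - (A : ℝ)⁻¹ • e) → p x) (x : V) : p x := by
  have key : ∀ k : ℕ, ∀ x : V, yc e x < 6 + k * (A : ℝ)⁻¹ → p x := by
    intro k
    induction k with
    | zero => intro x hx; exact h0 x (by simpa using hx)
    | succ k ih =>
      intro x hx
      by_cases h2 : yc e x < 6
      · exact h0 x h2
      · refine h1 x (by linarith) (ih _ ?_)
        rw [yc_sub_smul]; push_cast at hx; linarith
  obtain ⟨k, hk⟩ := exists_nat_gt ((yc e x - 6) * A)
  refine key k x ?_
  have := h.pos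
  rw [← sub_lt_iff_lt_add']
  exact (lt_mul_inv_iff₀ this).mpr hk

lemma Winf_abs (h : Roll e A M u) (x : V) : |Winf e (A : ℝ)⁻¹ u x| ≤ 6 * A * M := by
  refine h.induct_shift (p := fun x => |Winf e (A : ℝ)⁻¹ u x| ≤ 6 * A * M) ?_ ?_ x
  · intro x hx
    rw [Winf_eq h.eta_pos h.left (m := 6 * A)]
    · have := Wseq_abs_le (e := e) (η := (A : ℝ)⁻¹) h.bound (6 * A) x
      push_cast at this; exact this
    · push_cast; rw [mul_assoc, mul_inv_cancel₀ h.pos.ne']; linarith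
  · intro x hx hp
    rw [Winf_eqn h.eta_pos h.left, h.right _ ?_]
    · simpa using hp
    · rw [yc_add_smul]
      have := abs_le.mp (hp.trans h.small)
      linarith

lemma Winf_shift (h : Roll e A M u) {x : V} (hx : 9 / 2 ≤ yc e x) :
    Winf e (A : ℝ)⁻¹ u x = Winf e (A : ℝ)⁻¹ u (x - (A : ℝ)⁻¹ • e) := by
  rw [Winf_eqn h.eta_pos h.left, h.right _ ?_, add_zero]
  rw [yc_add_smul]
  have := abs_le.mp ((h.Winf_abs (x - (A : ℝ)⁻¹ • e)).trans h.small)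
  linarith

lemma Winf_smooth (h : Roll e A M u) : Smooth (Winf e (A : ℝ)⁻¹ u) :=
  DiffDistortion.Winf_smooth h.eta_pos h.smooth h.left

lemma Winf_nd (h : Roll e A M u) {i : ℕ} {b : ℝ}
    (hb : ∀ x, nd i (Wseq e (A : ℝ)⁻¹ u (6 * A)) x ≤ b) (x : V) :
    nd i (Winf e (A : ℝ)⁻¹ u) x ≤ b := by
  refine h.induct_shift (p := fun x => nd i (Winf e (A : ℝ)⁻¹ u) x ≤ b) ?_ ?_ x
  · intro x hx
    rw [nd_congr (Winf_eventually h.eta_pos h.left (m := 6 * A) ?_)]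
    · exact hb x
    · push_cast; rw [mul_assoc, mul_inv_cancel₀ h.pos.ne']; linarith
  · intro x hx hp
    rw [← nd_comp_sub] at hp
    rw [nd_congr (g := fun y => Winf e (A : ℝ)⁻¹ u (y - (A : ℝ)⁻¹ • e)) ?_]
    · exact hp
    · filter_upwards [(yc e).continuous.isOpen_preimage _ isOpen_Ioi |>.mem_nhds
        (show x ∈ (yc e) ⁻¹' Ioi (9 / 2) by simp; linarith)] with y hy
      exact h.Winf_shift (le_of_lt hy)

lemma Winf_TB (h : Roll e A M u) {K : ℕ} (hK : 2 ≤ K) {b a : ℝ} (hb : 0 < b) (hba : b ≤ a)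
    (ht : TB K b a u) (hN : 6 * A * (compC K * b) ≤ 1) :
    TB K (6 * A * (compC K * b)) (6 * A * (compC K * a)) (Winf e (A : ℝ)⁻¹ u) := by
  have := Wseq_TB (e := e) (η := (A : ℝ)⁻¹) hK hb hba h.smooth ht (N := 6 * A)
    (by push_cast; exact hN) (6 * A) le_rfl
  push_cast at this
  exact fun x => ⟨fun i h1 h2 => h.Winf_nd (fun y => (this y).1 i h1 h2) x,
    h.Winf_nd (fun y => (this y).2) x⟩

lemma Winf_shift_nat (h : Roll e A M u) {x : V} (hx : 9 / 2 ≤ yc e x) (m : ℕ) :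
    Winf e (A : ℝ)⁻¹ u (x + (m * (A : ℝ)⁻¹) • e) = Winf e (A : ℝ)⁻¹ u x := by
  have := h.eta_pos
  induction m with
  | zero => simp
  | succ m ih =>
    rw [h.Winf_shift, ← ih]
    · congr 1; push_cast; rw [add_mul, add_smul]; simp; abel
    · rw [yc_add_smul]; push_cast; nlinarith [(Nat.cast_nonneg m : (0 : ℝ) ≤ m)]

end Roll

variable (e) in
/-- The periodic continuation of `Winf`. -/
def vinf (A : ℕ) (u : V → ℝ) (x : V) : ℝ :=
  Winf e (A : ℝ)⁻¹ u (x + (⌈A * (5 - yc e x)⌉₊ * (A : ℝ)⁻¹) • e)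

namespace Roll

variable {A : ℕ} {M : ℝ}

lemma vinf_eq (h : Roll e A M u) {x : V} {m : ℕ} (hm : 5 ≤ yc e x + m * (A : ℝ)⁻¹) :
    vinf e A u x = Winf e (A : ℝ)⁻¹ u (x + (m * (A : ℝ)⁻¹) • e) := by
  have h0 := h.pos
  have h1 : ⌈A * (5 - yc e x)⌉₊ ≤ m := by
    rw [Nat.ceil_le, mul_comm, ← le_mul_inv_iff₀ h0]; linarith
  obtain ⟨k, rfl⟩ := Nat.exists_eq_add_of_le h1
  have h2 : 5 - yc e x ≤ ⌈A * (5 - yc e x)⌉₊ * (A : ℝ)⁻¹ := by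
    rw [le_mul_inv_iff₀ h0, mul_comm]; exact Nat.le_ceil _
  rw [vinf, ← h.Winf_shift_nat (m := k)]
  · congr 1; push_cast; rw [add_assoc, ← add_smul, add_mul]
  · rw [yc_add_smul]; linarith

lemma vinf_eq_Winf (h : Roll e A M u) {x : V} (hx : 5 ≤ yc e x) :
    vinf e A u x = Winf e (A : ℝ)⁻¹ u x := by
  rw [h.vinf_eq (m := 0) (by simpa using hx)]; simp

lemma vinf_periodic (h : Roll e A M u) (x : V) :
    vinf e A u (x + (A : ℝ)⁻¹ • e) = vinf e A u x := by
  obtain ⟨m, hm⟩ := exists_nat_ge (A * (5 - yc e x))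
  rw [mul_comm, ← le_mul_inv_iff₀ h.pos] at hm
  have := h.eta_pos
  rw [h.vinf_eq (m := m) (x := x + (A : ℝ)⁻¹ • e) (by rw [yc_add_smul]; linarith),
    h.vinf_eq (m := m + 1) (x := x) (by push_cast; linarith)]
  congr 1; push_cast; rw [add_mul, add_smul]; simp; abel

lemma vinf_eventually (h : Roll e A M u) (x : V) : ∃ c : V, vinf e A u =ᶠ[nhds x]
    fun y => Winf e (A : ℝ)⁻¹ u (y + c) := by
  obtain ⟨m, hm⟩ := exists_nat_gt (A * (5 - yc e x))
  rw [mul_comm, ← lt_mul_inv_iff₀ h.pos] at hm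
  refine ⟨(m * (A : ℝ)⁻¹) • e, ?_⟩
  filter_upwards [(yc e).continuous.isOpen_preimage _ isOpen_Ioi |>.mem_nhds
    (show x ∈ (yc e) ⁻¹' Ioi (5 - m * (A : ℝ)⁻¹) by simp; linarith)] with y hy
  simp only [mem_preimage, mem_Ioi] at hy
  exact h.vinf_eq (by linarith)

lemma vinf_smooth (h : Roll e A M u) : Smooth (vinf e A u) := smooth_of_locally fun x => by
  obtain ⟨c, hc⟩ := h.vinf_eventually x
  exact ⟨_, h.Winf_smooth.comp (contDiff_id.add contDiff_const), hc⟩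

lemma vinf_TB (h : Roll e A M u) {K : ℕ} {b a : ℝ} (ht : TB K b a (Winf e (A : ℝ)⁻¹ u)) :
    TB K b a (vinf e A u) := fun x => by
  obtain ⟨c, hc⟩ := h.vinf_eventually x
  have e1 : ∀ i, nd i (vinf e A u) x = nd i (Winf e (A : ℝ)⁻¹ u) (x + c) := fun i => by
    rw [nd_congr hc, nd_comp_add]
  simp only [e1]
  exact ht _

lemma vinf_abs (h : Roll e A M u) (x : V) : |vinf e A u x| ≤ 6 * A * M := h.Winf_abs _

end Roll

end RollUp

section PeriodicBounds

variable {V : Type} [NormedAddCommGroup V] [InnerProductSpace ℝ V] {e : V} [he : Fact (‖e‖ = 1)]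

lemma smooth_fderiv {E F : Type*} [NormedAddCommGroup E] [NormedSpace ℝ E]
    [NormedAddCommGroup F] [NormedSpace ℝ F] {f : E → F} (hf : Smooth f) :
    Smooth (fderiv ℝ f) := hf.fderiv_right (m := (⊤ : ℕ∞)) (by exact_mod_cast le_top)

lemma smooth_dir {E F : Type*} [NormedAddCommGroup E] [NormedSpace ℝ E]
    [NormedAddCommGroup F] [NormedSpace ℝ F] {f : E → F} (hf : Smooth f) (e : E) :
    Smooth fun x => fderiv ℝ f x e := (smooth_fderiv hf).clm_apply contDiff_const

lemma fderiv_periodic {E F : Type*} [NormedAddCommGroup E] [NormedSpace ℝ E]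
    [NormedAddCommGroup F] [NormedSpace ℝ F] {f : E → F} {e : E} (h : ∀ x, f (x + e) = f x)
    (x : E) : fderiv ℝ f (x + e) = fderiv ℝ f x := by
  rw [← fderiv_comp_add_right]; congr 1; funext y; exact h y

lemma norm_dir_le {F : Type*} [NormedAddCommGroup F] [NormedSpace ℝ F] {f : V → F}
    (hf : Smooth f) (hp : ∀ x, f (x + e) = f x) {M : ℝ}
    (hM : ∀ x, nd 1 (fun x => fderiv ℝ f x e) x ≤ M) (x : V) : ‖fderiv ℝ f x e‖ ≤ M := by
  have hM0 : 0 ≤ M := (nd_nonneg _ _ _).trans (hM 0)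
  have hd : ∀ t ∈ Icc (0 : ℝ) 1, HasDerivWithinAt
      (fun t : ℝ => f (x + t • e) - t • fderiv ℝ f x e)
      (fderiv ℝ f (x + t • e) e - fderiv ℝ f x e) (Icc 0 1) t := by
    intro t _
    have h1 : HasFDerivAt f (fderiv ℝ f (x + t • e)) (x + t • e) :=
      (hf.differentiable (by simp) _).hasFDerivAt
    have h2 : HasDerivAt (fun t : ℝ => x + t • e) e t := by
      simpa using ((hasDerivAt_id t).smul_const e).const_add x
    have h3 : HasDerivAt (fun t : ℝ => t • fderiv ℝ f x e) (fderiv ℝ f x e) t := by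
      simpa using (hasDerivAt_id t).smul_const (fderiv ℝ f x e)
    exact ((h1.comp_hasDerivAt t h2).sub h3).hasDerivWithinAt
  have key := norm_image_sub_le_of_norm_deriv_le_segment_01' (C := M) hd ?_
  · simpa [hp] using key
  · intro t ht
    refine (norm_sub_le_of_nd_one (smooth_dir hf e) hM _ _).trans ?_
    rw [add_sub_cancel_left, norm_smul, he.out, mul_one, Real.norm_eq_abs, abs_of_nonneg ht.1]
    nlinarith [ht.2]

lemma nd_dir_le_succ (k : ℕ) : ∀ {F : Type} [NormedAddCommGroup F] [NormedSpace ℝ F] {f : V → F},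
    Smooth f → (∀ x, f (x + e) = f x) → ∀ {M : ℝ},
    (∀ x, nd (k + 1) (fun x => fderiv ℝ f x e) x ≤ M) →
    ∀ x, nd k (fun x => fderiv ℝ f x e) x ≤ M := by
  induction k with
  | zero =>
    intro F _ _ f hf hp M hM x
    rw [nd_zero]
    exact norm_dir_le hf hp hM x
  | succ k ih =>
    intro F _ _ f hf hp M hM x
    have e1 : fderiv ℝ (fun x => fderiv ℝ f x e) = fun x => fderiv ℝ (fderiv ℝ f) x e := by
      funext x
      ext v
      have h1 : fderiv ℝ (fun x => fderiv ℝ f x e) x v = fderiv ℝ (fderiv ℝ f) x v e := by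
        rw [fderiv_clm_apply ((smooth_fderiv hf).differentiable (by simp) x)
          (differentiableAt_const _)]
        simp
      rw [h1]
      have hs : IsSymmSndFDerivAt ℝ f x :=
        hf.contDiffAt.isSymmSndFDerivAt (by
          rw [minSmoothness_of_isRCLikeNormedField]
          exact WithTop.coe_le_coe.2 (le_top : (2 : ℕ∞) ≤ ⊤))
      exact hs.eq v e
    rw [← nd_fderiv, e1]
    refine ih (smooth_fderiv hf) (fderiv_periodic hp) (fun y => ?_) x
    rw [← e1, nd_fderiv]
    exact hM y

lemma nd_dir_le {F : Type} [NormedAddCommGroup F] [NormedSpace ℝ F] {f : V → F}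
    (hf : Smooth f) (hp : ∀ x, f (x + e) = f x) {K : ℕ} {M : ℝ} (hM : ∀ x, nd (K + 1) f x ≤ M)
    {k : ℕ} (hk : k ≤ K) (x : V) : nd k (fun x => fderiv ℝ f x e) x ≤ M := by
  induction hk using Nat.decreasingInduction generalizing x with
  | of_succ k hk ih => exact nd_dir_le_succ k hf hp ih x
  | self =>
    have := nd_clm_comp_le (ContinuousLinearMap.apply ℝ F e) (smooth_fderiv hf) K x
    rw [nd_fderiv] at this
    refine this.trans ?_
    have h1 : ‖ContinuousLinearMap.apply ℝ F e‖ ≤ 1 :=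
      ContinuousLinearMap.opNorm_le_bound _ zero_le_one fun L => by
        have := L.le_opNorm e
        rw [he.out] at this
        simpa using this
    calc _ ≤ 1 * nd (K + 1) f x := by gcongr
      _ ≤ M := by rw [one_mul]; exact hM x

variable (e) in
/-- The difference between a function and its value at the foot point. -/
def cir {F : Type*} [AddGroup F] (f : V → F) (x : V) : F := f x - f (pr e x)

omit he in
lemma cir_smooth {F : Type*} [NormedAddCommGroup F] [NormedSpace ℝ F] {f : V → F}
    (hf : Smooth f) : Smooth (cir e f) := hf.sub (hf.comp (pr e).contDiff)

omit he in
lemma periodic_int {F : Type*} {f : V → F} (hp : ∀ x, f (x + e) = f x) (x : V) (n : ℤ) :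
    f (x + (n : ℝ) • e) = f x := by
  have : Function.Periodic f e := hp
  rw [Int.cast_smul_eq_zsmul]
  exact this.zsmul n x

lemma cir_norm_le {F : Type} [NormedAddCommGroup F] [NormedSpace ℝ F] {f : V → F}
    (hf : Smooth f) (hp : ∀ x, f (x + e) = f x) {M : ℝ}
    (hM : ∀ x, ‖fderiv ℝ f x e‖ ≤ M) (x : V) : ‖cir e f x‖ ≤ M := by
  have hM0 : 0 ≤ M := (norm_nonneg _).trans (hM 0)
  have h0 : f x = f (pr e x + Int.fract (yc e x) • e) := by
    rw [← periodic_int hp x (-⌊yc e x⌋)]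
    congr 1
    conv_lhs => enter [1]; rw [← pr_add_yc e x]
    rw [Int.fract, sub_smul, add_assoc]; congr 1; push_cast; rw [neg_smul]; abel
  have hd : ∀ t ∈ Icc (0 : ℝ) (Int.fract (yc e x)), HasDerivWithinAt
      (fun t : ℝ => f (pr e x + t • e))
      (fderiv ℝ f (pr e x + t • e) e) (Icc 0 (Int.fract (yc e x))) t := by
    intro t _
    have h1 : HasFDerivAt f (fderiv ℝ f (pr e x + t • e)) (pr e x + t • e) :=
      (hf.differentiable (by simp) _).hasFDerivAt
    have h2 : HasDerivAt (fun t : ℝ => pr e x + t • e) e t := by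
      simpa using ((hasDerivAt_id t).smul_const e).const_add (pr e x)
    exact (h1.comp_hasDerivAt t h2).hasDerivWithinAt
  have key := norm_image_sub_le_of_norm_deriv_le_segment' (C := M) hd (fun t _ => hM _)
    (Int.fract (yc e x)) ⟨Int.fract_nonneg _, le_rfl⟩
  rw [cir, h0]
  simp only [zero_smul, add_zero, sub_zero] at key
  refine key.trans ?_
  have := Int.fract_lt_one (yc e x)
  nlinarith

lemma nd_cir_le (k : ℕ) : ∀ {F : Type} [NormedAddCommGroup F] [NormedSpace ℝ F] {f : V → F},
    Smooth f → (∀ x, f (x + e) = f x) → ∀ {K : ℕ} {M : ℝ}, 1 ≤ K → k ≤ K →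
    (∀ x, nd K f x ≤ M) → ∀ x, nd k (cir e f) x ≤ (k + 2) * M := by
  induction k with
  | zero =>
    intro F _ _ f hf hp K M hK _ hM x
    obtain ⟨K, rfl⟩ : ∃ j, K = j + 1 := ⟨K - 1, by omega⟩
    rw [nd_zero]
    have := cir_norm_le hf hp
      (fun y => by simpa only [nd_zero] using nd_dir_le hf hp hM (Nat.zero_le K) y) x
    have hM0 : 0 ≤ M := (nd_nonneg _ _ _).trans (hM 0)
    push_cast
    linarith
  | succ k ih =>
    intro F _ _ f hf hp K M hK hkK hM x
    obtain ⟨K, rfl⟩ : ∃ j, K = j + 1 := ⟨K - 1, by omega⟩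
    have hM0 : 0 ≤ M := (nd_nonneg _ _ _).trans (hM 0)
    have hq : Smooth fun y => fderiv ℝ f (pr e y) e := (smooth_dir hf e).comp (pr e).contDiff
    have e1 : fderiv ℝ (cir e f) = fun x => cir e (fderiv ℝ f) x +
        ContinuousLinearMap.smulRightL ℝ V F (yc e) (fderiv ℝ f (pr e x) e) := by
      funext y
      have h1 : HasFDerivAt f (fderiv ℝ f y) y := (hf.differentiable (by simp) _).hasFDerivAt
      have h2 : HasFDerivAt f (fderiv ℝ f (pr e y)) (pr e y) :=
        (hf.differentiable (by simp) _).hasFDerivAt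
      have h3 := (h1.sub (h2.comp y (pr e).hasFDerivAt)).fderiv
      have h4 : fderiv ℝ (cir e f) y = fderiv ℝ f y - (fderiv ℝ f (pr e y)).comp (pr e) := h3
      rw [h4]
      ext v
      simp [cir, pr_apply e v]
      abel
    rw [← nd_fderiv, e1]
    have hq' : Smooth fun x => ContinuousLinearMap.smulRightL ℝ V F (yc e)
        (fderiv ℝ f (pr e x) e) := (ContinuousLinearMap.contDiff _).comp hq
    refine (nd_add_le (cir_smooth (smooth_fderiv hf)) hq' k x).trans ?_
    have hM' : 0 ≤ (k : ℝ) * M := by positivity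
    have b1 : nd k (cir e (fderiv ℝ f)) x ≤ (k + 2) * M := by
      rcases Nat.eq_zero_or_pos K with rfl | hK0
      · obtain rfl : k = 0 := by omega
        rw [nd_zero]
        simp only [zero_add] at hM
        refine (norm_sub_le _ _).trans ?_
        have h1 := hM x
        have h2 := hM (pr e x)
        rw [nd_one] at h1 h2
        push_cast
        linarith
      · exact ih (smooth_fderiv hf) (fderiv_periodic hp) hK0 (by omega)
          (fun y => by rw [nd_fderiv]; exact hM y) x
    have b2 : nd k (fun x => ContinuousLinearMap.smulRightL ℝ V F (yc e)
        (fderiv ℝ f (pr e x) e)) x ≤ M := by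
      refine (nd_clm_comp_le _ hq k x).trans ?_
      have h1 : ‖ContinuousLinearMap.smulRightL ℝ V F (yc e)‖ ≤ 1 :=
        ContinuousLinearMap.opNorm_le_bound _ zero_le_one fun c => by
          change ‖(yc e).smulRight c‖ ≤ 1 * ‖c‖
          rw [ContinuousLinearMap.norm_smulRight_apply]
          nlinarith [norm_yc_le e, norm_nonneg c]
      have h2 : nd k (fun y => fderiv ℝ f (pr e y) e) x ≤ M := by
        refine (nd_comp_clm_le (pr e) (smooth_dir hf e) k x).trans ?_
        have h3 : ‖pr e‖ ^ k ≤ 1 := pow_le_one₀ (norm_nonneg _) (norm_pr_le e)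
        have h4 := nd_dir_le hf hp hM (k := k) (by omega) (pr e x)
        calc _ ≤ 1 * M := mul_le_mul h3 h4 (nd_nonneg _ _ _) zero_le_one
          _ = M := one_mul M
      calc _ ≤ 1 * M := mul_le_mul h1 h2 (nd_nonneg _ _ _) zero_le_one
        _ = M := one_mul M
    push_cast
    linarith

end PeriodicBounds

section StagePrelim

lemma nd_mul_le {E : Type*} [NormedAddCommGroup E] [NormedSpace ℝ E] {f g : E → ℝ}
    (hf : Smooth f) (hg : Smooth g) {i : ℕ} {x : E} {C B : ℝ} (hC : ∀ j ≤ i, nd j f x ≤ C)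
    (hB : ∀ j ≤ i, nd j g x ≤ B) : nd i (fun y => f y * g y) x ≤ 2 ^ i * (C * B) := by
  have hC0 : 0 ≤ C := (nd_nonneg _ _ _).trans (hC 0 (Nat.zero_le _))
  refine (norm_iteratedFDeriv_mul_le hf hg x (by exact_mod_cast le_top)).trans ?_
  have h1 : ∀ j ∈ Finset.range (i + 1), (i.choose j : ℝ) * nd j f x * nd (i - j) g x ≤
      i.choose j * (C * B) := fun j hj => by
    rw [mul_assoc]
    have := hC j (by simpa [Nat.lt_succ_iff] using hj)
    have := hB (i - j) (Nat.sub_le _ _)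
    gcongr
  refine (Finset.sum_le_sum h1).trans ?_
  rw [← Finset.sum_mul]
  have := Nat.sum_range_choose i
  have h2 : ∑ j ∈ Finset.range (i + 1), (i.choose j : ℝ) = 2 ^ i := by exact_mod_cast this
  rw [h2]

lemma nd_comp_affine {E F G : Type*} [NormedAddCommGroup E] [NormedSpace ℝ E]
    [NormedAddCommGroup F] [NormedSpace ℝ F] [NormedAddCommGroup G] [NormedSpace ℝ G]
    (L : E →L[ℝ] F) (c : F) {f : F → G} (hf : Smooth f) (n : ℕ) (x : E) :
    nd n (fun y => f (L y + c)) x ≤ ‖L‖ ^ n * nd n f (L x + c) := by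
  have h1 : Smooth fun v => f (v + c) := hf.comp (contDiff_id.add contDiff_const)
  have := nd_comp_clm_le L h1 n x
  rwa [nd_comp_add f c] at this

lemma smoothTransition_smooth : Smooth Real.smoothTransition := Real.smoothTransition.contDiff

lemma exists_trans_bound (K : ℕ) : ∃ C : ℝ, 1 ≤ C ∧ ∀ i ≤ K, ∀ x, nd i Real.smoothTransition x ≤ C := by
  have h1 : ∀ i : ℕ, ∃ C : ℝ, ∀ x, nd i Real.smoothTransition x ≤ C := by
    intro i
    have hc : Continuous fun x => nd i Real.smoothTransition x :=
      (smoothTransition_smooth.continuous_iteratedFDeriv (m := i) (by exact_mod_cast le_top)).norm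
    obtain ⟨C, hC⟩ := (isCompact_Icc (a := (-1 : ℝ)) (b := 2)).bddAbove_image hc.continuousOn
    refine ⟨max C 1, fun x => ?_⟩
    by_cases hx : x ∈ Icc (-1 : ℝ) 2
    · exact (hC (mem_image_of_mem _ hx)).trans (le_max_left _ _)
    rcases Nat.eq_zero_or_pos i with rfl | hi
    · rw [nd_zero, Real.norm_eq_abs, abs_of_nonneg (Real.smoothTransition.nonneg x)]
      exact (Real.smoothTransition.le_one x).trans (le_max_right _ _)
    · refine le_trans (le_of_eq ?_) (zero_le_one.trans (le_max_right _ _))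
      rw [mem_Icc, not_and_or, not_le, not_le] at hx
      rcases hx with hx | hx
      · refine nd_eq_zero_of_eventually ?_ i
        filter_upwards [isOpen_Iio.mem_nhds hx] with y hy
        exact Real.smoothTransition.zero_of_nonpos (by simp only [mem_Iio] at hy; linarith)
      · have : Real.smoothTransition =ᶠ[nhds x] fun _ => (1 : ℝ) := by
          filter_upwards [isOpen_Ioi.mem_nhds hx] with y hy
          exact Real.smoothTransition.one_of_one_le (by simp only [mem_Ioi] at hy; linarith)
        rw [nd_congr this, nd_const 1 hi]
  choose C hC using h1
  refine ⟨1 + ∑ i ∈ Finset.range (K + 1), |C i|, ?_, fun i hi x => ?_⟩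
  · have : 0 ≤ ∑ i ∈ Finset.range (K + 1), |C i| := Finset.sum_nonneg fun _ _ => abs_nonneg _
    linarith
  · have : |C i| ≤ ∑ i ∈ Finset.range (K + 1), |C i| :=
      Finset.single_le_sum (f := fun i => |C i|) (fun _ _ => abs_nonneg _)
        (by simpa [Nat.lt_succ_iff] using hi)
    linarith [hC i x, le_abs_self (C i)]

/-- A bound for the derivatives of the transition function. -/
def transC (K : ℕ) : ℝ := (exists_trans_bound K).choose

lemma one_le_transC (K : ℕ) : 1 ≤ transC K := (exists_trans_bound K).choose_spec.1

lemma nd_trans_le {i K : ℕ} (hi : i ≤ K) (x : ℝ) : nd i Real.smoothTransition x ≤ transC K :=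
  (exists_trans_bound K).choose_spec.2 i hi x

variable {V : Type} [NormedAddCommGroup V] [InnerProductSpace ℝ V] {e : V} [he : Fact (‖e‖ = 1)]

variable (e) in
/-- A cutoff in the `e` direction, equal to `0` for small and `1` for large coordinates. -/
def chi (b c : ℝ) (w : V) : ℝ := Real.smoothTransition (b * (yc e w - c))

omit he in
lemma chi_smooth (b c : ℝ) : Smooth (chi e b c) :=
  smoothTransition_smooth.comp (contDiff_const.mul ((yc e).contDiff.sub contDiff_const))

lemma nd_chi_le {b : ℝ} (hb : 1 ≤ b) (c : ℝ) {i K : ℕ} (hi : i ≤ K) (w : V) :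
    nd i (chi e b c) w ≤ b ^ K * transC K := by
  have h1 : chi e b c = fun w => Real.smoothTransition ((b • yc e) w + (-(b * c))) := by
    funext w; rw [chi]; congr 1; simp; ring
  rw [h1]
  refine (nd_comp_affine _ _ smoothTransition_smooth i w).trans ?_
  have h2 : ‖b • yc e‖ ≤ b := by
    rw [norm_smul, Real.norm_eq_abs, abs_of_nonneg (by linarith)]
    nlinarith [norm_yc_le e]
  have h3 : ‖b • yc e‖ ^ i ≤ b ^ K :=
    (pow_le_pow_left₀ (norm_nonneg _) h2 i).trans (pow_le_pow_right₀ hb hi)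
  have := nd_trans_le hi ((b • yc e) w + (-(b * c)))
  gcongr

/-- Lower derivatives are controlled for functions supported in a slab. -/
lemma nd_le_of_supp {u : V → ℝ} (hu : Smooth u) (hs : ∀ x, u x ≠ 0 → 0 < yc e x ∧ yc e x < 4)
    {i : ℕ} {q : ℝ} (hq : ∀ x, nd (i + 1) u x ≤ q) (x : V) : nd i u x ≤ 5 * q := by
  have hq0 : 0 ≤ q := (nd_nonneg _ _ _).trans (hq 0)
  have hz : ∀ x, yc e x < 0 ∨ 4 < yc e x → iteratedFDeriv ℝ i u x = 0 := fun x hx => by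
    have ho : IsOpen {x : V | yc e x < 0 ∨ 4 < yc e x} :=
      ((yc e).continuous.isOpen_preimage _ isOpen_Iio).union
        ((yc e).continuous.isOpen_preimage _ isOpen_Ioi)
    refine norm_eq_zero.mp (nd_eq_zero_of_eventually ?_ i)
    filter_upwards [ho.mem_nhds hx] with y hy
    by_contra hc
    have := hs y hc
    rcases hy with hy | hy <;> linarith
  by_cases hx : yc e x < 0 ∨ 4 < yc e x
  · rw [nd, hz x hx, norm_zero]; positivity
  · push Not at hx
    have h1 := convex_univ.norm_image_sub_le_of_norm_fderiv_le (𝕜 := ℝ)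
      (f := iteratedFDeriv ℝ i u) (C := q) (x := x - (yc e x + 1) • e) (y := x)
      (fun y _ => (hu.differentiable_iteratedFDeriv (m := i) (by exact_mod_cast ENat.natCast_lt_top i)) y)
      (fun y _ => by rw [norm_fderiv_iteratedFDeriv]; exact hq y) (mem_univ _) (mem_univ _)
    rw [hz (x - (yc e x + 1) • e) (by left; rw [yc_sub_smul]; linarith), sub_zero, sub_sub_cancel,
      norm_smul, he.out, mul_one, Real.norm_eq_abs, abs_of_nonneg (by linarith [hx.1])] at h1
    exact h1.trans (by nlinarith [hx.2])

lemma nd_low {u : V → ℝ} (hu : Smooth u) (hs : ∀ x, u x ≠ 0 → 0 < yc e x ∧ yc e x < 4)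
    {K : ℕ} {q : ℝ} (hq : ∀ x, nd K u x ≤ q) {i : ℕ} (hi : i ≤ K) (x : V) :
    nd i u x ≤ 5 ^ K * q := by
  have hq0 : 0 ≤ q := (nd_nonneg _ _ _).trans (hq 0)
  have key : ∀ j, ∀ i, i + j = K → ∀ x, nd i u x ≤ 5 ^ j * q := by
    intro j
    induction j with
    | zero => intro i hi x; obtain rfl : i = K := by omega
              simpa using hq x
    | succ j ih => intro i hi x
                   have := nd_le_of_supp hu hs (ih (i + 1) (by omega)) x
                   rw [pow_succ]; linarith
  refine (key (K - i) i (by omega) x).trans ?_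
  gcongr
  · norm_num
  · omega

/-- Conjugation of a function by a dilation. -/
def dil {E : Type*} [NormedAddCommGroup E] [NormedSpace ℝ E] (A : ℝ) (f : E → ℝ) (w : E) : ℝ :=
  A * f (A⁻¹ • w)

lemma dil_smooth {A : ℝ} {f : V → ℝ} (hf : Smooth f) : Smooth (dil A f) :=
  contDiff_const.mul (hf.comp (contDiff_const.smul contDiff_id))

lemma nd_dil {A : ℝ} (hA : 0 < A) {f : V → ℝ} (hf : Smooth f) (i : ℕ) (w : V) :
    nd i (dil A f) w = A * (A⁻¹ ^ i * nd i f (A⁻¹ • w)) := by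
  have h1 : Smooth fun w => f (A⁻¹ • w) := hf.comp (contDiff_const.smul contDiff_id)
  change nd i (fun w => A * f (A⁻¹ • w)) w = _
  rw [nd_const_mul h1, abs_of_pos hA, nd_comp_smul hf, abs_of_pos (inv_pos.mpr hA)]

lemma nd_dil_le {A : ℝ} (hA : 1 ≤ A) {f : V → ℝ} (hf : Smooth f) {i : ℕ} (hi : 1 ≤ i) (w : V) :
    nd i (dil A f) w ≤ nd i f (A⁻¹ • w) := by
  rw [nd_dil (by linarith) hf]
  obtain ⟨i, rfl⟩ : ∃ j, i = j + 1 := ⟨i - 1, by omega⟩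
  rw [pow_succ, ← mul_assoc, ← mul_assoc, mul_comm A, mul_assoc (A⁻¹ ^ i),
    mul_inv_cancel₀ (by linarith), mul_one]
  have : A⁻¹ ^ i ≤ 1 := pow_le_one₀ (inv_nonneg.mpr (by linarith)) (inv_le_one_of_one_le₀ hA)
  have h0 := nd_nonneg (i + 1) f (A⁻¹ • w)
  nlinarith

variable (e) in
/-- Bounds for the displacements of a family of permutations of lines and of its inverse. -/
def FB (K : ℕ) (b a : ℝ) (c : V → Equiv.Perm ℝ) : Prop :=
  FSm e c ∧ TB K b a (dis e c) ∧ TB K b a (dis e c⁻¹)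

/-- The loss in one operation on families. -/
def opC (K : ℕ) : ℝ := 2 ^ (K + 1) * (1 + compC K)

lemma compC_pos (K : ℕ) : 0 < compC K := by unfold compC; positivity

lemma opC_ge (K : ℕ) : 1 + compC K ≤ opC K := by
  have := compC_pos K
  have h2 : (1 : ℝ) ≤ 2 ^ (K + 1) := one_le_pow₀ (by norm_num)
  rw [opC]; nlinarith

lemma two_compC_le (K : ℕ) : 2 * compC K ≤ opC K := by
  have := compC_pos K
  have h2 : (1 : ℝ) ≤ 2 ^ K := one_le_pow₀ (by norm_num)
  rw [opC, pow_succ]; nlinarith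

lemma two_pow_le_opC (K : ℕ) : 2 ^ (K + 1) ≤ opC K := by
  have := compC_pos K
  have h2 : (0 : ℝ) < 2 ^ (K + 1) := by positivity
  rw [opC]; nlinarith

lemma one_le_opC (K : ℕ) : 1 ≤ opC K := by linarith [compC_pos K, opC_ge K]

lemma opC_pos (K : ℕ) : 0 < opC K := by linarith [one_le_opC K]

variable {K : ℕ} {b a : ℝ} {c c' : V → Equiv.Perm ℝ}

lemma FB.mono {b' a' : ℝ} (h : FB e K b a c) (hb : b ≤ b') (ha : a ≤ a') : FB e K b' a' c :=
  ⟨h.1, h.2.1.mono hb ha, h.2.2.mono hb ha⟩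

lemma FB.inv (h : FB e K b a c) : FB e K b a c⁻¹ := ⟨h.1.inv, h.2.2, by simpa using h.2.1⟩

lemma FB.mul (hK : 2 ≤ K) (hb : 0 < b) (hba : b ≤ a) (hb1 : b ≤ 1) (h : FB e K b a c)
    (h' : FB e K b a c') : FB e K (opC K * b) (opC K * a) (c * c') := by
  have key : ∀ c c' : V → Equiv.Perm ℝ, FSm e c → FSm e c' → TB K b a (dis e c) →
      TB K b a (dis e c') → TB K (opC K * b) (opC K * a) (dis e (c * c')) := by
    intro c c' hc hc' ht ht'
    have e1 : dis e (c * c') = fun w => dis e c' w + dis e c (w + dis e c' w • e) :=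
      funext (dis_mul e c c')
    rw [e1]
    have h2 := ht.comp_disp hK hb hba hc.1 (w := fun w => dis e c' w • e)
      (hc'.1.smul contDiff_const) ((ht'.smul_e hc'.1).mono hb1 le_rfl)
    have h3 : max a (b * a) = a := max_eq_left (by nlinarith)
    rw [h3] at h2
    refine (ht'.add hc'.1 (hc.1.comp (smooth_add_smul hc'.1)) h2).mono ?_ ?_
    · nlinarith [opC_ge K]
    · nlinarith [opC_ge K]
  exact ⟨h.1.mul h'.1, key _ _ h.1 h'.1 h.2.1 h'.2.1, by
    rw [mul_inv_rev]; exact key _ _ h'.1.inv h.1.inv h'.2.2 h.2.2⟩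

lemma FB_fib [CompleteSpace V] (hK : 2 ≤ K) (hb : 0 < b) (hba : b ≤ a) (hC : opC K * b ≤ 1)
    {u : V → ℝ} (hu : Smooth u) (h : TB K b a u) :
    FB e K (opC K * b) (opC K * a) (fib e u) := by
  have h2 := two_le_compC (K := K) (by omega)
  have hC' : compC K * b ≤ 1 / 2 := by nlinarith [two_compC_le K]
  have h1 : ∀ x, nd 1 u x ≤ 1 / 2 := fun x => ((h x).1 1 le_rfl (by omega)).trans (by nlinarith)
  have hf := FSm_fib (e := e) hu h1
  have ho : 1 ≤ opC K := one_le_opC K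
  have ho' : compC K ≤ opC K := by linarith [opC_ge K]
  have ha : 0 ≤ a := hb.le.trans hba
  refine ⟨hf, ?_, ?_⟩
  · rw [dis_fib hu h1]; exact h.mono (by nlinarith) (by nlinarith)
  · have h3 := TB.inv hK hb hba hC' (w := fun w => u w • e)
      (w' := fun w => dis e (fib e u)⁻¹ w • e) (hu.smul contDiff_const)
      (hf.2.smul contDiff_const) (fun x => by
        have := dis_inv e (fib e u) x
        rw [dis_fib hu h1] at this
        rw [← neg_smul, ← this]) (h.smul_e hu)
    have h4 : ∀ i x, nd i (dis e (fib e u)⁻¹) x ≤ nd i (fun w => dis e (fib e u)⁻¹ w • e) x := by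
      intro i x
      have := nd_clm_comp_le (yc e) (f := fun w => dis e (fib e u)⁻¹ w • e)
        (hf.2.smul contDiff_const) i x
      have e1 : (fun y => yc e (dis e (fib e u)⁻¹ y • e)) = dis e (fib e u)⁻¹ := by
        funext y; simp [yc_self]
      rw [e1] at this
      refine this.trans ?_
      have h5 := nd_nonneg i (fun w => dis e (fib e u)⁻¹ w • e) x
      nlinarith [norm_yc_le e]
    exact fun x => ⟨fun i hi hi' => (h4 i x).trans (((h3 x).1 i hi hi').trans (by gcongr)),
      (h4 K x).trans ((h3 x).2.trans (by gcongr))⟩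

lemma dis_conj_const (c : V → Equiv.Perm ℝ) (p : Equiv.Perm ℝ) {s t : ℝ}
    (hp : ∀ y, p y = s * y + t) (hs : s ≠ 0) (w : V) :
    dis e (fun z => p * c z * p⁻¹) w = s * dis e c (pr e w + ((yc e w - t) / s) • e) := by
  have h1 : p⁻¹ (yc e w) = (yc e w - t) / s := by
    rw [Equiv.Perm.inv_eq_iff_eq, hp]; field_simp; ring
  simp only [dis, Equiv.Perm.mul_apply, h1, hp, pr_add_smul, yc_add_smul, pr_pr, yc_pr, zero_add]
  field_simp; ring

lemma TB_affine {u : V → ℝ} (hu : Smooth u) (h : TB K b a u) {s t : ℝ} (hs : 1 ≤ s) (hs2 : s ≤ 2)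
    (hb : 0 ≤ b) (ha : 0 ≤ a) :
    TB K (opC K * b) (opC K * a) fun w => s * u (pr e w + ((yc e w - t) / s) • e) := by
  set L : V →L[ℝ] V := pr e + (s⁻¹ • yc e).smulRight e with hL
  have hs0 : 0 < s := by linarith
  have e1 : (fun w => s * u (pr e w + ((yc e w - t) / s) • e)) =
      fun w => s * u (L w + (-(t / s)) • e) := by
    funext w; congr 2
    rw [hL, add_apply, add_assoc, ContinuousLinearMap.smulRight_apply,
      ← add_smul]
    congr 2; simp; field_simp; ring
  have hLn : ‖L‖ ≤ 2 := by
    refine (norm_add_le _ _).trans ?_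
    rw [ContinuousLinearMap.norm_smulRight_apply, he.out, mul_one, norm_smul, Real.norm_eq_abs,
      abs_of_pos (inv_pos.mpr hs0)]
    have : s⁻¹ ≤ 1 := inv_le_one_of_one_le₀ hs
    nlinarith [norm_pr_le e, norm_yc_le e, norm_nonneg (yc e), inv_pos.mpr hs0]
  have hsm : Smooth fun w => u (L w + (-(t / s)) • e) :=
    hu.comp (L.contDiff.add contDiff_const)
  have key : ∀ i ≤ K, ∀ x, ∀ B, (∀ x, nd i u x ≤ B) → 0 ≤ B →
      nd i (fun w => s * u (L w + (-(t / s)) • e)) x ≤ opC K * B := by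
    intro i hi x B hB hB0
    rw [nd_const_mul hsm, abs_of_pos hs0]
    have h1 := nd_comp_affine L ((-(t / s)) • e) hu i x
    have h2 : ‖L‖ ^ i ≤ 2 ^ K := (pow_le_pow_left₀ (norm_nonneg _) hLn i).trans
      (pow_le_pow_right₀ (by norm_num) hi)
    have h3 : nd i (fun w => u (L w + (-(t / s)) • e)) x ≤ 2 ^ K * B :=
      h1.trans (mul_le_mul h2 (hB _) (nd_nonneg _ _ _) (by positivity))
    calc _ ≤ 2 * (2 ^ K * B) := mul_le_mul hs2 h3 (nd_nonneg _ _ _) (by norm_num)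
      _ = 2 ^ (K + 1) * B := by ring
      _ ≤ opC K * B := by gcongr; exact two_pow_le_opC K
  rw [e1]
  exact fun x => ⟨fun i hi hi' => key i hi'.le x b (fun y => (h y).1 i hi hi') hb,
    key K le_rfl x a (fun y => (h y).2) ha⟩

lemma FB.conj_const (h : FB e K b a c) (hb : 0 ≤ b) (ha : 0 ≤ a) (p : Equiv.Perm ℝ) {s t : ℝ}
    (hp : ∀ y, p y = s * y + t) (hs : 1 ≤ s) (hs2 : s ≤ 2) :
    FB e K (opC K * b) (opC K * a) (fun z => p * c z * p⁻¹) := by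
  have hs0 : s ≠ 0 := by linarith
  have e1 : dis e (fun z => p * c z * p⁻¹) = _ := funext (dis_conj_const (e := e) c p hp hs0)
  have e2 : dis e (fun z => p * c z * p⁻¹)⁻¹ =
      fun w => s * dis e c⁻¹ (pr e w + ((yc e w - t) / s) • e) := by
    have : (fun z => p * c z * p⁻¹)⁻¹ = fun z => p * c⁻¹ z * p⁻¹ := by
      funext z; simp only [Pi.inv_apply]; group
    rw [this]
    exact funext (dis_conj_const (e := e) c⁻¹ p hp hs0)
  have hsm : ∀ u : V → ℝ, Smooth u →
      Smooth fun w => s * u (pr e w + ((yc e w - t) / s) • e) := fun u hu =>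
    contDiff_const.mul (hu.comp ((pr e).contDiff.add
      ((((yc e).contDiff.sub contDiff_const).div_const s).smul contDiff_const)))
  refine ⟨⟨?_, ?_⟩, ?_, ?_⟩
  · rw [e1]; exact hsm _ h.1.1
  · rw [e2]; exact hsm _ h.1.2
  · rw [e1]; exact TB_affine h.1.1 h.2.1 hs hs2 hb ha
  · rw [e2]; exact TB_affine h.1.2 h.2.2 hs hs2 hb ha

end StagePrelim

section Stage

variable {V : Type} [NormedAddCommGroup V] [InnerProductSpace ℝ V] {e : V} [he : Fact (‖e‖ = 1)]

/-- The basic constant of a stage. -/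
def stC₀ (K : ℕ) : ℝ :=
  opC K ^ 6 * (8 ^ K * transC K * (K + 2) * (48 * compC K * 5 ^ K))

/-- The constant of a stage. -/
def stC (K : ℕ) : ℝ := stC₀ K + stC₀ (K + 1)

lemma one_le_compC (K : ℕ) : 1 ≤ compC K := by
  unfold compC
  have h1 : (1 : ℝ) ≤ K.factorial := by exact_mod_cast Nat.succ_le_of_lt K.factorial_pos
  have h2 : (1 : ℝ) ≤ 2 ^ K := one_le_pow₀ (by norm_num)
  nlinarith

lemma stC₀_ge (K : ℕ) : opC K ^ 6 * (8 ^ K * transC K * (K + 2) * (6 * compC K * 5 ^ K)) ≤ stC₀ K := by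
  have := one_le_transC K
  have := one_le_compC K
  have := opC_pos K
  unfold stC₀
  gcongr
  norm_num

lemma stC₀_ge' (K : ℕ) : 48 * compC K * 5 ^ K ≤ stC₀ K := by
  have h1 := one_le_transC K
  have h2 := one_le_compC K
  have h3 := one_le_pow₀ (one_le_opC K) (n := 6)
  have h4 : (1 : ℝ) ≤ 8 ^ K := one_le_pow₀ (by norm_num)
  have h5 : (1 : ℝ) ≤ (K : ℝ) + 2 := by have : (0 : ℝ) ≤ K := Nat.cast_nonneg K; linarith
  have h6 : 1 ≤ opC K ^ 6 * (8 ^ K * transC K * (K + 2)) :=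
    one_le_mul_of_one_le_of_one_le h3 (one_le_mul_of_one_le_of_one_le
      (one_le_mul_of_one_le_of_one_le h4 h1) h5)
  have h7 : stC₀ K = (opC K ^ 6 * (8 ^ K * transC K * (K + 2))) * (48 * compC K * 5 ^ K) := by
    unfold stC₀; ring
  have h8 : 0 ≤ 48 * compC K * 5 ^ K := by positivity
  rw [h7]; nlinarith

lemma stC₀_pos (K : ℕ) : 0 < stC₀ K := by
  have := one_le_compC K
  have : 0 < 48 * compC K * 5 ^ K := by positivity
  linarith [stC₀_ge' K]

lemma stC₀_le (K : ℕ) : stC₀ K ≤ stC K := by linarith [stC₀_pos (K + 1), stC.eq_1 K]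

lemma stC₀_succ_le (K : ℕ) : stC₀ (K + 1) ≤ stC K := by linarith [stC₀_pos K, stC.eq_1 K]

lemma stC_pos (K : ℕ) : 0 < stC K := (stC₀_pos K).trans_le (stC₀_le K)

/-- Input of one stage of the construction. -/
structure Stg (e : V) (K A : ℕ) (q : ℝ) (u : V → ℝ) : Prop where
  two_le : 2 ≤ K
  one_le : 1 ≤ A
  smooth : Smooth u
  supp : ∀ x, u x ≠ 0 → 0 < yc e x ∧ yc e x < 4
  pos : 0 < q
  bound : ∀ x, nd K u x ≤ q
  small : stC K * A ^ 2 * q ≤ 1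

variable (e) in
/-- The dilated periodic function of a stage. -/
def vper (A : ℕ) (u : V → ℝ) : V → ℝ := dil A (vinf e A u)

variable (e) in
/-- The perturbation unrolled by a stage. -/
def stP (A : ℕ) (u : V → ℝ) : V → Equiv.Perm ℝ := fib e (dil A u)

variable (e) in
/-- The conjugacy between the perturbed and the unperturbed translation. -/
def sth (A : ℕ) (u : V → ℝ) : V → Equiv.Perm ℝ := fib e (dil A (Winf e (A : ℝ)⁻¹ u))

variable (e) in
/-- The periodic factor of the model. -/
def stg (A : ℕ) (u : V → ℝ) : V → Equiv.Perm ℝ :=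
  fib e fun w => chi e 2 (-3) w * cir e (vper e A u) w

variable (e) in
/-- The translation factor of the model. -/
def sto (A : ℕ) (u : V → ℝ) : V → Equiv.Perm ℝ :=
  fib e fun w => chi e 4 0 w * (vper e A u (pr e w) / 3)

variable (e) in
/-- The correction of the conjugacy to its model. -/
def stH (A : ℕ) (u : V → ℝ) : V → Equiv.Perm ℝ :=
  fun z => sth e A u z * (hmodel (stg e A u z) (sto e A u z))⁻¹

variable (e) in
/-- The remaining perturbation. -/
def stE (A : ℕ) (u : V → ℝ) : V → Equiv.Perm ℝ :=
  fun z => stg e A u z * tr 1 * (stg e A u z)⁻¹ * (tr 1)⁻¹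

variable (e) in
/-- The commutator generating translations. -/
def stS (A : ℕ) (u : V → ℝ) : V → Equiv.Perm ℝ :=
  fun z => sto e A u z * tr (1 / 2) * (sto e A u z)⁻¹ * (tr (1 / 2))⁻¹

variable (e) in
/-- The cut off translation. -/
def stO (A : ℕ) (u : V → ℝ) : V → Equiv.Perm ℝ := fun z => cut (sto e A u z)

variable (e) in
/-- The input of the following stage. -/
def nxt (A : ℕ) (u : V → ℝ) (w : V) : ℝ := 2 * dis e (stE e A u) ((1 / 2 : ℝ) • w - (3 : ℝ) • e)

namespace Stg

variable {K A : ℕ} {q : ℝ} {u : V → ℝ}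

lemma A_ge (h : Stg e K A q u) : (1 : ℝ) ≤ A := by exact_mod_cast h.one_le

lemma A_pos (h : Stg e K A q u) : (0 : ℝ) < A := by linarith [h.A_ge]

lemma low (h : Stg e K A q u) {i : ℕ} (hi : i ≤ K) (x : V) : nd i u x ≤ 5 ^ K * q :=
  nd_low h.smooth h.supp h.bound hi x

lemma small' (h : Stg e K A q u) : 48 * compC K * A ^ 2 * (5 ^ K * q) ≤ 1 := by
  refine le_trans ?_ h.small
  have h0 := h.pos
  calc _ = (48 * compC K * 5 ^ K) * A ^ 2 * q := by ring
    _ ≤ stC K * A ^ 2 * q := by gcongr; exact (stC₀_ge' K).trans (stC₀_le K)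

lemma small'' (h : Stg e K A q u) : 48 * A ^ 2 * (5 ^ K * q) ≤ 1 := by
  refine le_trans ?_ h.small'
  have h0 := h.pos
  have h2 := one_le_compC K
  have : 0 ≤ 48 * (A : ℝ) ^ 2 * (5 ^ K * q) := by positivity
  nlinarith

lemma A_le_sq (h : Stg e K A q u) : (A : ℝ) ≤ (A : ℝ) ^ 2 := by nlinarith [h.A_ge]

lemma roll (h : Stg e K A q u) : Roll e A (5 ^ K * q) u where
  one_le := h.one_le
  smooth := h.smooth
  supp := h.supp
  bound x := by
    have := h.low (Nat.zero_le K) x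
    rwa [nd_zero, Real.norm_eq_abs] at this
  small := by
    have h1 := h.small''
    have h2 := h.A_le_sq
    have h3 : 0 ≤ 5 ^ K * q := by have := h.pos; positivity
    nlinarith

lemma Winf_TB (h : Stg e K A q u) : TB K (6 * A * (compC K * (5 ^ K * q)))
    (6 * A * (compC K * (5 ^ K * q))) (Winf e (A : ℝ)⁻¹ u) := by
  have h0 : 0 < 5 ^ K * q := by have := h.pos; positivity
  refine h.roll.Winf_TB h.two_le h0 le_rfl (TB.of_plain (by linarith [h.two_le])
    fun i _ hi x => h.low hi x) ?_
  have h1 := h.small'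
  have h2 := h.A_le_sq
  have h3 : 0 ≤ compC K * (5 ^ K * q) := by have := compC_pos K; positivity
  nlinarith

lemma vper_smooth (h : Stg e K A q u) : Smooth (vper e A u) := dil_smooth h.roll.vinf_smooth

lemma vper_abs (h : Stg e K A q u) (x : V) : |vper e A u x| ≤ 6 * A ^ 2 * (5 ^ K * q) := by
  have := h.A_pos
  rw [vper, dil, abs_mul, abs_of_pos this]
  calc _ ≤ (A : ℝ) * (6 * A * (5 ^ K * q)) := by gcongr; exact h.roll.vinf_abs _
    _ = _ := by ring

lemma vper_abs_le (h : Stg e K A q u) (x : V) : |vper e A u x| ≤ 1 / 8 := by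
  have := h.vper_abs x
  have := h.small''
  linarith

lemma vper_periodic (h : Stg e K A q u) (x : V) : vper e A u (x + e) = vper e A u x := by
  rw [vper, dil, dil, smul_add, h.roll.vinf_periodic]

lemma vper_nd (h : Stg e K A q u) {i : ℕ} (hi : i ≤ K) (x : V) :
    nd i (vper e A u) x ≤ 6 * compC K * A ^ 2 * (5 ^ K * q) := by
  have h0 := h.A_pos
  have h1 := one_le_compC K
  have hq : 0 < 5 ^ K * q := by have := h.pos; positivity
  rcases Nat.eq_zero_or_pos i with rfl | hi0
  · rw [nd_zero, Real.norm_eq_abs]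
    refine (h.vper_abs x).trans ?_
    have : 0 ≤ 6 * (A : ℝ) ^ 2 * (5 ^ K * q) := by positivity
    nlinarith
  · refine (nd_dil_le h.A_ge h.roll.vinf_smooth hi0 x).trans
      (((h.roll.vinf_TB h.Winf_TB).plain hi0 hi _).trans ?_)
    calc _ = 6 * compC K * A * (5 ^ K * q) := by ring
      _ ≤ _ := by gcongr; exact h.A_le_sq

/-- The common bound for the displacements of the basic families. -/
def base (K A : ℕ) (q : ℝ) : ℝ := 8 ^ K * transC K * (K + 2) * (6 * compC K * A ^ 2 * (5 ^ K * q))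

lemma base_pos (h : Stg e K A q u) : 0 < base K A q := by
  have := compC_pos K
  have := h.pos
  have := h.A_pos
  have := one_le_transC K
  unfold base; positivity

lemma opC_base (h : Stg e K A q u) : opC K ^ 6 * base K A q ≤ stC K * A ^ 2 * q := by
  have h0 := h.pos
  calc _ = opC K ^ 6 * (8 ^ K * transC K * (K + 2) * (6 * compC K * 5 ^ K)) * A ^ 2 * q := by
        unfold base; ring
    _ ≤ stC K * A ^ 2 * q := by gcongr; exact (stC₀_ge K).trans (stC₀_le K)

lemma base_ge (h : Stg e K A q u) {c : ℝ} (hc : c ≤ 8 ^ K * transC K * (K + 2)) :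
    c * (6 * compC K * A ^ 2 * (5 ^ K * q)) ≤ base K A q := by
  have := compC_pos K
  have := h.pos
  unfold base; gcongr

lemma one_le_fac (K : ℕ) : 1 ≤ 8 ^ K * transC K * (K + 2) := by
  have h4 : (1 : ℝ) ≤ 8 ^ K := one_le_pow₀ (by norm_num)
  have h5 : (1 : ℝ) ≤ (K : ℝ) + 2 := by have : (0 : ℝ) ≤ K := Nat.cast_nonneg K; linarith
  exact one_le_mul_of_one_le_of_one_le
      (one_le_mul_of_one_le_of_one_le h4 (one_le_transC K)) h5

lemma TB_h (h : Stg e K A q u) :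
    TB K (base K A q) (base K A q) (dil A (Winf e (A : ℝ)⁻¹ u)) := by
  refine TB.of_plain (by linarith [h.two_le]) fun i hi hi' x => ?_
  refine (nd_dil_le h.A_ge h.roll.Winf_smooth hi x).trans ((h.Winf_TB.plain hi hi' _).trans ?_)
  have h0 := compC_pos K
  have hq := h.pos
  calc _ = 6 * compC K * A * (5 ^ K * q) := by ring
    _ ≤ 1 * (6 * compC K * A ^ 2 * (5 ^ K * q)) := by rw [one_mul]; gcongr; exact h.A_le_sq
    _ ≤ _ := h.base_ge (one_le_fac K)

lemma g_smooth (h : Stg e K A q u) :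
    Smooth fun w => chi e 2 (-3) w * cir e (vper e A u) w :=
  (chi_smooth _ _).mul (cir_smooth h.vper_smooth)

lemma o_smooth (h : Stg e K A q u) :
    Smooth fun w => chi e 4 0 w * (vper e A u (pr e w) / 3) :=
  (chi_smooth _ _).mul ((h.vper_smooth.comp (pr e).contDiff).div_const 3)

lemma four_pow_mul (K : ℕ) : (2 : ℝ) ^ K * 4 ^ K = 8 ^ K := by rw [← mul_pow]; norm_num

lemma TB_g (h : Stg e K A q u) :
    TB K (base K A q) (base K A q) fun w => chi e 2 (-3) w * cir e (vper e A u) w := by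
  refine TB.of_plain (by linarith [h.two_le]) fun i hi hi' x => ?_
  have hB0 : 0 ≤ 6 * compC K * A ^ 2 * (5 ^ K * q) := by
    have := compC_pos K; have := h.pos; positivity
  have ht := one_le_transC K
  refine (nd_mul_le (C := 2 ^ K * transC K)
    (B := (K + 2) * (6 * compC K * A ^ 2 * (5 ^ K * q))) (chi_smooth _ _)
    (cir_smooth h.vper_smooth) (fun j hj => nd_chi_le (by norm_num) _ (hj.trans hi') _)
    (fun j hj => (nd_cir_le j h.vper_smooth h.vper_periodic (by linarith [h.two_le])
      (hj.trans hi') (h.vper_nd le_rfl) x).trans ?_)).trans ?_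
  · have : (j : ℝ) ≤ K := by exact_mod_cast hj.trans hi'
    gcongr
  · have h1 : (2 : ℝ) ^ i ≤ 2 ^ K := pow_le_pow_right₀ (by norm_num) hi'
    have h2 : (2 : ℝ) ^ K ≤ 4 ^ K := pow_le_pow_left₀ (by norm_num) (by norm_num) K
    rw [base, ← four_pow_mul]
    generalize 6 * compC K * A ^ 2 * (5 ^ K * q) = B at *
    calc _ ≤ (2 : ℝ) ^ K * (4 ^ K * transC K * ((K + 2) * B)) := by gcongr
      _ = _ := by ring

lemma TB_o (h : Stg e K A q u) :
    TB K (base K A q) (base K A q) fun w => chi e 4 0 w * (vper e A u (pr e w) / 3) := by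
  refine TB.of_plain (by linarith [h.two_le]) fun i hi hi' x => ?_
  have hB0 : 0 ≤ 6 * compC K * A ^ 2 * (5 ^ K * q) := by
    have := compC_pos K; have := h.pos; positivity
  have ht := one_le_transC K
  have hs : Smooth fun w => vper e A u (pr e w) := h.vper_smooth.comp (pr e).contDiff
  have key : ∀ j ≤ i, nd j (fun w => vper e A u (pr e w) / 3) x ≤
      6 * compC K * A ^ 2 * (5 ^ K * q) := fun j hj => by
    have e1 : (fun w => vper e A u (pr e w) / 3) = fun w => (1 / 3 : ℝ) * vper e A u (pr e w) := by
      funext w; ring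
    rw [e1, nd_const_mul hs, abs_of_pos (by norm_num)]
    have h1 := nd_comp_clm_le (pr e) h.vper_smooth j x
    have h3 : ‖pr e‖ ^ j ≤ 1 := pow_le_one₀ (norm_nonneg _) (norm_pr_le e)
    have h4 := h.vper_nd (hj.trans hi') (pr e x)
    have h5 := nd_nonneg j (vper e A u) (pr e x)
    nlinarith
  refine (nd_mul_le (C := 4 ^ K * transC K) (chi_smooth _ _)
    ((h.vper_smooth.comp (pr e).contDiff).div_const 3)
    (fun j hj => nd_chi_le (by norm_num) _ (hj.trans hi') _) key).trans ?_
  have h1 : (2 : ℝ) ^ i ≤ 2 ^ K := pow_le_pow_right₀ (by norm_num) hi'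
  rw [base, ← four_pow_mul]
  generalize 6 * compC K * A ^ 2 * (5 ^ K * q) = B at *
  have h3 : B ≤ (K + 2) * B := by
    have : (0 : ℝ) ≤ K := Nat.cast_nonneg K
    nlinarith
  calc _ ≤ (2 : ℝ) ^ K * (4 ^ K * transC K * ((K + 2) * B)) := by gcongr
    _ = _ := by ring

lemma opC_base_le (h : Stg e K A q u) {i : ℕ} (hi : i ≤ 6) : opC K ^ i * base K A q ≤ 1 :=
  le_trans (mul_le_mul_of_nonneg_right (pow_le_pow_right₀ (one_le_opC K) hi) h.base_pos.le)
    (h.opC_base.trans h.small)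

lemma nd_one_le (h : Stg e K A q u) {f : V → ℝ} (hf : TB K (base K A q) (base K A q) f) (x : V) :
    nd 1 f x ≤ 1 / 2 := by
  refine ((hf x).1 1 le_rfl (by linarith [h.two_le])).trans ?_
  have h1 := h.opC_base_le (i := 1) (by norm_num)
  have h2 := two_compC_le K
  have h3 := one_le_compC K
  have h4 := h.base_pos
  nlinarith

lemma sth_apply (h : Stg e K A q u) (z : V) (y : ℝ) :
    sth e A u z y = y + dil A (Winf e (A : ℝ)⁻¹ u) (pr e z + y • e) :=
  fib_apply (dil_smooth h.roll.Winf_smooth) (h.nd_one_le h.TB_h) z y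

lemma stg_apply (h : Stg e K A q u) (z : V) (y : ℝ) :
    stg e A u z y = y + chi e 2 (-3) (pr e z + y • e) * cir e (vper e A u) (pr e z + y • e) :=
  fib_apply h.g_smooth (h.nd_one_le h.TB_g) z y

lemma sto_apply (h : Stg e K A q u) (z : V) (y : ℝ) :
    sto e A u z y = y + chi e 4 0 (pr e z + y • e) *
      (vper e A u (pr e (pr e z + y • e)) / 3) :=
  fib_apply h.o_smooth (h.nd_one_le h.TB_o) z y

lemma nd_one_P (h : Stg e K A q u) (x : V) : nd 1 (dil A u) x ≤ 1 / 2 := by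
  refine (nd_dil_le h.A_ge h.smooth le_rfl x).trans ((h.low (by linarith [h.two_le]) _).trans ?_)
  have h1 := h.small''
  have h2 := h.A_ge
  have h3 : 0 ≤ 5 ^ K * q := by have := h.pos; positivity
  nlinarith

lemma stP_apply (h : Stg e K A q u) (z : V) (y : ℝ) :
    stP e A u z y = y + dil A u (pr e z + y • e) :=
  fib_apply (dil_smooth h.smooth) h.nd_one_P z y

lemma periodic₀ (h : Stg e K A q u) (z : V) : Periodic₀ (stg e A u z) where
  left y hy := by
    rw [h.stg_apply, chi, Real.smoothTransition.zero_of_nonpos]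
    · ring
    · rw [yc_add_smul, yc_pr]; linarith
  right y hy := by
    have h1 : ∀ y : ℝ, -(5 / 2) ≤ y → chi e 2 (-3) (pr e z + y • e) = 1 := fun y hy => by
      rw [chi, Real.smoothTransition.one_of_one_le]
      rw [yc_add_smul, yc_pr]; linarith
    rw [h.stg_apply, h.stg_apply, h1 y hy, h1 (y + 1) (by linarith), cir, cir, pr_add_smul,
      pr_add_smul, add_smul, one_smul, ← add_assoc, h.vper_periodic]
    ring
  disp y := by
    rw [h.stg_apply, add_sub_cancel_left, abs_mul]
    have h1 : |cir e (vper e A u) (pr e z + y • e)| ≤ 1 / 4 := by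
      have h2 := abs_le.mp (h.vper_abs_le (pr e z + y • e))
      have h3 := abs_le.mp (h.vper_abs_le (pr e (pr e z + y • e)))
      rw [cir, abs_le]; constructor <;> linarith
    have h4 : |chi e 2 (-3) (pr e z + y • e)| ≤ 1 := by
      rw [chi, abs_of_nonneg (Real.smoothTransition.nonneg _)]
      exact Real.smoothTransition.le_one _
    nlinarith [abs_nonneg (cir e (vper e A u) (pr e z + y • e))]

lemma halfTr (h : Stg e K A q u) (z : V) : HalfTr (sto e A u z) (vper e A u (pr e z) / 3) where
  left y hy := by
    rw [h.sto_apply, chi, Real.smoothTransition.zero_of_nonpos]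
    · ring
    · rw [yc_add_smul, yc_pr]; linarith
  right y hy := by
    rw [h.sto_apply, chi, Real.smoothTransition.one_of_one_le, pr_add_smul, pr_pr]
    · ring
    · rw [yc_add_smul, yc_pr]; linarith
  disp y := by
    rw [h.sto_apply, add_sub_cancel_left, abs_mul]
    have h2 := abs_le.mp (h.vper_abs_le (pr e (pr e z + y • e)))
    have h1 : |vper e A u (pr e (pr e z + y • e)) / 3| ≤ 1 / 4 := by
      rw [abs_le]; constructor <;> linarith
    have h4 : |chi e 4 0 (pr e z + y • e)| ≤ 1 := by
      rw [chi, abs_of_nonneg (Real.smoothTransition.nonneg _)]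
      exact Real.smoothTransition.le_one _
    nlinarith [abs_nonneg (vper e A u (pr e (pr e z + y • e)) / 3)]

lemma conjugacy (h : Stg e K A q u) (z : V) (y : ℝ) :
    sth e A u z (y + 1) = stP e A u z (sth e A u z y + 1) := by
  have hA := h.A_pos
  rw [h.stP_apply, h.sth_apply, h.sth_apply]
  simp only [dil]
  rw [Winf_eqn h.roll.eta_pos h.roll.left]
  have e1 : (A : ℝ)⁻¹ • (pr e z + (y + 1) • e) - (A : ℝ)⁻¹ • e =
      (A : ℝ)⁻¹ • (pr e z + y • e) := by
    rw [add_smul, ← add_assoc, smul_add _ _ ((1 : ℝ) • e), one_smul, add_sub_cancel_right]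
  rw [e1]
  set W := Winf e (A : ℝ)⁻¹ u ((A : ℝ)⁻¹ • (pr e z + y • e)) with hW
  have e2 : (A : ℝ)⁻¹ • (pr e z + (y + 1) • e) + W • e =
      (A : ℝ)⁻¹ • (pr e z + (y + A * W + 1) • e) := by
    rw [smul_add, smul_add, smul_smul, smul_smul, add_assoc, ← add_smul]
    congr 2; field_simp; ring
  rw [e2]; ring

/-- The stage identity for families. -/
lemma identity (h : Stg e K A q u) (z : V) :
    stP e A u z = stH e A u z * xword (tr (1 / 2)) aff₂ aff₄ (stE e A u z) (stS e A u z)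
      (stO e A u z) * (tr 1 * (stH e A u z)⁻¹ * (tr 1)⁻¹) :=
  stage_identity (h.periodic₀ z) (h.halfTr z) (h.conjugacy z)

lemma sup_E (h : Stg e K A q u) (z : V) : Sup (stE e A u z) (Ioo (-3) (-1)) :=
  (h.periodic₀ z).sup_comm

lemma sup_S (h : Stg e K A q u) (z : V) : Sup (stS e A u z) (Ioo 0 1) :=
  ((h.halfTr z).sup_comm (by norm_num)).mono (Ioo_subset_Ioo le_rfl (by norm_num))

lemma sup_O (h : Stg e K A q u) (z : V) : Sup (stO e A u z) (Ioo 0 5) := (h.halfTr z).sup_cut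

lemma sup_H (h : Stg e K A q u) (z : V) : Sup (stH e A u z) (Ioo (-3) (5 * A + 14)) := by
  have hA := h.A_pos
  have h1 : Sup (stH e A u z) (Ioo (-3) ((5 * A + 12) + 2)) := by
    refine sup_htilde (by linarith) (h.periodic₀ z) (h.halfTr z) (fun y hy => ?_) fun y hy => ?_
    · rw [h.sth_apply, dil, Winf_left h.roll.eta_pos h.roll.left]
      · simp
      · rw [map_smul, yc_add_smul, yc_pr, zero_add, smul_eq_mul]
        exact mul_nonpos_of_nonneg_of_nonpos (by positivity) hy
    · rw [h.sth_apply, h.stg_apply, chi, Real.smoothTransition.one_of_one_le, cir, pr_add_smul,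
        pr_pr]
      · rw [vper]
        simp only [dil]
        rw [h.roll.vinf_eq_Winf (x := (A : ℝ)⁻¹ • (pr e z + y • e))]
        · ring
        · rw [map_smul, yc_add_smul, yc_pr, zero_add, smul_eq_mul, inv_mul_eq_div,
            le_div_iff₀ hA]
          linarith
      · rw [yc_add_smul, yc_pr]; linarith
  exact h1.mono (Ioo_subset_Ioo le_rfl (by linarith))

end Stg

end Stage

section StageBounds

variable {V : Type} [NormedAddCommGroup V] [InnerProductSpace ℝ V] {e : V} [he : Fact (‖e‖ = 1)]

lemma FB.tr_conj {K : ℕ} {b a : ℝ} {c : V → Equiv.Perm ℝ} (h : FB e K b a c) (hb : 0 ≤ b)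
    (ha : 0 ≤ a) (t : ℝ) : FB e K (opC K * b) (opC K * a) (fun z => tr t * c z * (tr t)⁻¹) :=
  h.conj_const hb ha _ (s := 1) (t := t) (fun y => by simp) le_rfl (by norm_num)

lemma FB.aff_conj {K : ℕ} {b a : ℝ} {c : V → Equiv.Perm ℝ} (h : FB e K b a c) (hb : 0 ≤ b)
    (ha : 0 ≤ a) (t : ℝ) :
    FB e K (opC K * b) (opC K * a) (fun z => (tr t * dbl) * c z * (tr t * dbl)⁻¹) :=
  h.conj_const hb ha _ (s := 2) (t := t) (fun y => by simp) (by norm_num) le_rfl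

/-- The commutator with a translation. -/
lemma FB.comm_tr {K : ℕ} {b a : ℝ} {c : V → Equiv.Perm ℝ} (hK : 2 ≤ K) (hb : 0 < b) (hba : b ≤ a)
    (h1 : opC K * b ≤ 1) (h : FB e K b a c) (t : ℝ) :
    FB e K (opC K ^ 2 * b) (opC K ^ 2 * a) (fun z => c z * tr t * (c z)⁻¹ * (tr t)⁻¹) := by
  have ho := one_le_opC K
  have ha := hb.le.trans hba
  have h2 := h.inv.tr_conj hb.le ha t
  have h3 := FB.mul hK (by positivity) (mul_le_mul_of_nonneg_left hba (by positivity)) h1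
    (h.mono (by nlinarith) (by nlinarith)) h2
  have e1 : (fun z => c z * tr t * (c z)⁻¹ * (tr t)⁻¹) =
      c * fun z => tr t * c⁻¹ z * (tr t)⁻¹ := by
    funext z; simp only [Pi.mul_apply, Pi.inv_apply]; group
  rw [e1]
  exact h3.mono (by rw [pow_two]; linarith) (by rw [pow_two]; linarith)

lemma FB.pow_mono {K : ℕ} {b a : ℝ} {c : V → Equiv.Perm ℝ} {i j : ℕ} (hb : 0 ≤ b) (ha : 0 ≤ a)
    (hij : i ≤ j) (h : FB e K (opC K ^ i * b) (opC K ^ i * a) c) :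
    FB e K (opC K ^ j * b) (opC K ^ j * a) c :=
  h.mono (mul_le_mul_of_nonneg_right (pow_le_pow_right₀ (one_le_opC K) hij) hb)
    (mul_le_mul_of_nonneg_right (pow_le_pow_right₀ (one_le_opC K) hij) ha)

lemma nd_chi_mul_le {f : V → ℝ} (hf : Smooth f) {K i : ℕ} (hi : i ≤ K) {c B : ℝ} {x : V}
    (hB : ∀ j ≤ i, nd j f x ≤ B) :
    nd i (fun w => chi e 2 c w * f w) x ≤ 8 ^ K * transC K * B := by
  have ht := one_le_transC K
  have hB0 : 0 ≤ B := (nd_nonneg _ _ _).trans (hB 0 (Nat.zero_le _))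
  refine (nd_mul_le (C := 2 ^ K * transC K) (chi_smooth _ _) hf
    (fun j hj => nd_chi_le (by norm_num) _ (hj.trans hi) _) hB).trans ?_
  have h1 : (2 : ℝ) ^ i ≤ 2 ^ K := pow_le_pow_right₀ (by norm_num) hi
  have h2 : (2 : ℝ) ^ K ≤ 4 ^ K := pow_le_pow_left₀ (by norm_num) (by norm_num) K
  rw [← Stg.four_pow_mul]
  calc _ ≤ (2 : ℝ) ^ K * (4 ^ K * transC K * B) := by gcongr
    _ = _ := by ring

namespace Stg

variable {K A : ℕ} {q : ℝ} {u : V → ℝ}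

/-- All families of a stage satisfy this bound. -/
def bd (K A : ℕ) (q : ℝ) : ℝ := stC K * A ^ 2 * q

lemma FB_pow_le (h : Stg e K A q u) {c : V → Equiv.Perm ℝ} {i : ℕ} (hi : i ≤ 6)
    (hc : FB e K (opC K ^ i * base K A q) (opC K ^ i * base K A q) c) :
    FB e K (bd K A q) (bd K A q) c :=
  (FB.pow_mono (e := e) h.base_pos.le h.base_pos.le hi hc).mono h.opC_base h.opC_base

section Complete

variable [CompleteSpace V]

lemma FB_of_TB (h : Stg e K A q u) {f : V → ℝ} (hf : Smooth f)
    (ht : TB K (base K A q) (base K A q) f) :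
    FB e K (opC K ^ 1 * base K A q) (opC K ^ 1 * base K A q) (fib e f) := by
  have := FB_fib (e := e) h.two_le h.base_pos le_rfl (by simpa using h.opC_base_le (i := 1) (by norm_num))
    hf ht
  simpa using this

lemma FB_mul (h : Stg e K A q u) {c c' : V → Equiv.Perm ℝ} {i : ℕ} (hi : i ≤ 6)
    (hc : FB e K (opC K ^ i * base K A q) (opC K ^ i * base K A q) c)
    (hc' : FB e K (opC K ^ i * base K A q) (opC K ^ i * base K A q) c') :
    FB e K (opC K ^ (i + 1) * base K A q) (opC K ^ (i + 1) * base K A q) (c * c') := by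
  have := FB.mul h.two_le (mul_pos (pow_pos (opC_pos K) i) h.base_pos) le_rfl
    (h.opC_base_le hi) hc hc'
  rwa [← mul_assoc, ← pow_succ'] at this

lemma TB_P (h : Stg e K A q u) : TB K (base K A q) (base K A q) (dil A u) := by
  refine TB.of_plain (by linarith [h.two_le]) fun i hi hi' x => ?_
  refine (nd_dil_le h.A_ge h.smooth hi x).trans ((h.low hi' _).trans ?_)
  refine le_trans ?_ (h.base_ge (one_le_fac K))
  have h1 := one_le_compC K
  have h2 := one_le_pow₀ h.A_ge (n := 2)
  have h0 : 0 ≤ 5 ^ K * q := by have := h.pos; positivity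
  have h3 : 1 ≤ 6 * compC K * (A : ℝ) ^ 2 := by nlinarith
  rw [one_mul]
  nlinarith

lemma FB_P (h : Stg e K A q u) : FB e K (bd K A q) (bd K A q) (stP e A u) :=
  h.FB_pow_le (by norm_num) (h.FB_of_TB (dil_smooth h.smooth) h.TB_P)

lemma FB_g (h : Stg e K A q u) :
    FB e K (opC K ^ 1 * base K A q) (opC K ^ 1 * base K A q) (stg e A u) :=
  h.FB_of_TB h.g_smooth h.TB_g

lemma FB_o (h : Stg e K A q u) :
    FB e K (opC K ^ 1 * base K A q) (opC K ^ 1 * base K A q) (sto e A u) :=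
  h.FB_of_TB h.o_smooth h.TB_o

lemma FB_E (h : Stg e K A q u) : FB e K (bd K A q) (bd K A q) (stE e A u) := by
  have h0 := h.base_pos
  have h1 := opC_pos K
  have h2 := h.opC_base_le (i := 2) (by norm_num)
  have := h.FB_g.comm_tr h.two_le (by positivity) le_rfl (by rw [← mul_assoc, ← pow_succ']; exact h2) 1
  rw [← mul_assoc, ← pow_add] at this
  exact h.FB_pow_le (by norm_num) this

lemma FB_S (h : Stg e K A q u) : FB e K (bd K A q) (bd K A q) (stS e A u) := by
  have h0 := h.base_pos
  have h1 := opC_pos K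
  have h2 := h.opC_base_le (i := 2) (by norm_num)
  have := h.FB_o.comm_tr h.two_le (by positivity) le_rfl (by rw [← mul_assoc, ← pow_succ']; exact h2)
    (1 / 2)
  rw [← mul_assoc, ← pow_add] at this
  exact h.FB_pow_le (by norm_num) this

lemma FB_O (h : Stg e K A q u) : FB e K (bd K A q) (bd K A q) (stO e A u) := by
  have h0 := h.base_pos
  have h1 := opC_pos K
  have h2 := h.FB_o.inv.tr_conj (by positivity) (by positivity) 4
  rw [← mul_assoc, ← pow_succ'] at h2
  exact h.FB_pow_le (by norm_num) (h.FB_mul (by norm_num)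
    (FB.pow_mono h0.le h0.le (by norm_num) h.FB_o) h2)

lemma FB_H (h : Stg e K A q u) : FB e K (bd K A q) (bd K A q) (stH e A u) := by
  have h0 := h.base_pos
  have h1 := opC_pos K
  have h2 := h.FB_o.aff_conj (by positivity) (by positivity) 2
  have h4 := h.FB_o.aff_conj (by positivity) (by positivity) 4
  rw [← mul_assoc, ← pow_succ'] at h2 h4
  have h5 := h.FB_mul (by norm_num) h4 h2
  have h6 := h.FB_mul (by norm_num) h5 (FB.pow_mono h0.le h0.le (by norm_num) h.FB_o.inv)
  have h7 := h.FB_mul (by norm_num) h6 (FB.pow_mono h0.le h0.le (by norm_num) h.FB_g)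
  have h8 := h.FB_mul (by norm_num) (FB.pow_mono h0.le h0.le (by norm_num)
    (h.FB_of_TB (dil_smooth h.roll.Winf_smooth) h.TB_h)) h7.inv
  exact h.FB_pow_le (by norm_num) h8

lemma nxt_smooth (h : Stg e K A q u) : Smooth (nxt e A u) :=
  contDiff_const.mul (h.FB_E.1.1.comp ((contDiff_const.smul contDiff_id).sub contDiff_const))

lemma nxt_supp (h : Stg e K A q u) (x : V) (hx : nxt e A u x ≠ 0) :
    0 < yc e x ∧ yc e x < 4 := by
  by_contra hc
  refine hx ?_
  rw [nxt, dis, h.sup_E _ _ (fun hm => hc ?_), sub_self, mul_zero]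
  rw [yc_sub_smul, map_smul, smul_eq_mul, mem_Ioo] at hm
  constructor <;> linarith

lemma nd_nxt {i : ℕ} (h : Stg e K A q u) (hi : 1 ≤ i) (x : V) :
    nd i (nxt e A u) x ≤ nd i (dis e (stE e A u)) ((1 / 2 : ℝ) • x - (3 : ℝ) • e) := by
  have hs : Smooth fun w => dis e (stE e A u) (w - (3 : ℝ) • e) :=
    h.FB_E.1.1.comp (contDiff_id.sub contDiff_const)
  have hs' : Smooth fun w : V => dis e (stE e A u) ((1 / 2 : ℝ) • w - (3 : ℝ) • e) :=
    hs.comp (contDiff_const.smul contDiff_id)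
  change nd i (fun w => 2 * dis e (stE e A u) ((1 / 2 : ℝ) • w - (3 : ℝ) • e)) x ≤ _
  rw [nd_const_mul hs', nd_comp_smul hs (1 / 2) i x, nd_comp_sub, abs_of_pos two_pos,
    abs_of_pos (by norm_num)]
  obtain ⟨i, rfl⟩ : ∃ j, i = j + 1 := ⟨i - 1, by omega⟩
  have : (1 / 2 : ℝ) ^ (i + 1) ≤ (1 / 2) ^ 1 :=
    pow_le_pow_of_le_one (by norm_num) (by norm_num) (by omega)
  have h0 := nd_nonneg (i + 1) (dis e (stE e A u)) ((1 / 2 : ℝ) • x - (3 : ℝ) • e)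
  nlinarith

/-- The tame estimate: one stage gains derivatives at the top order. -/
lemma tame (h : Stg e K A q u) {r : ℝ} (hr : 0 < r) (hu : ∀ x, nd (K + 1) u x ≤ r) (x : V) :
    nd (K + 1) (nxt e A u) x ≤ stC K * A ^ 2 * (A : ℝ)⁻¹ ^ (K + 1) * r := by
  have hK := h.two_le
  have hK2 : 2 ≤ K + 1 := by omega
  have hA := h.A_pos
  have hq := h.pos
  have hc := compC_pos (K + 1)
  have hc1 := one_le_compC (K + 1)
  have hP := one_le_fac (K + 1)
  have hop := opC_pos (K + 1)
  set C := compC (K + 1) with hC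
  set P : ℝ := 8 ^ (K + 1) * transC (K + 1) * ((K + 1 : ℕ) + 2) with hPdef
  have hsmall : opC (K + 1) ^ 6 * (P * (48 * C * 5 ^ (K + 1))) * A ^ 2 * q ≤ 1 := by
    refine le_trans ?_ h.small
    gcongr
    exact stC₀_succ_le K
  -- bounds for the input
  set b₀ : ℝ := min (5 ^ K * q) (5 ^ (K + 1) * r) with hb₀
  have hb₀pos : 0 < b₀ := lt_min (by positivity) (by positivity)
  have hTu : TB (K + 1) b₀ (5 ^ (K + 1) * r) u := fun x =>
    ⟨fun i _ hi => le_min (h.low (by omega) x) (nd_low h.smooth h.supp hu hi.le x),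
      nd_low h.smooth h.supp hu le_rfl x⟩
  have hW : TB (K + 1) (6 * A * (C * b₀)) (6 * A * (C * (5 ^ (K + 1) * r)))
      (vinf e A u) := by
    refine h.roll.vinf_TB (h.roll.Winf_TB hK2 hb₀pos (min_le_right _ _) hTu ?_)
    have h6 : (1 : ℝ) ≤ opC (K + 1) ^ 6 := one_le_pow₀ (one_le_opC _)
    have h7 : 1 ≤ opC (K + 1) ^ 6 * P := one_le_mul_of_one_le_of_one_le h6 hP
    calc 6 * A * (C * b₀) ≤ 48 * A ^ 2 * (C * (5 ^ (K + 1) * q)) := by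
          have := h.A_le_sq
          have h8 : b₀ ≤ 5 ^ (K + 1) * q := (min_le_left _ _).trans (by
            gcongr
            · norm_num
            · omega)
          gcongr
          norm_num
      _ ≤ (opC (K + 1) ^ 6 * P) * (48 * A ^ 2 * (C * (5 ^ (K + 1) * q))) :=
          le_mul_of_one_le_left (by positivity) h7
      _ ≤ 1 := by refine le_trans (le_of_eq ?_) hsmall; ring
  -- bounds for the periodic function
  have hvs : Smooth (vinf e A u) := h.roll.vinf_smooth
  have hv1 : ∀ x, nd (K + 1) (vper e A u) x ≤
      6 * C * A ^ 2 * ((A : ℝ)⁻¹ ^ (K + 1) * (5 ^ (K + 1) * r)) := fun x => by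
    rw [vper, nd_dil hA hvs]
    calc _ ≤ (A : ℝ) * ((A : ℝ)⁻¹ ^ (K + 1) * (6 * A * (C * (5 ^ (K + 1) * r)))) := by
          gcongr; exact (hW _).2
      _ = _ := by ring
  have hv0 : ∀ x, nd K (vper e A u) x ≤ 6 * C * A ^ 2 * (5 ^ K * q) := fun x => by
    refine (nd_dil_le h.A_ge hvs (by omega) x).trans (((hW _).1 K (by omega) (by omega)).trans ?_)
    calc _ = 6 * C * A * b₀ := by ring
      _ ≤ _ := by
        have := h.A_le_sq
        have := min_le_left (5 ^ K * q) (5 ^ (K + 1) * r)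
        gcongr
  -- bounds for the model
  set a : ℝ := P * (6 * C * A ^ 2 * ((A : ℝ)⁻¹ ^ (K + 1) * (5 ^ (K + 1) * r))) with ha
  set b : ℝ := min (P * (6 * C * A ^ 2 * (5 ^ K * q))) a with hb
  have ha0 : 0 < a := by positivity
  have hb0 : 0 < b := lt_min (by positivity) ha0
  have ka : ∀ i ≤ K + 1, ∀ x, nd i (fun w => chi e 2 (-3) w * cir e (vper e A u) w) x ≤ a := by
    intro i hi x
    refine (nd_chi_mul_le (e := e) (cir_smooth h.vper_smooth) hi
      (B := ((K + 1 : ℕ) + 2) * (6 * C * A ^ 2 * ((A : ℝ)⁻¹ ^ (K + 1) * (5 ^ (K + 1) * r))))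
      fun j hj => (nd_cir_le j h.vper_smooth h.vper_periodic (by omega) (hj.trans hi)
        hv1 x).trans ?_).trans (le_of_eq ?_)
    · have : (j : ℝ) ≤ (K + 1 : ℕ) := by exact_mod_cast hj.trans hi
      gcongr
    · rw [ha, hPdef]; ring
  have kb : ∀ i ≤ K, ∀ x, nd i (fun w => chi e 2 (-3) w * cir e (vper e A u) w) x ≤ b := by
    intro i hi x
    refine le_min ?_ (ka i (by omega) x)
    refine (nd_chi_mul_le (e := e) (K := K + 1) (cir_smooth h.vper_smooth) (by omega)
      (B := ((K + 1 : ℕ) + 2) * (6 * C * A ^ 2 * (5 ^ K * q)))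
      fun j hj => (nd_cir_le j h.vper_smooth h.vper_periodic (by omega) (hj.trans hi)
        hv0 x).trans ?_).trans (le_of_eq ?_)
    · have : (j : ℝ) ≤ (K + 1 : ℕ) := by exact_mod_cast (hj.trans hi).trans (Nat.le_succ K)
      gcongr
    · rw [hPdef]; ring
  have hg : TB (K + 1) b a fun w => chi e 2 (-3) w * cir e (vper e A u) w := fun x =>
    ⟨fun i _ hi => kb i (by omega) x, ka _ le_rfl x⟩
  have hb1 : ∀ j ≤ 6, opC (K + 1) ^ j * b ≤ 1 := fun j hj => by
    refine le_trans ?_ hsmall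
    have h1 : opC (K + 1) ^ j ≤ opC (K + 1) ^ 6 := pow_le_pow_right₀ (one_le_opC _) hj
    have h2 : b ≤ P * (48 * C * A ^ 2 * (5 ^ (K + 1) * q)) := (min_le_left _ _).trans (by
      gcongr
      · norm_num
      · norm_num
      · omega)
    calc _ ≤ opC (K + 1) ^ 6 * (P * (48 * C * A ^ 2 * (5 ^ (K + 1) * q))) := by gcongr
      _ = _ := by ring
  have hfib := FB_fib (e := e) hK2 hb0 (min_le_right _ _) (by simpa using hb1 1 (by norm_num))
    h.g_smooth hg
  have hE := hfib.comm_tr hK2 (by positivity) (mul_le_mul_of_nonneg_left (min_le_right _ _) hop.le)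
    (by rw [← mul_assoc, ← pow_two]; exact hb1 2 (by norm_num)) 1
  refine (h.nd_nxt (by omega) x).trans ((hE.2.1 _).2.trans ?_)
  have h3 : opC (K + 1) ^ 3 ≤ opC (K + 1) ^ 6 := pow_le_pow_right₀ (one_le_opC _) (by norm_num)
  calc opC (K + 1) ^ 2 * (opC (K + 1) * a) = opC (K + 1) ^ 3 * a := by ring
    _ ≤ opC (K + 1) ^ 6 * (P * (48 * C * A ^ 2 * ((A : ℝ)⁻¹ ^ (K + 1) * (5 ^ (K + 1) * r)))) := by
        rw [ha]; gcongr; norm_num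
    _ = stC₀ (K + 1) * A ^ 2 * (A : ℝ)⁻¹ ^ (K + 1) * r := by rw [stC₀, hPdef]; push_cast; ring
    _ ≤ _ := by gcongr; exact stC₀_succ_le K

end Complete

end Stg

end StageBounds

section Contents

variable {V : Type} [NormedAddCommGroup V] [InnerProductSpace ℝ V] {e : V} [he : Fact (‖e‖ = 1)]

namespace Stg

variable {K A : ℕ} {q : ℝ} {u : V → ℝ}

lemma mono_A (h : Stg e K A q u) {A' : ℕ} (h1 : 1 ≤ A') (hA : A' ≤ A) : Stg e K A' q u where
  two_le := h.two_le
  one_le := h1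
  smooth := h.smooth
  supp := h.supp
  pos := h.pos
  bound := h.bound
  small := by
    refine le_trans ?_ h.small
    have := stC_pos K
    have := h.pos
    gcongr

lemma vper_line (_h : Stg e K A q u) {z : V} (hz : ∀ t : ℝ, u ((A : ℝ)⁻¹ • pr e z + t • e) = 0)
    (y : ℝ) : vper e A u (pr e z + y • e) = 0 := by
  rw [vper, dil, vinf, smul_add, smul_smul, add_assoc, ← add_smul, Winf_line hz, mul_zero]

lemma triv_P (h : Stg e K A q u) {z : V} (hz : ∀ t : ℝ, u ((A : ℝ)⁻¹ • pr e z + t • e) = 0) :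
    stP e A u z = 1 := by
  ext y; rw [h.stP_apply, dil, smul_add, smul_smul, hz]; simp

lemma triv_g (h : Stg e K A q u) {z : V} (hz : ∀ t : ℝ, u ((A : ℝ)⁻¹ • pr e z + t • e) = 0) :
    stg e A u z = 1 := by
  ext y
  have h0 := h.vper_line hz 0
  rw [zero_smul, add_zero] at h0
  rw [h.stg_apply, cir, pr_add_smul, pr_pr, h.vper_line hz, h0]; simp

lemma triv_o (h : Stg e K A q u) {z : V} (hz : ∀ t : ℝ, u ((A : ℝ)⁻¹ • pr e z + t • e) = 0) :
    sto e A u z = 1 := by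
  ext y
  have h0 := h.vper_line hz 0
  rw [zero_smul, add_zero] at h0
  rw [h.sto_apply, pr_add_smul, pr_pr, h0]; simp

lemma triv_h (h : Stg e K A q u) {z : V} (hz : ∀ t : ℝ, u ((A : ℝ)⁻¹ • pr e z + t • e) = 0) :
    sth e A u z = 1 := by
  ext y; rw [h.sth_apply, dil, smul_add, smul_smul, Winf_line hz]; simp

lemma triv_E (h : Stg e K A q u) {z : V} (hz : ∀ t : ℝ, u ((A : ℝ)⁻¹ • pr e z + t • e) = 0) :
    stE e A u z = 1 := by rw [stE, h.triv_g hz]; group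

lemma triv_S (h : Stg e K A q u) {z : V} (hz : ∀ t : ℝ, u ((A : ℝ)⁻¹ • pr e z + t • e) = 0) :
    stS e A u z = 1 := by rw [stS, h.triv_o hz]; group

lemma triv_O (h : Stg e K A q u) {z : V} (hz : ∀ t : ℝ, u ((A : ℝ)⁻¹ • pr e z + t • e) = 0) :
    stO e A u z = 1 := by rw [stO, cut, h.triv_o hz]; group

lemma triv_H (h : Stg e K A q u) {z : V} (hz : ∀ t : ℝ, u ((A : ℝ)⁻¹ • pr e z + t • e) = 0) :
    stH e A u z = 1 := by rw [stH, hmodel, h.triv_o hz, h.triv_g hz, h.triv_h hz]; group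

end Stg

/-- Localisation of the content of a site. -/
structure Loc (e : V) [Fact (‖e‖ = 1)] (s : ℕ) (c : V → Equiv.Perm ℝ) : Prop where
  smooth : FSm e c
  hor : ∀ z, (2 : ℝ) ^ s / 4 < ‖pr e z‖ → c z = 1
  ver : ∀ z, Sup (c z) (Icc (-(25 * 2 ^ s)) (25 * 2 ^ s))

namespace Loc

variable {s : ℕ} {c : V → Equiv.Perm ℝ}

lemma one : Loc e s 1 := ⟨FSm.one, fun _ _ => rfl, fun _ _ _ => rfl⟩

lemma inv (h : Loc e s c) : Loc e s c⁻¹ :=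
  ⟨h.smooth.inv, fun z hz => by rw [Pi.inv_apply, h.hor z hz, inv_one], fun z => (h.ver z).inv⟩

lemma dis_zero_hor (h : Loc e s c) {w : V} (hw : (2 : ℝ) ^ s / 4 < ‖pr e w‖) : dis e c w = 0 := by
  rw [dis, h.hor _ (by rwa [pr_pr]), Equiv.Perm.one_apply, sub_self]

lemma dis_zero_ver (h : Loc e s c) {w : V} (hw : 25 * 2 ^ s < |yc e w|) : dis e c w = 0 := by
  rw [dis, h.ver _ _ (fun hm => absurd (abs_le.mpr hm) (not_le.mpr hw)), sub_self]

lemma abs_dis_le (h : Loc e s c) {M : ℝ} (hM : ∀ x, nd 1 (dis e c) x ≤ M) (x : V) :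
    |dis e c x| ≤ 52 * 2 ^ s * M := by
  have hM0 : 0 ≤ M := (nd_nonneg _ _ _).trans (hM 0)
  have h2 : (1 : ℝ) ≤ 2 ^ s := one_le_pow₀ (by norm_num)
  by_cases hx : 25 * 2 ^ s < |yc e x|
  · rw [h.dis_zero_ver hx, abs_zero]; positivity
  · have hx' := abs_le.mp (not_lt.mp hx)
    have h1 := norm_sub_le_of_nd_one h.smooth.1 hM x (pr e x + (26 * 2 ^ s : ℝ) • e)
    have h3 : dis e c (pr e x + (26 * 2 ^ s : ℝ) • e) = 0 := by
      refine h.dis_zero_ver ?_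
      rw [yc_add_smul, yc_pr, zero_add, abs_of_pos (by positivity)]; nlinarith
    have h4 : ‖x - (pr e x + (26 * 2 ^ s : ℝ) • e)‖ ≤ 52 * 2 ^ s := by
      have : x - (pr e x + (26 * 2 ^ s : ℝ) • e) = (yc e x - 26 * 2 ^ s) • e := by
        conv_lhs => rw [← pr_add_yc e x]
        rw [pr_add_smul, pr_pr, sub_smul]; abel
      rw [this, norm_smul, he.out, mul_one, Real.norm_eq_abs, abs_le]
      constructor <;> nlinarith [hx'.1, hx'.2]
    rw [h3, sub_zero, Real.norm_eq_abs] at h1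
    refine h1.trans ?_
    rw [mul_comm M] 
    gcongr

lemma nd_le (h : Loc e s c) {K : ℕ} (hK : 1 ≤ K) {B : ℝ} (ht : TB K B B (dis e c)) {i : ℕ}
    (hi : i ≤ K) (x : V) : nd i (dis e c) x ≤ 52 * 2 ^ s * B := by
  have hB : 0 ≤ B := (nd_nonneg _ _ _).trans (ht 0).2
  rcases Nat.eq_zero_or_pos i with rfl | hi0
  · rw [nd_zero, Real.norm_eq_abs]
    exact h.abs_dis_le (fun y => ht.plain le_rfl hK y) x
  · refine (ht.plain hi0 hi x).trans ?_
    have h2 : (1 : ℝ) ≤ 2 ^ s := one_le_pow₀ (by norm_num)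
    nlinarith

lemma bounded [FiniteDimensional ℝ V] (h : Loc e s c) (K : ℕ) :
    ∃ M, 0 ≤ M ∧ ∀ i ≤ K, ∀ x, nd i (dis e c) x ≤ M := by
  have hs : ∀ x : V, 26 * 2 ^ s < ‖x‖ → dis e c x = 0 := fun x hx => by
    by_contra hc
    have h1 : ‖pr e x‖ ≤ 2 ^ s / 4 := not_lt.mp fun hh => hc (h.dis_zero_hor hh)
    have h2 : |yc e x| ≤ 25 * 2 ^ s := not_lt.mp fun hh => hc (h.dis_zero_ver hh)
    have h3 := norm_le_pr_add_yc e x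
    have : (0 : ℝ) < 2 ^ s := by positivity
    linarith
  have key : ∀ i : ℕ, ∃ M, 0 ≤ M ∧ ∀ x, nd i (dis e c) x ≤ M := fun i => by
    have hcont : Continuous (nd i (dis e c)) :=
      (h.smooth.1.continuous_iteratedFDeriv (m := i) (by exact_mod_cast le_top)).norm
    obtain ⟨M, hM⟩ := (isCompact_closedBall (0 : V) (27 * 2 ^ s)).bddAbove_image
      hcont.continuousOn
    refine ⟨max M 0, le_max_right _ _, fun x => ?_⟩
    by_cases hx : x ∈ Metric.closedBall (0 : V) (27 * 2 ^ s)
    · exact (hM (mem_image_of_mem _ hx)).trans (le_max_left _ _)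
    · refine le_trans (le_of_eq (nd_eq_zero_of_eventually ?_ i)) (le_max_right _ _)
      have ho : IsOpen {y : V | 26 * 2 ^ s < ‖y‖} := isOpen_lt continuous_const continuous_norm
      rw [mem_closedBall_zero_iff, not_le] at hx
      filter_upwards [ho.mem_nhds (show 26 * 2 ^ s < ‖x‖ by
        have : (0 : ℝ) < 2 ^ s := by positivity
        linarith)] with y hy
      exact hs y hy
  choose M hM using key
  refine ⟨∑ i ∈ Finset.range (K + 1), M i, Finset.sum_nonneg fun i _ => (hM i).1,
    fun i hi x => ((hM i).2 x).trans ?_⟩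
  exact Finset.single_le_sum (f := M) (fun j _ => (hM j).1) (by simpa [Nat.lt_succ_iff] using hi)

end Loc

/-- Localisation of the input of a stage in the horizontal direction. -/
def HorSupp (e : V) (s : ℕ) (u : V → ℝ) : Prop := ∀ w, (2 : ℝ) ^ s / 4 < ‖pr e w‖ → u w = 0

namespace Stg

variable {K s i : ℕ} {q : ℝ} {u : V → ℝ}

lemma line_zero (hu : HorSupp e s u) {z : V} (hz : (2 : ℝ) ^ (s + i) / 4 < ‖pr e z‖) (t : ℝ) :
    u (((2 ^ i : ℕ) : ℝ)⁻¹ • pr e z + t • e) = 0 := by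
  refine hu _ ?_
  have h2 : (0 : ℝ) < 2 ^ i := by positivity
  rw [pr_add_smul, map_smul, pr_pr, norm_smul, Nat.cast_pow, Nat.cast_ofNat, norm_inv,
    Real.norm_eq_abs, abs_of_pos h2, inv_mul_eq_div, lt_div_iff₀ h2]
  rw [pow_add] at hz; linarith

variable [CompleteSpace V]

lemma loc_aux {c : V → Equiv.Perm ℝ} (hc : FSm e c)
    (ht : ∀ z, (2 : ℝ) ^ (s + i) / 4 < ‖pr e z‖ → c z = 1)
    (hv : ∀ z, Sup (c z) (Ioo (-3) (5 * (2 ^ i : ℕ) + 14))) : Loc e (s + i) c := by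
  refine ⟨hc, ht, fun z => (hv z).mono fun y hy => ?_⟩
  have h1 : (1 : ℝ) ≤ 2 ^ i := one_le_pow₀ (by norm_num)
  have h2 : (2 : ℝ) ^ i ≤ 2 ^ (s + i) := pow_le_pow_right₀ (by norm_num) (by omega)
  have h3 := hy.2
  push_cast at h3
  constructor <;> linarith [hy.1]

lemma loc_P (h : Stg e K (2 ^ i) q u) (hu : HorSupp e s u) :
    Loc e (s + i) (stP e (2 ^ i) u) := by
  refine loc_aux h.FB_P.1 (fun z hz => h.triv_P (line_zero hu hz)) fun z y hy => ?_
  rw [h.stP_apply, dil]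
  by_cases h0 : u (((2 ^ i : ℕ) : ℝ)⁻¹ • (pr e z + y • e)) = 0
  · rw [h0]; simp
  · refine absurd ?_ hy
    have h1 := h.supp _ h0
    have h2 := h.A_pos
    rw [map_smul, yc_add_smul, yc_pr, zero_add, smul_eq_mul, inv_mul_eq_div, lt_div_iff₀ h2,
      div_lt_iff₀ h2] at h1
    constructor <;> linarith

lemma loc_H (h : Stg e K (2 ^ i) q u) (hu : HorSupp e s u) :
    Loc e (s + i) (stH e (2 ^ i) u) :=
  loc_aux h.FB_H.1 (fun _ hz => h.triv_H (line_zero hu hz)) h.sup_H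

lemma loc_E (h : Stg e K (2 ^ i) q u) (hu : HorSupp e s u) :
    Loc e (s + i) (stE e (2 ^ i) u) :=
  loc_aux h.FB_E.1 (fun _ hz => h.triv_E (line_zero hu hz)) fun z => (h.sup_E z).mono
    (Ioo_subset_Ioo le_rfl (by linarith [h.A_pos]))

lemma loc_S (h : Stg e K (2 ^ i) q u) (hu : HorSupp e s u) :
    Loc e (s + i) (stS e (2 ^ i) u) :=
  loc_aux h.FB_S.1 (fun _ hz => h.triv_S (line_zero hu hz)) fun z => (h.sup_S z).mono
    (Ioo_subset_Ioo (by norm_num) (by linarith [h.A_pos]))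

lemma loc_O (h : Stg e K (2 ^ i) q u) (hu : HorSupp e s u) :
    Loc e (s + i) (stO e (2 ^ i) u) :=
  loc_aux h.FB_O.1 (fun _ hz => h.triv_O (line_zero hu hz)) fun z => (h.sup_O z).mono
    (Ioo_subset_Ioo (by norm_num) (by linarith [h.A_pos]))

lemma nxt_hor (h : Stg e K (2 ^ i) q u) (hu : HorSupp e s u) :
    HorSupp e (s + i + 1) (nxt e (2 ^ i) u) := fun w hw => by
  rw [nxt, (h.loc_E hu).dis_zero_hor, mul_zero]
  rw [pr_sub_smul, map_smul, norm_smul, Real.norm_eq_abs, abs_of_pos (by norm_num)]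
  rw [pow_succ] at hw; linarith

end Stg

end Contents

section StageSequence

variable {V : Type} [NormedAddCommGroup V] [InnerProductSpace ℝ V] {e : V} [he : Fact (‖e‖ = 1)]

/-- The first site of each stage, when stage `j` has `j + m + 1` sites. -/
def startSite (m : ℕ) : ℕ → ℕ
  | 0 => 0
  | j + 1 => startSite m j + (j + m) + 1

variable (e) in
/-- The inputs of the successive stages. -/
def stageInput (m : ℕ) (u : V → ℝ) : ℕ → V → ℝ
  | 0 => u
  | j + 1 => nxt e (2 ^ (j + m)) (stageInput m u j)

/-- The bound propagated along the stages. -/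
def stageBound (m l : ℕ) (ρ : ℝ) (j : ℕ) : ℝ :=
  ρ * (1 / 2) ^ (j + l * startSite m (j + 1) + 3 * (j + m))

lemma stageBound_pos {m l : ℕ} {ρ : ℝ} (hρ : 0 < ρ) (j : ℕ) : 0 < stageBound m l ρ j := by
  unfold stageBound; positivity

lemma half_pow_mul (n : ℕ) : (1 / 2 : ℝ) ^ n * 2 ^ n = 1 := by rw [← mul_pow]; norm_num

lemma stageBound_step {m l K : ℕ} {ρ : ℝ} (hρ : 0 < ρ) {j : ℕ} (hlK : l + 2 ≤ K)
    (hj : 16 * stC K * 4 ^ l ≤ 2 ^ (j + m)) :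
    stC K * ((2 ^ (j + m) : ℕ) : ℝ) ^ 2 * ((2 ^ (j + m) : ℕ) : ℝ)⁻¹ ^ (K + 1) *
      stageBound m l ρ j ≤ stageBound m l ρ (j + 1) := by
  set n := j + m with hn
  have e1 : startSite m (j + 1 + 1) = startSite m (j + 1) + n + 2 := by
    rw [startSite]; omega
  have e2 : stageBound m l ρ (j + 1) =
      stageBound m l ρ j * ((1 / 2) ^ 4 * (1 / 2) ^ (l * n) * (1 / 2) ^ (l * 2)) := by
    rw [stageBound, stageBound, e1, show j + 1 + m = n + 1 by omega, mul_assoc ρ, ← pow_add,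
      ← pow_add, ← pow_add]
    congr 2; ring
  rw [e2, mul_comm]
  refine mul_le_mul_of_nonneg_left ?_ (stageBound_pos hρ j).le
  have e3 : (((2 ^ n : ℕ) : ℝ))⁻¹ = (1 / 2) ^ n := by push_cast; rw [one_div, inv_pow]
  have e4 : (((2 ^ n : ℕ) : ℝ)) = 2 ^ n := by push_cast; rfl
  obtain ⟨k, rfl⟩ := Nat.exists_eq_add_of_le hlK
  have e6 : ((1 / 2 : ℝ) ^ n) ^ (l + 2 + k + 1) =
      (1 / 2) ^ n * (1 / 2) ^ n * ((1 / 2) ^ n * (1 / 2) ^ (l * n)) * ((1 / 2) ^ n) ^ k := by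
    have : (1 / 2 : ℝ) ^ (l * n) = ((1 / 2) ^ n) ^ l := by rw [mul_comm, pow_mul]
    rw [this]; ring
  have e7 : ((1 / 2 : ℝ) ^ n) ^ k ≤ 1 := pow_le_one₀ (by positivity)
    (pow_le_one₀ (by norm_num) (by norm_num))
  rw [e3, e4, e6]
  have h2 := half_pow_mul n
  have e8 : (4 : ℝ) ^ l * (1 / 2) ^ (l * 2) = 1 := by
    rw [mul_comm l 2, pow_mul, ← mul_pow]; norm_num
  have hC := stC_pos (l + 2 + k)
  have h3 : stC (l + 2 + k) * (1 / 2) ^ n ≤ (1 / 2) ^ 4 * (1 / 2) ^ (l * 2) := by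
    have h4 : stC (l + 2 + k) = (1 / 2) ^ 4 * (1 / 2) ^ (l * 2) * (16 * stC (l + 2 + k) * 4 ^ l) := by
      linear_combination (-stC (l + 2 + k)) * e8
    rw [h4, mul_assoc]
    refine mul_le_of_le_one_right (by positivity) ?_
    calc _ ≤ (2 : ℝ) ^ n * (1 / 2) ^ n := by gcongr
      _ = 1 := by rw [mul_comm]; exact h2
  calc _ = (stC (l + 2 + k) * (1 / 2) ^ n) * (1 / 2) ^ (l * n) * ((1 / 2) ^ n) ^ k *
        ((1 / 2) ^ n * 2 ^ n) ^ 2 := by ring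
    _ ≤ ((1 / 2) ^ 4 * (1 / 2) ^ (l * 2)) * (1 / 2) ^ (l * n) * 1 * 1 ^ 2 := by
        rw [h2]; gcongr
    _ = _ := by ring

lemma stageBound_sq {m l : ℕ} {ρ : ℝ} (hρ : 0 < ρ) (j : ℕ) :
    ((2 ^ (j + m) : ℕ) : ℝ) ^ 2 * stageBound m l ρ j ≤
      ρ * (1 / 2) ^ (j + l * startSite m (j + 1)) := by
  have h2 := half_pow_mul (j + m)
  have h3 : (1 / 2 : ℝ) ^ (j + m) ≤ 1 := pow_le_one₀ (by norm_num) (by norm_num)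
  have h4 : 0 ≤ ρ * (1 / 2) ^ (j + l * startSite m (j + 1)) := by positivity
  calc _ = ρ * (1 / 2) ^ (j + l * startSite m (j + 1)) * (1 / 2) ^ (j + m) *
        ((1 / 2) ^ (j + m) * 2 ^ (j + m)) ^ 2 := by
        rw [stageBound, pow_add _ (j + l * startSite m (j + 1)), mul_comm 3, pow_mul]; push_cast; ring
    _ ≤ ρ * (1 / 2) ^ (j + l * startSite m (j + 1)) * 1 * 1 ^ 2 := by rw [h2]; gcongr
    _ = _ := by ring

section Init

variable [CompleteSpace V] {m l K : ℕ} {ρ : ℝ} {u : V → ℝ}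

/-- Uniform bounds for all stages. -/
lemma stages_init (hlK : l + 2 ≤ K) (hm : 16 * stC K * 4 ^ l ≤ 2 ^ m) (hρ : 0 < ρ)
    (hρ1 : stC K * (5 * ρ) ≤ 1) (hu : Smooth u) (hs : ∀ x, u x ≠ 0 → 0 < yc e x ∧ yc e x < 4)
    (h0 : HorSupp e 0 u) (hb : ∀ x, nd (K + 1) u x ≤ stageBound m l ρ 0) (j : ℕ) :
    Stg e K (2 ^ (j + m)) (5 * stageBound m l ρ j) (stageInput e m u j) ∧
      HorSupp e (startSite m j) (stageInput e m u j) ∧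
      ∀ x, nd (K + 1) (stageInput e m u j) x ≤ stageBound m l ρ j := by
  have mk : ∀ j (v : V → ℝ), Smooth v → (∀ x, v x ≠ 0 → 0 < yc e x ∧ yc e x < 4) →
      (∀ x, nd (K + 1) v x ≤ stageBound m l ρ j) →
      Stg e K (2 ^ (j + m)) (5 * stageBound m l ρ j) v := fun j v hv hvs hvb =>
    { two_le := by omega
      one_le := Nat.one_le_two_pow
      smooth := hv
      supp := hvs
      pos := by have := stageBound_pos (m := m) (l := l) hρ j; positivity
      bound := nd_le_of_supp hv hvs hvb
      small := by
        have hC := stC_pos K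
        have h1 := stageBound_sq (m := m) (l := l) hρ j
        have h2 : ρ * (1 / 2) ^ (j + l * startSite m (j + 1)) ≤ ρ * 1 := by
          gcongr; exact pow_le_one₀ (by norm_num) (by norm_num)
        calc _ = stC K * (5 * (((2 ^ (j + m) : ℕ) : ℝ) ^ 2 * stageBound m l ρ j)) := by ring
          _ ≤ stC K * (5 * (ρ * 1)) :=
              mul_le_mul_of_nonneg_left (mul_le_mul_of_nonneg_left (h1.trans h2) (by norm_num)) hC.le
          _ ≤ 1 := by simpa using hρ1 }
  induction j with
  | zero => exact ⟨mk 0 u hu hs hb, h0, hb⟩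
  | succ j ih =>
    obtain ⟨h1, h2, h3⟩ := ih
    have hb' : ∀ x, nd (K + 1) (stageInput e m u (j + 1)) x ≤ stageBound m l ρ (j + 1) := fun x =>
      (h1.tame (stageBound_pos hρ j) h3 x).trans (stageBound_step hρ hlK (hm.trans (by
        gcongr
        · norm_num
        · omega)))
    exact ⟨mk (j + 1) _ h1.nxt_smooth h1.nxt_supp hb', h1.nxt_hor h2, hb'⟩

/-- Boundedness of the derivatives of an input. -/
lemma input_bounded [FiniteDimensional ℝ V] {s : ℕ} (hu : Smooth u)
    (hs : ∀ x, u x ≠ 0 → 0 < yc e x ∧ yc e x < 4) (h0 : HorSupp e s u) (i : ℕ) :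
    ∃ M : ℝ, 0 < M ∧ ∀ x, nd i u x ≤ M := by
  have hc : HasCompactSupport u := by
    refine HasCompactSupport.intro (isCompact_closedBall (0 : V) (2 ^ s / 4 + 4)) fun x hx => ?_
    by_contra hne
    refine hx ?_
    have h1 := hs x hne
    have h2 : ‖pr e x‖ ≤ 2 ^ s / 4 := not_lt.mp fun hh => hne (h0 x hh)
    have h3 := norm_le_pr_add_yc e x
    rw [abs_of_pos h1.1] at h3
    rw [mem_closedBall_zero_iff]; linarith
  have h1 : Continuous (iteratedFDeriv ℝ i u) :=
    hu.continuous_iteratedFDeriv (m := i) (by exact_mod_cast le_top)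
  obtain ⟨M, hM⟩ := (hc.iteratedFDeriv (𝕜 := ℝ) i).exists_bound_of_continuous h1
  exact ⟨max M 1, by positivity, fun x => (hM x).trans (le_max_left _ _)⟩

lemma exists_two_pow_ge (x : ℝ) : ∃ n : ℕ, x ≤ 2 ^ n := by
  obtain ⟨n, hn⟩ := pow_unbounded_of_one_lt x (by norm_num : (1 : ℝ) < 2)
  exact ⟨n, hn.le⟩

/-- Improving the order of differentiability along the stages. -/
lemma stages_succ [FiniteDimensional ℝ V] {p : ℕ → ℝ} {j₀ : ℕ}
    (hh : ∀ j, HorSupp e (startSite m j) (stageInput e m u j))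
    (h : ∀ j ≥ j₀, Stg e K (2 ^ (j + m)) (p j) (stageInput e m u j)) :
    ∃ ρ > 0, ∃ j₁, ∀ j ≥ j₁,
      Stg e (K + 1) (2 ^ (j + m)) (stageBound m (K - 2) ρ j) (stageInput e m u j) := by
  have hK := (h j₀ le_rfl).two_le
  obtain ⟨n, hn⟩ := exists_two_pow_ge (16 * stC K * 4 ^ (K - 2))
  set j₁ := max j₀ n with hj₁
  obtain ⟨M, hM0, hM⟩ := input_bounded (h j₁ (le_max_left _ _)).smooth
    (h j₁ (le_max_left _ _)).supp (hh j₁) (K + 1)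
  set ρ : ℝ := M * 2 ^ (j₁ + (K - 2) * startSite m (j₁ + 1) + 3 * (j₁ + m)) with hρ
  have hρ0 : 0 < ρ := by positivity
  have key : ∀ j ≥ j₁, ∀ x, nd (K + 1) (stageInput e m u j) x ≤ stageBound m (K - 2) ρ j := by
    intro j hj
    induction j, hj using Nat.le_induction with
    | base =>
      intro x
      refine (hM x).trans (le_of_eq ?_)
      rw [stageBound, hρ, mul_assoc, mul_comm (2 ^ _) ((1 / 2 : ℝ) ^ _), half_pow_mul, mul_one]
    | succ j hj ih =>
      intro x
      have hst := h j ((le_max_left _ _).trans hj)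
      refine (hst.tame (stageBound_pos hρ0 j) ih x).trans
        (stageBound_step hρ0 (by omega) (hn.trans ?_))
      have : n ≤ j := (le_max_right _ _).trans hj
      gcongr
      · norm_num
      · omega
  obtain ⟨n₂, hn₂⟩ := exists_two_pow_ge (stC (K + 1) * ρ)
  refine ⟨ρ, hρ0, max j₁ n₂, fun j hj => ?_⟩
  have hj1 : j₁ ≤ j := (le_max_left _ _).trans hj
  have hst := h j ((le_max_left _ _).trans hj1)
  exact
    { two_le := by omega
      one_le := Nat.one_le_two_pow
      smooth := hst.smooth
      supp := hst.supp
      pos := stageBound_pos hρ0 j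
      bound := key j hj1
      small := by
        have hC := stC_pos (K + 1)
        have h1 := stageBound_sq (m := m) (l := K - 2) hρ0 j
        have hj2 : n₂ ≤ j := (le_max_right _ _).trans hj
        have h2 : (1 / 2 : ℝ) ^ (j + (K - 2) * startSite m (j + 1)) ≤ (1 / 2) ^ n₂ :=
          pow_le_pow_of_le_one (by norm_num) (by norm_num) (by omega)
        calc _ = stC (K + 1) * (((2 ^ (j + m) : ℕ) : ℝ) ^ 2 * stageBound m (K - 2) ρ j) := by ring
          _ ≤ stC (K + 1) * (ρ * (1 / 2) ^ n₂) :=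
              mul_le_mul_of_nonneg_left (h1.trans (mul_le_mul_of_nonneg_left h2 hρ0.le)) hC.le
          _ ≤ 2 ^ n₂ * (1 / 2) ^ n₂ := by rw [← mul_assoc]; gcongr
          _ = 1 := by rw [mul_comm]; exact half_pow_mul n₂ }

/-- Decay of all orders along the stages. -/
lemma stages_decay [FiniteDimensional ℝ V] {p : ℕ → ℝ}
    (hh : ∀ j, HorSupp e (startSite m j) (stageInput e m u j))
    (h : ∀ j, Stg e K (2 ^ (j + m)) (p j) (stageInput e m u j)) (i : ℕ) :
    ∃ ρ > 0, ∃ j₁, ∀ j ≥ j₁, Stg e (K + i + 1) (2 ^ (j + m)) (stageBound m (K + i - 2) ρ j)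
      (stageInput e m u j) := by
  induction i with
  | zero => exact stages_succ hh (j₀ := 0) fun j _ => h j
  | succ i ih =>
    obtain ⟨ρ, hρ, j₁, hj⟩ := ih
    have := stages_succ hh hj
    exact this

end Init

end StageSequence

section Sites

variable {V : Type} [NormedAddCommGroup V] [InnerProductSpace ℝ V] {e : V} [he : Fact (‖e‖ = 1)]

/-- The stage of a site and the position of the site in its stage. -/
def sitePos (m : ℕ) : ℕ → ℕ × ℕ
  | 0 => (0, 0)
  | s + 1 => if (sitePos m s).2 = (sitePos m s).1 + m then ((sitePos m s).1 + 1, 0)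
      else ((sitePos m s).1, (sitePos m s).2 + 1)

lemma sitePos_spec (m s : ℕ) : startSite m (sitePos m s).1 + (sitePos m s).2 = s ∧
    (sitePos m s).2 ≤ (sitePos m s).1 + m := by
  induction s with
  | zero => simp [sitePos, startSite]
  | succ s ih =>
    rw [sitePos]
    split_ifs with h
    · simp only [startSite]; omega
    · simp only; omega

lemma site_lt (m s : ℕ) : s < startSite m ((sitePos m s).1 + 1) := by
  have := sitePos_spec m s
  rw [startSite]; omega

lemma startSite_mono (m : ℕ) : Monotone (startSite m) :=
  monotone_nat_of_le_succ fun j => by rw [startSite]; omega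

variable (e) in
/-- Uniform geometric decay of contents of sites. -/
def Decay (K l : ℕ) (M : ℝ) (c : ℕ → V → Equiv.Perm ℝ) : Prop :=
  ∀ s, ∀ i ≤ K, ∀ x, nd i (dis e (c s)) x ≤ M * (1 / 2) ^ (l * s) ∧
    nd i (dis e (c s)⁻¹) x ≤ M * (1 / 2) ^ (l * s)

variable (e) in
/-- Well behaved contents of sites. -/
structure Sites (c : ℕ → V → Equiv.Perm ℝ) : Prop where
  loc : ∀ s, Loc e s (c s)
  decay : ∀ K l, ∃ M, Decay e K l M c

variable (e) in
/-- Well behaved contents in terms of stages. -/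
structure Adm (m : ℕ) (u : V → ℝ) (c : ℕ × ℕ → V → Equiv.Perm ℝ) : Prop where
  loc : ∀ j i, i ≤ j + m → Loc e (startSite m j + i) (c (j, i))
  fb : ∀ j i, i ≤ j + m → ∀ K q, Stg e K (2 ^ (j + m)) q (stageInput e m u j) →
    FB e K (Stg.bd K (2 ^ (j + m)) q) (Stg.bd K (2 ^ (j + m)) q) (c (j, i))

namespace Adm

variable {m : ℕ} {u : V → ℝ} {c : ℕ × ℕ → V → Equiv.Perm ℝ}

lemma loc_site (h : Adm e m u c) (s : ℕ) : Loc e s (c (sitePos m s)) := by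
  have h1 := sitePos_spec m s
  have h2 := h.loc _ _ h1.2
  rwa [h1.1] at h2

lemma site_le (h : Adm e m u c) {K l s i : ℕ} {q ρ : ℝ} (hρ : 0 < ρ) {j : ℕ}
    (hj : j = (sitePos m s).1) (hq : q ≤ 5 * stageBound m (l + 1) ρ j)
    (hS : Stg e K (2 ^ (j + m)) q (stageInput e m u j)) (hi : i ≤ K) (x : V) :
    nd i (dis e (c (sitePos m s))) x ≤ 260 * stC K * ρ * (1 / 2) ^ (l * s) ∧
      nd i (dis e (c (sitePos m s))⁻¹) x ≤ 260 * stC K * ρ * (1 / 2) ^ (l * s) := by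
  subst hj
  have hfb := h.fb _ _ (sitePos_spec m s).2 _ _ hS
  have hC := stC_pos K
  have h1 : Stg.bd K (2 ^ ((sitePos m s).1 + m)) q ≤ stC K * 5 * ρ * (1 / 2) ^ ((l + 1) * s) := by
    have h2 := stageBound_sq (m := m) (l := l + 1) hρ (sitePos m s).1
    have h3 : (1 / 2 : ℝ) ^ ((sitePos m s).1 + (l + 1) * startSite m ((sitePos m s).1 + 1)) ≤
        (1 / 2) ^ ((l + 1) * s) := by
      refine pow_le_pow_of_le_one (by norm_num) (by norm_num) ?_
      have := Nat.mul_le_mul_left (l + 1) (site_lt m s).le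
      omega
    rw [Stg.bd]
    calc _ ≤ stC K * ((2 ^ ((sitePos m s).1 + m) : ℕ) : ℝ) ^ 2 *
          (5 * stageBound m (l + 1) ρ (sitePos m s).1) := by gcongr
      _ = stC K * 5 * (((2 ^ ((sitePos m s).1 + m) : ℕ) : ℝ) ^ 2 *
          stageBound m (l + 1) ρ (sitePos m s).1) := by ring
      _ ≤ stC K * 5 * (ρ * (1 / 2) ^ ((l + 1) * s)) :=
          mul_le_mul_of_nonneg_left (h2.trans (mul_le_mul_of_nonneg_left h3 hρ.le)) (by positivity)
      _ = _ := by ring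
  have h4 : 52 * 2 ^ s * Stg.bd K (2 ^ ((sitePos m s).1 + m)) q ≤
      260 * stC K * ρ * (1 / 2) ^ (l * s) := by
    calc _ ≤ 52 * 2 ^ s * (stC K * 5 * ρ * (1 / 2) ^ ((l + 1) * s)) := by gcongr
      _ = 260 * stC K * ρ * (1 / 2) ^ (l * s) * ((1 / 2) ^ s * 2 ^ s) := by
          rw [Nat.succ_mul, pow_add]; ring
      _ = _ := by rw [half_pow_mul, mul_one]
  have hK : 1 ≤ K := by linarith [hS.two_le]
  exact ⟨((h.loc_site s).nd_le hK hfb.2.1 hi x).trans h4,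
    ((h.loc_site s).inv.nd_le hK hfb.2.2 hi x).trans h4⟩

lemma sites [FiniteDimensional ℝ V] (h : Adm e m u c) {K : ℕ} {p : ℕ → ℝ}
    (hh : ∀ j, HorSupp e (startSite m j) (stageInput e m u j))
    (hS : ∀ j, Stg e K (2 ^ (j + m)) (p j) (stageInput e m u j)) :
    Sites e (fun s => c (sitePos m s)) := by
  refine ⟨h.loc_site, fun K' l => ?_⟩
  have : CompleteSpace V := FiniteDimensional.complete ℝ V
  have hK := (hS 0).two_le
  obtain ⟨ρ, hρ, j₁, hj₁⟩ := stages_decay hh hS (K' + l + 1)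
  choose A hA0 hA using fun s => (h.loc_site s).bounded K'
  choose B hB0 hB using fun s => (h.loc_site s).inv.bounded K'
  set N := startSite m j₁
  set M₁ := ∑ s ∈ Finset.range N, (A s + B s) * 2 ^ (l * s) with hM₁
  have hM₁0 : 0 ≤ M₁ := Finset.sum_nonneg fun s _ => by
    have := hA0 s
    have := hB0 s
    positivity
  set M₂ := 260 * stC (K + (K' + l + 1) + 1) * ρ with hM₂
  have hM₂0 : 0 ≤ M₂ := by have := stC_pos (K + (K' + l + 1) + 1); positivity
  refine ⟨M₁ + M₂, fun s i hi x => ?_⟩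
  have hp : (0 : ℝ) < (1 / 2) ^ (l * s) := by positivity
  by_cases hs : (sitePos m s).1 < j₁
  · have hsN : s < N := (site_lt m s).trans_le (startSite_mono m hs)
    have h1 : (A s + B s) * 2 ^ (l * s) ≤ M₁ :=
      Finset.single_le_sum (f := fun s => (A s + B s) * (2 : ℝ) ^ (l * s)) (fun s _ => by
        have := hA0 s
        have := hB0 s
        positivity) (Finset.mem_range.mpr hsN)
    have h2 : A s + B s ≤ (M₁ + M₂) * (1 / 2) ^ (l * s) := by
      calc A s + B s = (A s + B s) * 2 ^ (l * s) * (1 / 2) ^ (l * s) := by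
            rw [mul_assoc, mul_comm ((2 : ℝ) ^ _), half_pow_mul, mul_one]
        _ ≤ _ := by gcongr; linarith
    exact ⟨(hA s i hi x).trans (by linarith [hB0 s]), (hB s i hi x).trans (by linarith [hA0 s])⟩
  · have h1 := hj₁ _ (not_lt.mp hs)
    have h2 : stageBound m (K + (K' + l + 1) - 2) ρ (sitePos m s).1 ≤
        5 * stageBound m (l + 1) ρ (sitePos m s).1 := by
      have h3 : stageBound m (K + (K' + l + 1) - 2) ρ (sitePos m s).1 ≤
          stageBound m (l + 1) ρ (sitePos m s).1 := by
        unfold stageBound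
        refine mul_le_mul_of_nonneg_left (pow_le_pow_of_le_one (by norm_num) (by norm_num) ?_) hρ.le
        have : (l + 1) ≤ K + (K' + l + 1) - 2 := by omega
        gcongr
      linarith [stageBound_pos (m := m) (l := l + 1) hρ (sitePos m s).1]
    have h4 := h.site_le hρ rfl h2 h1 (i := i) (by omega) x
    have h5 : M₂ * (1 / 2) ^ (l * s) ≤ (M₁ + M₂) * (1 / 2) ^ (l * s) := by gcongr; linarith
    exact ⟨h4.1.trans h5, h4.2.trans h5⟩

end Adm

end Sites

section SiteContents

variable {V : Type} [NormedAddCommGroup V] [InnerProductSpace ℝ V] {e : V} [he : Fact (‖e‖ = 1)]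

variable (e) in
/-- The full contents of the sites. -/
def fullC (m : ℕ) (u : V → ℝ) (p : ℕ × ℕ) : V → Equiv.Perm ℝ :=
  stP e (2 ^ p.2) (stageInput e m u p.1)

/-- Contents which are trivial at the last site of each stage. -/
def lowC (m : ℕ) (c : ℕ × ℕ → V → Equiv.Perm ℝ) (p : ℕ × ℕ) : V → Equiv.Perm ℝ :=
  if p.2 = p.1 + m then 1 else c p

variable (e) in
/-- Contents supported by the last site of each stage. -/
def topC (st : ℕ → (V → ℝ) → V → Equiv.Perm ℝ) (m : ℕ) (u : V → ℝ) (p : ℕ × ℕ) : V → Equiv.Perm ℝ :=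
  if p.2 = p.1 + m then st (2 ^ p.2) (stageInput e m u p.1) else 1

lemma dbl_inv_apply (y : ℝ) : dbl⁻¹ y = y / 2 := by
  rw [Equiv.Perm.inv_eq_iff_eq, Equiv.mulLeft₀_apply]; ring

lemma FB.one {K : ℕ} (hK : 1 ≤ K) {b : ℝ} (hb : 0 ≤ b) : FB e K b b 1 := by
  have h : TB K b b (dis e (1 : V → Equiv.Perm ℝ)) := by
    refine TB.of_plain hK fun i hi _ x => ?_
    rw [show dis e (1 : V → Equiv.Perm ℝ) = fun _ => 0 from funext (dis_one e), nd_const _ (by omega)]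
    exact hb
  exact ⟨FSm.one, h, by rwa [inv_one]⟩

variable {m : ℕ} {u : V → ℝ}

lemma bd_mono {K A A' : ℕ} {q : ℝ} (hq : 0 ≤ q) (hA : A ≤ A') : Stg.bd K A q ≤ Stg.bd K A' q := by
  have := stC_pos K
  unfold Stg.bd
  gcongr

lemma bd_nonneg (K A : ℕ) {q : ℝ} (hq : 0 ≤ q) : 0 ≤ Stg.bd K A q := by
  have := stC_pos K
  unfold Stg.bd
  positivity

section Adm

variable [CompleteSpace V] {K : ℕ} {p : ℕ → ℝ}
  (hh : ∀ j, HorSupp e (startSite m j) (stageInput e m u j))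
  (hS : ∀ j, Stg e K (2 ^ (j + m)) (p j) (stageInput e m u j))
include hh hS

lemma adm_full : Adm e m u (fullC e m u) where
  loc j i hi := ((hS j).mono_A Nat.one_le_two_pow
    (Nat.pow_le_pow_right (by norm_num) hi)).loc_P (hh j)
  fb j i hi K q h := by
    have h1 : 2 ^ i ≤ 2 ^ (j + m) := Nat.pow_le_pow_right (by norm_num) hi
    exact (h.mono_A Nat.one_le_two_pow h1).FB_P.mono (bd_mono h.pos.le h1) (bd_mono h.pos.le h1)

lemma adm_low : Adm e m u (lowC m (fullC e m u)) where
  loc j i hi := by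
    unfold lowC
    split_ifs
    · exact Loc.one
    · exact (adm_full hh hS).loc j i hi
  fb j i hi K q h := by
    unfold lowC
    split_ifs
    · exact FB.one (by linarith [h.two_le]) (bd_nonneg _ _ h.pos.le)
    · exact (adm_full hh hS).fb j i hi K q h

lemma adm_top {st : ℕ → (V → ℝ) → V → Equiv.Perm ℝ}
    (h1 : ∀ (K s i : ℕ) q u, Stg e K (2 ^ i) q u → HorSupp e s u → Loc e (s + i) (st (2 ^ i) u))
    (h2 : ∀ (K A : ℕ) q u, Stg e K A q u → FB e K (Stg.bd K A q) (Stg.bd K A q) (st A u)) :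
    Adm e m u (topC e st m u) where
  loc j i hi := by
    unfold topC
    split_ifs with h
    · obtain rfl : i = j + m := h
      exact h1 _ _ _ _ _ (hS j) (hh j)
    · exact Loc.one
  fb j i hi K q h := by
    unfold topC
    split_ifs with h'
    · obtain rfl : i = j + m := h'
      exact h2 _ _ _ _ h
    · exact FB.one (by linarith [h.two_le]) (bd_nonneg _ _ h.pos.le)

end Adm

variable (e) in
/-- Families of contents of sites encoding a function. -/
structure SiteData (u : V → ℝ) (x l h E S O : ℕ → V → Equiv.Perm ℝ) : Prop where
  start : ∀ z y, x 0 z y = y + u (pr e z + y • e)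
  word : ∀ s z, x s z = l s z * h s z * xword (tr (1 / 2)) aff₂ aff₄ (E s z) (S s z) (O s z) *
    (tr 1 * (h s z)⁻¹ * (tr 1)⁻¹)
  next : ∀ s z, pr e z = z → x (s + 1) z = dbl * (l s ((1 / 2 : ℝ) • z) *
    (tr 3 * E s ((1 / 2 : ℝ) • z) * (tr 3)⁻¹)) * dbl⁻¹

lemma siteData_of_stages {K : ℕ} {p : ℕ → ℝ}
    (hS : ∀ j, Stg e K (2 ^ (j + m)) (p j) (stageInput e m u j)) :
    SiteData e u (fun s => fullC e m u (sitePos m s)) (fun s => lowC m (fullC e m u) (sitePos m s))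
      (fun s => topC e (stH e) m u (sitePos m s)) (fun s => topC e (stE e) m u (sitePos m s))
      (fun s => topC e (stS e) m u (sitePos m s)) (fun s => topC e (stO e) m u (sitePos m s)) where
  start z y := by
    have h := (hS 0).mono_A (A' := 2 ^ 0) le_rfl (Nat.one_le_two_pow)
    have := h.stP_apply z y
    simp only [dil, pow_zero, Nat.cast_one, one_mul, inv_one, one_smul] at this
    exact this
  word s z := by
    simp only [lowC, topC]
    split_ifs with h
    · rw [fullC, h, (hS _).identity]; simp
    · simp only [xword, Pi.one_apply, inv_one, mul_one, mul_inv_cancel]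
  next s z hz := by
    have hz2 : pr e ((1 / 2 : ℝ) • z) = (1 / 2 : ℝ) • z := by rw [map_smul, hz]
    have hle := (sitePos_spec m s).2
    ext y
    simp only [lowC, topC]
    by_cases h : (sitePos m s).2 = (sitePos m s).1 + m
    · rw [if_pos h, if_pos h]
      have e1 : sitePos m (s + 1) = ((sitePos m s).1 + 1, 0) := by rw [sitePos, if_pos h]
      rw [fullC, e1, ((hS _).mono_A (A' := 2 ^ 0) le_rfl Nat.one_le_two_pow).stP_apply, h]
      have h3 : (1 / 2 : ℝ) • (z + y • e) - (3 : ℝ) • e = (1 / 2 : ℝ) • z + (y / 2 - 3) • e := by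
        module
      simp only [dil, pow_zero, Nat.cast_one, inv_one, one_smul, one_mul, Equiv.Perm.mul_apply, hz]
      rw [stageInput, nxt, h3]
      have key := apply_pr e (stE e (2 ^ ((sitePos m s).1 + m)) (stageInput e m u (sitePos m s).1))
        ((1 / 2 : ℝ) • z) (y / 2 - 3)
      rw [hz2] at key
      have h4 : dbl⁻¹ y = y / 2 := dbl_inv_apply y
      rw [h4, tr_inv_apply, key, Pi.one_apply, Equiv.Perm.one_apply, Equiv.mulLeft₀_apply,
        Equiv.coe_addRight]
      ring
    · rw [if_neg h, if_neg h]
      have e1 : sitePos m (s + 1) = ((sitePos m s).1, (sitePos m s).2 + 1) := by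
        rw [sitePos, if_neg h]
      rw [fullC, e1]
      have hg1 := (hS (sitePos m s).1).mono_A (A' := 2 ^ ((sitePos m s).2 + 1)) Nat.one_le_two_pow
        (Nat.pow_le_pow_right (by norm_num) (by omega))
      have hg2 := (hS (sitePos m s).1).mono_A (A' := 2 ^ ((sitePos m s).2)) Nat.one_le_two_pow
        (Nat.pow_le_pow_right (by norm_num) (by omega))
      rw [hg1.stP_apply]
      simp only [Equiv.Perm.mul_apply, Pi.one_apply, Equiv.Perm.one_apply, fullC]
      have h4 : dbl⁻¹ y = y / 2 := dbl_inv_apply y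
      have h5 : ((2 ^ ((sitePos m s).2 + 1) : ℕ) : ℝ)⁻¹ • (z + y • e) =
          ((2 ^ (sitePos m s).2 : ℕ) : ℝ)⁻¹ • ((1 / 2 : ℝ) • z + (y / 2) • e) := by
        push_cast
        rw [pow_succ, mul_inv, mul_smul]
        module
      rw [h4, pself_inv, hg2.stP_apply, hz2, hz, Equiv.mulLeft₀_apply, dil, dil, h5]
      push_cast
      ring

/-- Small functions are encoded by well behaved small contents of sites. -/
theorem exists_siteData [FiniteDimensional ℝ V] (K l : ℕ) {ε : ℝ} (hε : 0 < ε) :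
    ∃ k : ℕ, ∃ ρ > 0, ∀ u : V → ℝ, Smooth u → (∀ x, u x ≠ 0 → 0 < yc e x ∧ yc e x < 4) →
      HorSupp e 0 u → (∀ x, nd k u x ≤ ρ) →
      ∃ x y h E S O : ℕ → V → Equiv.Perm ℝ, SiteData e u x y h E S O ∧
        (∀ c ∈ [y, h, E, S, O], Sites e c ∧ Decay e K l ε c) := by
  have : CompleteSpace V := FiniteDimensional.complete ℝ V
  set K' := K + l + 3 with hK'
  obtain ⟨m, hm⟩ := exists_two_pow_ge (16 * stC K' * 4 ^ (l + 1))
  have hC := stC_pos K'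
  set ρ : ℝ := min (1 / (5 * stC K')) (ε / (260 * stC K')) with hρ
  have hρ0 : 0 < ρ := by positivity
  have hρ1 : stC K' * (5 * ρ) ≤ 1 := by
    have : ρ ≤ 1 / (5 * stC K') := min_le_left _ _
    rw [le_div_iff₀ (by positivity)] at this
    linarith
  have hρ2 : 260 * stC K' * ρ ≤ ε := by
    have : ρ ≤ ε / (260 * stC K') := min_le_right _ _
    rw [le_div_iff₀ (by positivity)] at this
    linarith
  refine ⟨K' + 1, stageBound m (l + 1) ρ 0, stageBound_pos hρ0 0, fun u hu hs h0 hb => ?_⟩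
  have hst := stages_init (m := m) (by omega) hm hρ0 hρ1 hu hs h0 hb
  have hh := fun j => (hst j).2.1
  have hS := fun j => (hst j).1
  refine ⟨_, _, _, _, _, _, siteData_of_stages hS, ?_⟩
  have key : ∀ c, Adm e m u c → Sites e (fun s => c (sitePos m s)) ∧
      Decay e K l ε (fun s => c (sitePos m s)) := fun c hc => by
    refine ⟨hc.sites hh hS, fun s i hi x => ?_⟩
    have h1 := hc.site_le hρ0 rfl le_rfl (hS (sitePos m s).1) (i := i) (by omega) x
    have h2 : 260 * stC K' * ρ * (1 / 2) ^ (l * s) ≤ ε * (1 / 2) ^ (l * s) := by gcongr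
    exact ⟨h1.1.trans h2, h1.2.trans h2⟩
  simp only [List.mem_cons, List.not_mem_nil, or_false]
  rintro c (rfl | rfl | rfl | rfl | rfl)
  · exact key _ (adm_low hh hS)
  · exact key _ (adm_top hh hS (fun _ _ _ _ _ h => h.loc_H) fun _ _ _ _ h => h.FB_H)
  · exact key _ (adm_top hh hS (fun _ _ _ _ _ h => h.loc_E) fun _ _ _ _ h => h.FB_E)
  · exact key _ (adm_top hh hS (fun _ _ _ _ _ h => h.loc_S) fun _ _ _ _ h => h.FB_S)
  · exact key _ (adm_top hh hS (fun _ _ _ _ _ h => h.loc_O) fun _ _ _ _ h => h.FB_O)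

end SiteContents

section SmoothSeries

variable {E F : Type*} [NormedAddCommGroup E] [NormedSpace ℝ E] [NormedAddCommGroup F]
  [NormedSpace ℝ F] [CompleteSpace F]

lemma summable_half_pow (M : ℝ) : Summable fun s : ℕ => M * (1 / 2 : ℝ) ^ s :=
  (summable_geometric_of_lt_one (by norm_num) (by norm_num)).mul_left M

lemma smooth_tsum {f : ℕ → E → F} (hf : ∀ s, Smooth (f s))
    (h : ∀ k, ∃ M, ∀ s x, nd k (f s) x ≤ M * (1 / 2) ^ s) : Smooth fun x => ∑' s, f s x := by
  choose M hM using h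
  exact contDiff_tsum (v := fun k s => M k * (1 / 2) ^ s) hf (fun k _ => summable_half_pow _)
    fun k i x _ => hM k i x

lemma nd_tsum_le {f : ℕ → E → F} (hf : ∀ s, Smooth (f s))
    (h : ∀ k, ∃ M, ∀ s x, nd k (f s) x ≤ M * (1 / 2) ^ s) {k : ℕ} {ε : ℝ}
    (hε : ∀ s x, nd k (f s) x ≤ ε * (1 / 2) ^ s) (x : E) :
    nd k (fun x => ∑' s, f s x) x ≤ 2 * ε := by
  choose M hM using h
  have h1 := iteratedFDeriv_tsum_apply (v := fun k s => M k * (1 / 2) ^ s) (N := ⊤) hf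
    (fun k _ => summable_half_pow _) (fun k i x _ => hM k i x) (k := k) le_top x
  rw [nd, h1]
  have h2 : HasSum (fun s : ℕ => ε * (1 / 2 : ℝ) ^ s) (ε * 2) :=
    hasSum_geometric_two.mul_left ε
  rw [mul_comm 2]
  exact tsum_of_norm_bounded h2 fun s => hε s x

end SmoothSeries

section Reciprocal

/-- A positive smooth function equal to the identity on `[1/4, ∞)`. -/
def posId (t : ℝ) : ℝ := Real.smoothTransition (4 * t) * t + (1 - Real.smoothTransition (4 * t))

lemma posId_pos (t : ℝ) : 0 < posId t := by
  have h0 := Real.smoothTransition.nonneg (4 * t)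
  have h1 := Real.smoothTransition.le_one (4 * t)
  unfold posId
  rcases le_or_gt t 0 with ht | ht
  · rw [Real.smoothTransition.zero_of_nonpos (by linarith)]; norm_num
  · rcases h0.eq_or_lt with h | h
    · rw [← h]; norm_num
    · have := mul_pos h ht; linarith

/-- A smooth function equal to the reciprocal on `[1/4, ∞)`. -/
def recip (t : ℝ) : ℝ := (posId t)⁻¹

lemma recip_eq {t : ℝ} (ht : 1 / 4 ≤ t) : recip t = t⁻¹ := by
  rw [recip, posId, Real.smoothTransition.one_of_one_le (by linarith)]; simp

lemma recip_smooth : Smooth recip := by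
  have h1 : Smooth fun t : ℝ => Real.smoothTransition (4 * t) :=
    smoothTransition_smooth.comp (contDiff_const.mul contDiff_id)
  have h2 : Smooth posId := (h1.mul contDiff_id).add (contDiff_const.sub h1)
  exact h2.inv fun t => (posId_pos t).ne'

lemma exists_recip_bound (K : ℕ) : ∃ C, 1 ≤ C ∧ ∀ i ≤ K, ∀ t ∈ Icc (1 / 2 : ℝ) (3 / 2),
    nd i recip t ≤ C := by
  have key : ∀ i : ℕ, ∃ M, 0 ≤ M ∧ ∀ t ∈ Icc (1 / 2 : ℝ) (3 / 2), nd i recip t ≤ M := fun i => by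
    have hcont : Continuous (nd i recip) :=
      (recip_smooth.continuous_iteratedFDeriv (m := i) (by exact_mod_cast le_top)).norm
    obtain ⟨M, hM⟩ := (isCompact_Icc (a := (1 / 2 : ℝ)) (b := 3 / 2)).bddAbove_image
      hcont.continuousOn
    exact ⟨max M 0, le_max_right _ _, fun t ht => (hM (mem_image_of_mem _ ht)).trans (le_max_left _ _)⟩
  choose M hM using key
  refine ⟨1 + ∑ i ∈ Finset.range (K + 1), M i,
    by linarith [Finset.sum_nonneg (s := Finset.range (K + 1)) fun i _ => (hM i).1],
    fun i hi x hx => ((hM i).2 x hx).trans ?_⟩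
  have := Finset.single_le_sum (f := M) (s := Finset.range (K + 1)) (fun j _ => (hM j).1)
    (show i ∈ _ by simpa [Nat.lt_succ_iff] using hi)
  linarith

end Reciprocal

section Lift

variable {V : Type} [NormedAddCommGroup V] [InnerProductSpace ℝ V] {e p : V}
  [he : Fact (‖e‖ = 1)] [hp : Fact (‖p‖ = 1)]

variable (e p) in
/-- The points of the site `s`. -/
def AtSite (s : ℕ) (Z : V) : Prop := ‖(4 : ℝ) ^ s • pr e Z - p‖ < 1 / 2

/-- The multiplication by a nonzero number. -/
def mulPerm (t : ℝ) : Equiv.Perm ℝ := if h : t ≠ 0 then Equiv.mulLeft₀ t h else 1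

lemma mulPerm_apply {t : ℝ} (h : t ≠ 0) (y : ℝ) : mulPerm t y = t * y := by
  rw [mulPerm, dif_pos h]; rfl

lemma mulPerm_inv_apply {t : ℝ} (h : t ≠ 0) (y : ℝ) : (mulPerm t)⁻¹ y = y / t := by
  rw [Equiv.Perm.inv_eq_iff_eq, mulPerm_apply h]; field_simp

lemma mulPerm_mul {s t : ℝ} (hs : s ≠ 0) (ht : t ≠ 0) : mulPerm (s * t) = mulPerm s * mulPerm t := by
  ext y; rw [Equiv.Perm.mul_apply, mulPerm_apply ht, mulPerm_apply hs,
    mulPerm_apply (mul_ne_zero hs ht), mul_assoc]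

/-- The base point is horizontal. -/
class Horizontal (e p : V) : Prop where
  out : pr e p = p

variable [hep : Horizontal e p]

lemma yc_base : yc p e = 0 := by
  have h : yc e p = 0 := by rw [← hep.out, yc_pr]
  simp only [yc, innerSL_apply_apply] at h ⊢
  rw [real_inner_comm]; exact h

lemma yc_base_pr (Z : V) : yc p (pr e Z) = yc p Z := by
  rw [pr_apply, map_sub, map_smul, yc_base (e := e), smul_zero, sub_zero]

lemma abs_yc_base_sub (Z : V) : |yc p Z - 1| ≤ ‖pr e Z - p‖ := by
  have : yc p Z - 1 = yc p (pr e Z - p) := by rw [map_sub, yc_base_pr, yc_self (e := p)]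
  rw [this]; exact abs_yc_le (e := p) _

lemma AtSite.yc {s : ℕ} {Z : V} (h : AtSite e p s Z) :
    1 / 2 < 4 ^ s * yc p Z ∧ 4 ^ s * yc p Z < 3 / 2 := by
  have h1 := abs_yc_base_sub (e := e) (p := p) ((4 : ℝ) ^ s • Z)
  rw [map_smul, map_smul, smul_eq_mul] at h1
  have h2 := abs_lt.mp (h1.trans_lt h)
  constructor <;> linarith [h2.1, h2.2]

lemma AtSite.yc_pos {s : ℕ} {Z : V} (h : AtSite e p s Z) : 0 < DiffDistortion.yc p Z := by
  have h1 : (0 : ℝ) < 4 ^ s := by positivity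
  by_contra hc
  nlinarith [h.yc.1, not_lt.mp hc]

lemma AtSite.unique {s t : ℕ} {Z : V} (hs : AtSite e p s Z) (ht : AtSite e p t Z) : s = t := by
  by_contra hne
  wlog hlt : s < t generalizing s t
  · exact this ht hs (Ne.symm hne) (lt_of_le_of_ne (not_lt.mp hlt) (Ne.symm hne))
  obtain ⟨k, rfl⟩ := Nat.exists_eq_add_of_lt hlt
  have h1 := ht.yc.2
  have h2 : (1 : ℝ) ≤ 4 ^ k := one_le_pow₀ (by norm_num)
  rw [pow_succ, pow_add] at h1
  have h3 := hs.yc.1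
  nlinarith

lemma atSite_pr {s : ℕ} {Z : V} : AtSite e p s (pr e Z) ↔ AtSite e p s Z := by
  rw [AtSite, AtSite, pr_pr]

variable (e p) in
/-- The coordinate of the lines through a site. -/
def siteCoord (s : ℕ) (Z : V) : V := (2 : ℝ) ^ s • ((4 : ℝ) ^ s • pr e Z - p)

variable (e p) in
open Classical in
/-- The family of permutations with prescribed contents of the sites. -/
def lift : (ℕ → V → Equiv.Perm ℝ) →* (V → Equiv.Perm ℝ) where
  toFun c Z := if h : ∃ s, AtSite e p s Z then
    mulPerm (yc p Z) * c h.choose (siteCoord e p h.choose Z) * (mulPerm (yc p Z))⁻¹ else 1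
  map_one' := by
    funext Z
    simp only [Pi.one_apply]
    split_ifs <;> group
  map_mul' c d := by
    funext Z
    simp only [Pi.mul_apply]
    split_ifs
    · group
    · rfl

lemma lift_apply {c : ℕ → V → Equiv.Perm ℝ} {s : ℕ} {Z : V} (h : AtSite e p s Z) :
    lift e p c Z = mulPerm (yc p Z) * c s (siteCoord e p s Z) * (mulPerm (yc p Z))⁻¹ := by
  have hex : ∃ s, AtSite e p s Z := ⟨s, h⟩
  refine (dif_pos hex).trans ?_
  rw [hex.choose_spec.unique h]

lemma lift_apply_none {c : ℕ → V → Equiv.Perm ℝ} {Z : V} (h : ∀ s, ¬ AtSite e p s Z) :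
    lift e p c Z = 1 :=
  dif_neg (not_exists.mpr h)

variable (e p) in
/-- The argument of the displacement of the content of a site. -/
def siteArg (s : ℕ) (X : V) : V :=
  (recip (yc p X) * yc e X) • e + (2 : ℝ) ^ s • (pr e X - p)

variable (e p) in
/-- The normalized displacement of a site. -/
def siteG (s : ℕ) (f : V → ℝ) (X : V) : ℝ := yc p X * f (siteArg e p s X)

variable (e p) in
/-- The displacement of a site. -/
def siteD (s : ℕ) (f : V → ℝ) (Z : V) : ℝ := ((4 : ℝ) ^ s)⁻¹ * siteG e p s f ((4 : ℝ) ^ s • Z)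

lemma siteArg_smooth (s : ℕ) : Smooth (siteArg e p s) := by
  have h1 : Smooth fun X : V => recip (yc p X) * yc e X :=
    (recip_smooth.comp (yc p).contDiff).mul (yc e).contDiff
  exact (h1.smul contDiff_const).add (contDiff_const.smul ((pr e).contDiff.sub contDiff_const))

lemma siteG_smooth (s : ℕ) {f : V → ℝ} (hf : Smooth f) : Smooth (siteG e p s f) :=
  (yc p).contDiff.mul (hf.comp (siteArg_smooth s))

lemma siteD_smooth (s : ℕ) {f : V → ℝ} (hf : Smooth f) : Smooth (siteD e p s f) :=
  contDiff_const.mul ((siteG_smooth s hf).comp (contDiff_const.smul contDiff_id))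

lemma pr_siteArg (s : ℕ) (X : V) : pr e (siteArg e p s X) = (2 : ℝ) ^ s • (pr e X - p) := by
  rw [siteArg, add_comm, pr_add_smul, map_smul, map_sub, pr_pr, hep.out]

lemma yc_siteArg (s : ℕ) (X : V) : yc e (siteArg e p s X) = recip (yc p X) * yc e X := by
  rw [siteArg, add_comm, yc_add_smul, map_smul, map_sub, yc_pr, ← hep.out, yc_pr]
  simp

variable {s : ℕ} {c : V → Equiv.Perm ℝ}

lemma siteG_eq_zero_hor (hc : Loc e s c) {X : V} (hX : 1 / 4 < ‖pr e X - p‖) :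
    siteG e p s (dis e c) X = 0 := by
  rw [siteG, hc.dis_zero_hor, mul_zero]
  rw [pr_siteArg, norm_smul, norm_pow, Real.norm_two]
  have : (0 : ℝ) < 2 ^ s := by positivity
  nlinarith

lemma siteG_eq_zero_ver (hc : Loc e s c) {X : V} (hX : 40 * 2 ^ s < |yc e X|) :
    siteG e p s (dis e c) X = 0 := by
  by_cases hh : 1 / 4 < ‖pr e X - p‖
  · exact siteG_eq_zero_hor hc hh
  · have h1 := abs_le.mp ((abs_yc_base_sub (e := e) (p := p) X).trans (not_lt.mp hh))
    rw [siteG, hc.dis_zero_ver, mul_zero]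
    rw [yc_siteArg, recip_eq (by linarith [h1.1]), abs_mul, abs_inv,
      abs_of_pos (by linarith [h1.1]), inv_mul_eq_div, lt_div_iff₀ (by linarith [h1.1])]
    have : (0 : ℝ) < 2 ^ s := by positivity
    nlinarith [h1.2]

/-- The displacement of a lift is the sum of the displacements of the sites. -/
lemma dis_lift {c : ℕ → V → Equiv.Perm ℝ} (hc : ∀ s, Loc e s (c s)) (Z : V) :
    dis e (lift e p c) Z = ∑' s, siteD e p s (dis e (c s)) Z := by
  have h0 : ∀ s, ¬ AtSite e p s Z → siteD e p s (dis e (c s)) Z = 0 := fun s hs => by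
    rw [siteD, siteG_eq_zero_hor (hc s), mul_zero]
    rw [map_smul]
    linarith [not_lt.mp hs]
  by_cases h : ∃ s, AtSite e p s Z
  · obtain ⟨s, hs⟩ := h
    have hpos := hs.yc_pos
    have h4 : (4 : ℝ) ^ s ≠ 0 := by positivity
    rw [tsum_eq_single s fun t ht => h0 t fun h => ht (h.unique hs)]
    rw [dis, lift_apply (atSite_pr.mpr hs), yc_base_pr, Equiv.Perm.mul_apply, Equiv.Perm.mul_apply,
      mulPerm_apply hpos.ne', mulPerm_inv_apply hpos.ne']
    have h2 : siteArg e p s ((4 : ℝ) ^ s • Z) =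
        siteCoord e p s (pr e Z) + (yc e Z / yc p Z) • e := by
      rw [siteArg, siteCoord, map_smul, map_smul, map_smul, pr_pr, smul_eq_mul, smul_eq_mul,
        recip_eq (by linarith [hs.yc.1]), add_comm]
      congr 2
      field_simp
    have h5 : pr e (siteCoord e p s (pr e Z)) = siteCoord e p s (pr e Z) := by
      rw [siteCoord, map_smul, map_sub, map_smul, pr_pr, pr_pr, hep.out]
    have key := apply_pr e (c s) (siteCoord e p s (pr e Z)) (yc e Z / yc p Z)
    rw [h5] at key
    rw [key, siteD, siteG, h2, map_smul, smul_eq_mul]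
    field_simp
    ring
  · push Not at h
    rw [dis, lift_apply_none fun s hs => h s (atSite_pr.mp hs), Equiv.Perm.one_apply, sub_self]
    simp [h0 _ (h _)]

end Lift

section LiftBounds

variable {V : Type} [NormedAddCommGroup V] [InnerProductSpace ℝ V] {e p : V}
  [he : Fact (‖e‖ = 1)] [hp : Fact (‖p‖ = 1)] [hep : Horizontal e p]

lemma nd_yc_le {i : ℕ} {x : V} {B : ℝ} (hB : 1 ≤ B) (hx : |yc e x| ≤ B) :
    nd i (fun y => yc e y) x ≤ B := by
  rcases i with _ | _ | i
  · rwa [nd_zero, Real.norm_eq_abs]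
  · rw [nd_one, show fderiv ℝ (fun y => yc e y) x = yc e from (yc e).fderiv]
    exact (norm_yc_le e).trans hB
  · rw [nd_clm _ (by omega)]; linarith

lemma one_le_two_pow' (s : ℕ) : (1 : ℝ) ≤ 2 ^ s := one_le_pow₀ (by norm_num)

lemma nd_siteArg_le {K : ℕ} {C : ℝ} (hC1 : 1 ≤ C)
    (hC : ∀ i ≤ K, ∀ t ∈ Icc (1 / 2 : ℝ) (3 / 2), nd i recip t ≤ C) {s : ℕ} {X : V}
    (h1 : ‖pr e X - p‖ ≤ 1 / 4) (h2 : |yc e X| ≤ 40 * 2 ^ s) {i : ℕ} (hi : 1 ≤ i) (hiK : i ≤ K) :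
    nd i (siteArg e p s) X ≤ (2 ^ K * C * 42 * 2 ^ s) ^ i := by
  have h2s := one_le_two_pow' s
  have h2K := one_le_two_pow' K
  have hb := abs_le.mp ((abs_yc_base_sub (e := e) (p := p) X).trans h1)
  have hmem : yc p X ∈ Icc (1 / 2 : ℝ) (3 / 2) := by constructor <;> linarith [hb.1, hb.2]
  have hs1 : Smooth fun X : V => recip (yc p X) := recip_smooth.comp (yc p).contDiff
  have hs2 : Smooth fun X : V => recip (yc p X) * yc e X := hs1.mul (yc e).contDiff
  have e1 : ∀ j ≤ i, nd j (fun X : V => recip (yc p X)) X ≤ C := fun j hj => by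
    refine (nd_comp_clm_le (yc p) recip_smooth j X).trans ?_
    have h3 : ‖yc p‖ ^ j ≤ 1 := pow_le_one₀ (norm_nonneg _) (norm_yc_le p)
    have h4 := hC j (hj.trans hiK) _ hmem
    have := nd_nonneg j recip (yc p X)
    nlinarith
  have e2 := nd_mul_le hs1 (yc e).contDiff e1
    (fun j _ => nd_yc_le (i := j) (by linarith) h2)
  have hs3 : Smooth fun X : V => (2 : ℝ) ^ s • (pr e X - p) :=
    contDiff_const.smul ((pr e).contDiff.sub contDiff_const)
  have e3 : nd i (fun X : V => (2 : ℝ) ^ s • (pr e X - p)) X ≤ 2 ^ s * 1 := by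
    rw [nd_const_smul ((pr e).contDiff.sub contDiff_const), abs_of_pos (by positivity)]
    refine mul_le_mul_of_nonneg_left ?_ (by positivity)
    rw [nd_sub_const (pr e).contDiff _ hi]
    rcases hi.eq_or_lt with rfl | hi'
    · rw [nd_one, show fderiv ℝ (fun y => pr e y) X = pr e from (pr e).fderiv]
      exact norm_pr_le e
    · rw [nd_clm _ (by omega)]; norm_num
  have e4 : nd i (siteArg e p s) X ≤ 2 ^ i * (C * (40 * 2 ^ s)) + 2 ^ s * 1 :=
    (nd_add_le (hs2.smul contDiff_const) hs3 i X).trans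
      (add_le_add ((nd_smul_e hs2 i X).trans e2) e3)
  have e5 : (2 : ℝ) ^ i ≤ 2 ^ K := pow_le_pow_right₀ (by norm_num) hiK
  have e6 : (1 : ℝ) ≤ 2 ^ K * C := one_le_mul_of_one_le_of_one_le h2K hC1
  have e7 : 2 ^ i * (C * (40 * 2 ^ s)) + 2 ^ s * 1 ≤ 2 ^ K * C * 42 * 2 ^ s := by
    have h3 : (2 : ℝ) ^ i * (C * (40 * 2 ^ s)) ≤ 2 ^ K * (C * (40 * 2 ^ s)) := by gcongr
    nlinarith
  refine (e4.trans e7).trans (le_self_pow₀ ?_ (by omega))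
  nlinarith

lemma exists_siteG_bound (e p : V) [Fact (‖e‖ = 1)] [Fact (‖p‖ = 1)] [Horizontal e p] (K : ℕ) :
    ∃ C, 1 ≤ C ∧ ∀ s c M, Loc e s c → (∀ i ≤ K, ∀ x, nd i (dis e c) x ≤ M) → ∀ i ≤ K, ∀ X : V,
      nd i (siteG e p s (dis e c)) X ≤ C * (2 ^ s) ^ K * M := by
  obtain ⟨C, hC1, hC⟩ := exists_recip_bound K
  set D := 2 ^ K * C * 42 with hD
  have hD1 : 1 ≤ D := by nlinarith [one_le_two_pow' K]
  have hF : (1 : ℝ) ≤ K.factorial := by exact_mod_cast Nat.succ_le_of_lt K.factorial_pos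
  refine ⟨2 ^ K * (2 * (K.factorial * D ^ K)), ?_, ?_⟩
  · have := one_le_two_pow' K
    have h1 : 1 ≤ D ^ K := one_le_pow₀ hD1
    have h2 := one_le_mul_of_one_le_of_one_le hF h1
    nlinarith
  intro s c M hc hM i hi X
  have hM0 : 0 ≤ M := (nd_nonneg _ _ _).trans (hM 0 (Nat.zero_le _) 0)
  have h2s := one_le_two_pow' s
  have hpos : 0 ≤ 2 ^ K * (2 * (K.factorial * D ^ K)) * (2 ^ s) ^ K * M := by positivity
  by_cases h1 : 1 / 4 < ‖pr e X - p‖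
  · refine (nd_eq_zero_of_eventually ?_ i).trans_le hpos
    have ho : IsOpen {Y : V | 1 / 4 < ‖pr e Y - p‖} :=
      isOpen_lt continuous_const ((pr e).continuous.sub continuous_const).norm
    filter_upwards [ho.mem_nhds h1] with Y hY
    exact siteG_eq_zero_hor hc hY
  by_cases h2 : 40 * 2 ^ s < |yc e X|
  · refine (nd_eq_zero_of_eventually ?_ i).trans_le hpos
    have ho : IsOpen {Y : V | 40 * 2 ^ s < |yc e Y|} :=
      isOpen_lt continuous_const (yc e).continuous.abs
    filter_upwards [ho.mem_nhds h2] with Y hY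
    exact siteG_eq_zero_ver hc hY
  rw [not_lt] at h1 h2
  have hb := abs_le.mp ((abs_yc_base_sub (e := e) (p := p) X).trans h1)
  have e1 : ∀ j ≤ i, nd j (fun Y => dis e c (siteArg e p s Y)) X ≤
      K.factorial * M * (D * 2 ^ s) ^ K := fun j hj => by
    have hjK := hj.trans hi
    refine (norm_iteratedFDeriv_comp_le (n := j) (N := (⊤ : ℕ∞)) hc.smooth.1 (siteArg_smooth s)
      (by exact_mod_cast le_top) X (C := M) (D := D * 2 ^ s)
      (fun k hk => hM k (hk.trans hjK) _)
      (fun k hk1 hk => nd_siteArg_le hC1 hC h1 h2 hk1 (hk.trans hjK))).trans ?_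
    have h3 : (1 : ℝ) ≤ D * 2 ^ s := one_le_mul_of_one_le_of_one_le hD1 h2s
    have h4 : (j.factorial : ℝ) ≤ K.factorial := by exact_mod_cast Nat.factorial_le hjK
    have h5 : (D * 2 ^ s) ^ j ≤ (D * 2 ^ s) ^ K := pow_le_pow_right₀ h3 hjK
    gcongr
  have e2 := nd_mul_le (i := i) (x := X) (yc p).contDiff (hc.smooth.1.comp (siteArg_smooth s))
    (fun j _ => nd_yc_le (e := p) (B := 2) (by norm_num)
      (by rw [abs_le]; constructor <;> linarith [hb.1, hb.2])) e1
  have e3 : (2 : ℝ) ^ i ≤ 2 ^ K := pow_le_pow_right₀ (by norm_num) hi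
  calc nd i (siteG e p s (dis e c)) X ≤ 2 ^ i * (2 * (K.factorial * M * (D * 2 ^ s) ^ K)) := e2
    _ ≤ 2 ^ K * (2 * (K.factorial * M * (D * 2 ^ s) ^ K)) := by gcongr
    _ = _ := by rw [mul_pow]; ring

lemma exists_siteD_bound (e p : V) [Fact (‖e‖ = 1)] [Fact (‖p‖ = 1)] [Horizontal e p] (K : ℕ) :
    ∃ C, 1 ≤ C ∧ ∀ s c M, Loc e s c → (∀ i ≤ K, ∀ x, nd i (dis e c) x ≤ M) → ∀ i ≤ K, ∀ X : V,
      nd i (siteD e p s (dis e c)) X ≤ C * 2 ^ (3 * K * s) * M := by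
  obtain ⟨C, hC1, hC⟩ := exists_siteG_bound e p K
  refine ⟨C, hC1, fun s c M hc hM i hi X => ?_⟩
  have hg := siteG_smooth (e := e) (p := p) s hc.smooth.1
  have h4 : (1 : ℝ) ≤ 4 ^ s := one_le_pow₀ (by norm_num)
  have hM0 : 0 ≤ M := (nd_nonneg _ _ _).trans (hM 0 (Nat.zero_le _) 0)
  have h1 : nd i (siteD e p s (dis e c)) X =
      |((4 : ℝ) ^ s)⁻¹| * (|(4 : ℝ) ^ s| ^ i * nd i (siteG e p s (dis e c)) ((4 : ℝ) ^ s • X)) := by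
    rw [← nd_comp_smul hg]
    have hg2 : Smooth fun y : V => siteG e p s (dis e c) ((4 : ℝ) ^ s • y) :=
      hg.comp (contDiff_const.smul contDiff_id)
    exact nd_const_mul hg2 _ i X
  rw [h1, abs_of_pos (by positivity), abs_of_pos (by positivity)]
  have h2 := hC s c M hc hM i hi ((4 : ℝ) ^ s • X)
  have h3 : ((4 : ℝ) ^ s)⁻¹ ≤ 1 := inv_le_one_of_one_le₀ h4
  have h5 : ((4 : ℝ) ^ s) ^ i ≤ (4 ^ s) ^ K := pow_le_pow_right₀ h4 hi
  have h6 : (2 : ℝ) ^ (3 * K * s) = (4 ^ s) ^ K * (2 ^ s) ^ K := by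
    rw [← mul_pow, ← mul_pow, show (4 : ℝ) * 2 = 2 ^ 3 by norm_num, ← pow_mul, ← pow_mul]
    congr 1; ring
  calc _ ≤ 1 * ((4 ^ s) ^ K * (C * (2 ^ s) ^ K * M)) := by gcongr
    _ = _ := by rw [h6]; ring

lemma Sites.inv {c : ℕ → V → Equiv.Perm ℝ} (h : Sites e c) : Sites e c⁻¹ :=
  ⟨fun s => (h.loc s).inv, fun K l => by
    obtain ⟨M, hM⟩ := h.decay K l
    refine ⟨M, fun s i hi x => ⟨(hM s i hi x).2, ?_⟩⟩
    rw [Pi.inv_apply, inv_inv]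
    exact (hM s i hi x).1⟩

lemma two_pow_mul_half (K s : ℕ) : (2 : ℝ) ^ (3 * K * s) * (1 / 2) ^ ((3 * K + 1) * s) =
    (1 / 2) ^ s := by
  rw [show (3 * K + 1) * s = 3 * K * s + s by ring, pow_add, ← mul_assoc, mul_comm ((2 : ℝ) ^ _),
    half_pow_mul, one_mul]

lemma exists_lift_bound (e p : V) [Fact (‖e‖ = 1)] [Fact (‖p‖ = 1)] [Horizontal e p] (K : ℕ) :
    ∃ C, 1 ≤ C ∧ ∀ c M, (∀ s, Loc e s (c s)) → Decay e K (3 * K + 1) M c → ∀ s, ∀ i ≤ K, ∀ X : V,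
      nd i (siteD e p s (dis e (c s))) X ≤ C * M * (1 / 2) ^ s := by
  obtain ⟨C, hC1, hC⟩ := exists_siteD_bound e p K
  refine ⟨C, hC1, fun c M hl hd s i hi X => ?_⟩
  refine (hC s (c s) _ (hl s) (fun i hi x => (hd s i hi x).1) i hi X).trans (le_of_eq ?_)
  rw [← two_pow_mul_half K s]; ring

lemma lift_decay {c : ℕ → V → Equiv.Perm ℝ} (h : Sites e c) (k : ℕ) :
    ∃ M, ∀ s (x : V), nd k (siteD e p s (dis e (c s))) x ≤ M * (1 / 2) ^ s := by
  obtain ⟨C, _, hC⟩ := exists_lift_bound e p k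
  obtain ⟨M, hM⟩ := h.decay k (3 * k + 1)
  exact ⟨C * M, fun s x => hC c M h.loc hM s k le_rfl x⟩

lemma lift_FSm {c : ℕ → V → Equiv.Perm ℝ} (h : Sites e c) : FSm e (lift e p c) := by
  have key : ∀ c : ℕ → V → Equiv.Perm ℝ, Sites e c → Smooth (dis e (lift e p c)) := fun c h => by
    rw [funext (dis_lift h.loc)]
    exact smooth_tsum (fun s => siteD_smooth s (h.loc s).smooth.1) (lift_decay h)
  exact ⟨key c h, by rw [← map_inv]; exact key _ h.inv⟩

lemma exists_lift_small (e p : V) [Fact (‖e‖ = 1)] [Fact (‖p‖ = 1)] [Horizontal e p] (K : ℕ) :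
    ∃ C, 1 ≤ C ∧ ∀ c M, Sites e c → Decay e K (3 * K + 1) M c → ∀ i ≤ K, ∀ X : V,
      nd i (dis e (lift e p c)) X ≤ 2 * (C * M) := by
  obtain ⟨C, hC1, hC⟩ := exists_lift_bound e p K
  refine ⟨C, hC1, fun c M h hM i hi X => ?_⟩
  rw [funext (dis_lift h.loc)]
  exact nd_tsum_le (fun s => siteD_smooth s (h.loc s).smooth.1) (lift_decay h)
    (fun s x => hC c M h.loc hM s i hi x) X

lemma lift_zero {c : ℕ → V → Equiv.Perm ℝ} (h : ∀ s, Loc e s (c s)) {Z : V} (hZ : 42 < ‖Z‖) :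
    dis e (lift e p c) Z = 0 := by
  rw [dis_lift h]
  refine (tsum_congr fun s => ?_).trans tsum_zero
  by_contra hc
  have h4 : (1 : ℝ) ≤ 4 ^ s := one_le_pow₀ (by norm_num)
  have h24 : (2 : ℝ) ^ s ≤ 4 ^ s := pow_le_pow_left₀ (by norm_num) (by norm_num) s
  have hc' : siteG e p s (dis e (c s)) ((4 : ℝ) ^ s • Z) ≠ 0 := fun h0 => hc (by rw [siteD, h0, mul_zero])
  have h1 : ‖pr e ((4 : ℝ) ^ s • Z) - p‖ ≤ 1 / 4 :=
    not_lt.mp fun hh => hc' (siteG_eq_zero_hor (h s) hh)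
  have h2 : |yc e ((4 : ℝ) ^ s • Z)| ≤ 40 * 2 ^ s :=
    not_lt.mp fun hh => hc' (siteG_eq_zero_ver (h s) hh)
  have h3 := norm_le_pr_add_yc e ((4 : ℝ) ^ s • Z)
  have h5 : ‖pr e ((4 : ℝ) ^ s • Z)‖ ≤ 5 / 4 := by
    have := norm_le_norm_sub_add (pr e ((4 : ℝ) ^ s • Z)) p
    rw [hp.out] at this; linarith
  rw [norm_smul, norm_pow, Real.norm_of_nonneg (by norm_num : (0 : ℝ) ≤ 4)] at h3
  nlinarith

end LiftBounds

section MachineWord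

/-- The word expressing a fiberwise diffeomorphism. -/
def mword {G : Type*} [Group G] (T S C₂ C₄ C σ F H E s Ω : G) : G :=
  F * H * xword S C₂ C₄ E s Ω * (T * H⁻¹ * T⁻¹) * ((σ * F * σ⁻¹) * (C * E * C⁻¹))⁻¹

lemma map_mword {G G' : Type*} [Group G] [Group G'] (φ : G →* G') (T S C₂ C₄ C σ F H E s Ω : G) :
    φ (mword T S C₂ C₄ C σ F H E s Ω) =
      mword (φ T) (φ S) (φ C₂) (φ C₄) (φ C) (φ σ) (φ F) (φ H) (φ E) (φ s) (φ Ω) := by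
  simp only [mword, xword, map_mul, map_inv]

lemma conj_eq_of_agree {α : Type*} {c c' Y : Equiv.Perm α} {B : Set α} (hc : ∀ x ∈ B, c' x = c x)
    (hY : Sup Y B) : c' * Y * c'⁻¹ = c * Y * c⁻¹ := by
  have h1 : Sup (c⁻¹ * c') Bᶜ := fun x hx => by
    rw [Equiv.Perm.mul_apply, hc x (not_not.mp hx), pinv_self]
  have h2 : Commute (c⁻¹ * c') Y := h1.commute hY disjoint_compl_left
  calc c' * Y * c'⁻¹ = c * ((c⁻¹ * c') * Y) * (c⁻¹ * c')⁻¹ * c⁻¹ := by group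
    _ = c * Y * c⁻¹ := by rw [h2.eq]; group

lemma mword_agree {α : Type*} {T S C₂ C₄ C σ T' S' C₂' C₄' C' σ' F H E s Ω : Equiv.Perm α}
    {B : Set α} (hT : ∀ x ∈ B, T' x = T x) (hS : ∀ x ∈ B, S' x = S x)
    (hC₂ : ∀ x ∈ B, C₂' x = C₂ x) (hC₄ : ∀ x ∈ B, C₄' x = C₄ x) (hC : ∀ x ∈ B, C' x = C x)
    (hσ : ∀ x ∈ B, σ' x = σ x) (hF : Sup F B) (hH : Sup H B) (hE : Sup E B) (hs : Sup s B) :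
    mword T' S' C₂' C₄' C' σ' F H E s Ω = mword T S C₂ C₄ C σ F H E s Ω := by
  simp only [mword, xword]
  rw [conj_eq_of_agree hT hH.inv, conj_eq_of_agree hS hs, conj_eq_of_agree hC₂ hs,
    conj_eq_of_agree hC₄ hs, conj_eq_of_agree hC hE, conj_eq_of_agree hσ hF]

end MachineWord

section Machine

variable {V : Type} [NormedAddCommGroup V] [InnerProductSpace ℝ V] {e p : V}
  [he : Fact (‖e‖ = 1)] [hp : Fact (‖p‖ = 1)] [hep : Horizontal e p]

variable (e) in
/-- The scaling between consecutive sites. -/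
def sig : Equiv.Perm V where
  toFun w := (1 / 4 : ℝ) • (w + yc e w • e)
  invFun w := (4 : ℝ) • w - (2 * yc e w) • e
  left_inv w := by
    simp only [map_smul, yc_add_smul, smul_smul, smul_eq_mul]
    module
  right_inv w := by
    simp only [yc_sub_smul, map_smul, smul_eq_mul]
    module

lemma sig_apply (w : V) : sig e w = (1 / 4 : ℝ) • (w + yc e w • e) := rfl

lemma yc_sig (w : V) : yc e (sig e w) = 1 / 2 * yc e w := by
  rw [sig_apply, map_smul, yc_add_smul, smul_eq_mul]; ring

lemma pr_sig (w : V) : pr e (sig e w) = (1 / 4 : ℝ) • pr e w := by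
  rw [sig_apply, map_smul, pr_add_smul]

lemma ext_pr_yc {v w : V} (h1 : pr e v = pr e w) (h2 : yc e v = yc e w) : v = w := by
  rw [← pr_add_yc e v, ← pr_add_yc e w, h1, h2]

lemma pr_act (a : V → Equiv.Perm ℝ) (w : V) : pr e (act e a w) = pr e w := by
  rw [act_apply', pr_add_smul, pr_pr]

lemma yc_act (a : V → Equiv.Perm ℝ) (w : V) : yc e (act e a w) = a (pr e w) (yc e w) := by
  rw [act_apply', yc_add_smul, yc_pr, zero_add]

/-- The effect of the scaling on families. -/
def sigFam (a : V → Equiv.Perm ℝ) (Z : V) : Equiv.Perm ℝ :=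
  mulPerm (1 / 2) * a ((4 : ℝ) • Z) * (mulPerm (1 / 2))⁻¹

lemma sig_conj (a : V → Equiv.Perm ℝ) : sig e * act e a * (sig e)⁻¹ = act e (sigFam a) := by
  rw [mul_inv_eq_iff_eq_mul]
  ext w
  simp only [Equiv.Perm.mul_apply]
  have h2 : (1 / 2 : ℝ) ≠ 0 := by norm_num
  refine ext_pr_yc (e := e) ?_ ?_
  · rw [pr_sig, pr_act, pr_act, pr_sig]
  · rw [yc_sig, yc_act, yc_act, yc_sig, pr_sig, sigFam, smul_smul, Equiv.Perm.mul_apply,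
      Equiv.Perm.mul_apply, mulPerm_apply h2, mulPerm_inv_apply h2]
    norm_num

variable (p) in
/-- Translation of the lines by a multiple of the coordinate. -/
def trF (t : ℝ) (Z : V) : Equiv.Perm ℝ := tr (t * yc p Z)

/-- Doubling on the lines. -/
def dblF (_ : V) : Equiv.Perm ℝ := dbl

lemma mulPerm_conj_tr {ℓ : ℝ} (h : ℓ ≠ 0) (t : ℝ) :
    mulPerm ℓ * tr t * (mulPerm ℓ)⁻¹ = tr (t * ℓ) := by
  rw [mul_inv_eq_iff_eq_mul]
  ext y
  simp only [Equiv.Perm.mul_apply, mulPerm_apply h, Equiv.coe_addRight]; ring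

lemma mulPerm_conj_dbl {ℓ : ℝ} (h : ℓ ≠ 0) : mulPerm ℓ * dbl * (mulPerm ℓ)⁻¹ = dbl := by
  rw [mul_inv_eq_iff_eq_mul]
  ext y
  simp only [Equiv.Perm.mul_apply, mulPerm_apply h, Equiv.mulLeft₀_apply]; ring

lemma mulPerm_half_four {ℓ : ℝ} (h : ℓ ≠ 0) :
    mulPerm (1 / 2) * mulPerm (4 * ℓ) = mulPerm ℓ * dbl := by
  ext y
  simp only [Equiv.Perm.mul_apply, mulPerm_apply h, Equiv.mulLeft₀_apply,
    mulPerm_apply (show (1 / 2 : ℝ) ≠ 0 by norm_num),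
    mulPerm_apply (mul_ne_zero (four_ne_zero (α := ℝ)) h)]
  ring

lemma atSite_four {s : ℕ} {Z : V} : AtSite e p s ((4 : ℝ) • Z) ↔ AtSite e p (s + 1) Z := by
  rw [AtSite, AtSite, map_smul, smul_smul, ← pow_succ]

lemma siteCoord_four (s : ℕ) (Z : V) :
    siteCoord e p s ((4 : ℝ) • Z) = (1 / 2 : ℝ) • siteCoord e p (s + 1) Z := by
  simp only [siteCoord, map_smul, smul_smul]
  rw [← pow_succ]
  congr 1
  rw [pow_succ]; ring

variable {u : V → ℝ} {x l h E S O : ℕ → V → Equiv.Perm ℝ}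

lemma aff_conj {Z : V} (hℓ : yc p Z ≠ 0) (t : ℝ) :
    trF p t Z * dblF Z = mulPerm (yc p Z) * (tr t * dbl) * (mulPerm (yc p Z))⁻¹ := by
  rw [trF, dblF, ← mulPerm_conj_tr hℓ]
  conv_lhs => rw [← mulPerm_conj_dbl hℓ]
  group

/-- The first part of the word, as a family. -/
lemma mword_fst (D : SiteData e u x l h E S O) (Z : V) :
    (lift e p l * lift e p h * xword (trF p (1 / 2)) (trF p 2 * dblF) (trF p 4 * dblF)
      (lift e p E) (lift e p S) (lift e p O) * (trF p 1 * (lift e p h)⁻¹ * (trF p 1)⁻¹)) Z =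
      lift e p x Z := by
  by_cases hs : ∃ s, AtSite e p s Z
  · obtain ⟨s, hs⟩ := hs
    have hℓ := hs.yc_pos.ne'
    simp only [xword, Pi.mul_apply, Pi.inv_apply, lift_apply hs, D.word, aff_conj hℓ, aff₂, aff₄]
    simp only [trF, ← mulPerm_conj_tr hℓ]
    group
  · push Not at hs
    simp only [xword, Pi.mul_apply, Pi.inv_apply, lift_apply_none hs]
    group

open Classical in
/-- The second part of the word, as a family. -/
lemma mword_snd (D : SiteData e u x l h E S O) (Z : V) :
    sigFam (lift e p l * (trF p 3 * lift e p E * (trF p 3)⁻¹)) Z =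
      if AtSite e p 0 Z then 1 else lift e p x Z := by
  have none : (∀ s, ¬ AtSite e p s ((4 : ℝ) • Z)) →
      sigFam (lift e p l * (trF p 3 * lift e p E * (trF p 3)⁻¹)) Z = 1 := fun h => by
    simp only [sigFam, Pi.mul_apply, Pi.inv_apply, lift_apply_none h]
    group
  by_cases hs : ∃ s, AtSite e p s Z
  · obtain ⟨s, hs⟩ := hs
    rcases s with _ | s
    · rw [if_pos hs, none]
      intro t ht
      exact absurd (hs.unique (atSite_four.mp ht)) (by omega)
    · rw [if_neg fun h0 => absurd (h0.unique hs) (by omega), lift_apply hs]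
      have hℓ := hs.yc_pos.ne'
      have hp4 : yc p ((4 : ℝ) • Z) = 4 * yc p Z := by rw [map_smul, smul_eq_mul]
      have hℓ4 : yc p ((4 : ℝ) • Z) ≠ 0 := by rw [hp4]; exact mul_ne_zero (by norm_num) hℓ
      have hc : pr e (siteCoord e p (s + 1) Z) = siteCoord e p (s + 1) Z := by
        rw [siteCoord, map_smul, map_sub, map_smul, pr_pr, hep.out]
      have hn := D.next s _ hc
      simp only [sigFam, Pi.mul_apply, Pi.inv_apply, lift_apply (atSite_four.mpr hs),
        siteCoord_four, hn]
      simp only [trF, ← mulPerm_conj_tr hℓ4]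
      rw [hp4]
      have hm : mulPerm (4 * yc p Z) = (mulPerm (1 / 2))⁻¹ * (mulPerm (yc p Z) * dbl) := by
        rw [← mulPerm_half_four hℓ]; group
      rw [hm]
      group
  · push Not at hs
    rw [if_neg (hs 0), lift_apply_none hs, none]
    intro t ht
    exact hs _ (atSite_four.mp ht)

open Classical in
lemma mword_lift (D : SiteData e u x l h E S O) :
    mword (act e (trF p 1)) (act e (trF p (1 / 2))) (act e (trF p 2 * dblF))
      (act e (trF p 4 * dblF)) (sig e * act e (trF p 3)) (sig e) (act e (lift e p l))
      (act e (lift e p h)) (act e (lift e p E)) (act e (lift e p S)) (act e (lift e p O)) =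
    act e fun Z => if AtSite e p 0 Z then lift e p x Z else 1 := by
  have h1 : sig e * act e (lift e p l) * (sig e)⁻¹ * ((sig e * act e (trF p 3)) *
      act e (lift e p E) * (sig e * act e (trF p 3))⁻¹) =
      act e (sigFam (lift e p l * (trF p 3 * lift e p E * (trF p 3)⁻¹))) := by
    rw [← sig_conj, map_mul, map_mul, map_mul, map_inv]; group
  rw [mword, h1]
  have h2 : act e (lift e p l) * act e (lift e p h) * xword (act e (trF p (1 / 2)))
      (act e (trF p 2 * dblF)) (act e (trF p 4 * dblF)) (act e (lift e p E)) (act e (lift e p S))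
      (act e (lift e p O)) * (act e (trF p 1) * (act e (lift e p h))⁻¹ * (act e (trF p 1))⁻¹) =
      act e (lift e p x) := by
    rw [← funext (mword_fst (p := p) D)]
    simp only [xword, map_mul, map_inv]
  rw [h2, ← map_inv, ← map_mul]
  refine congrArg _ (funext fun Z => ?_)
  rw [Pi.mul_apply, Pi.inv_apply, mword_snd D]
  split_ifs <;> group

lemma start_apply (D : SiteData e u x l h E S O) {W : V → ℝ}
    (hu : ∀ w, u w = recip (yc p (p + pr e w)) * W (p + pr e w + (yc e w * yc p (p + pr e w)) • e))
    (hW : ∀ X, W X ≠ 0 → ‖pr e X - p‖ ≤ 1 / 4) (X : V) :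
    act e (fun Z => open Classical in if AtSite e p 0 Z then lift e p x Z else 1) X =
      X + W X • e := by
  classical
  refine ext_pr_yc (e := e) (by rw [pr_act, pr_add_smul]) ?_
  rw [yc_act, yc_add_smul]
  by_cases hX : AtSite e p 0 X
  · have hs := atSite_pr.mpr hX
    have h1 := hX.yc
    simp only [pow_zero, one_mul] at h1
    have hpos := hX.yc_pos
    rw [if_pos hs, lift_apply hs, yc_base_pr, Equiv.Perm.mul_apply, Equiv.Perm.mul_apply,
      mulPerm_apply hpos.ne', mulPerm_inv_apply hpos.ne', D.start, hu]
    have h2 : siteCoord e p 0 (pr e X) = pr e X - p := by simp [siteCoord]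
    have h3 : pr e (pr e X - p) = pr e X - p := by rw [map_sub, pr_pr, hep.out]
    have h4 : yc e (pr e X - p) = 0 := by rw [← h3, yc_pr]
    rw [h2, pr_add_smul, yc_add_smul, h3, h3, h4, zero_add, add_sub_cancel, yc_base_pr,
      div_mul_cancel₀ _ hpos.ne', pr_add_yc, recip_eq (by linarith)]
    field_simp
  · have hW0 : W X = 0 := by
      by_contra hc
      refine hX ?_
      rw [AtSite, pow_zero, one_smul]
      linarith [hW X hc]
    rw [if_neg fun hh => hX (atSite_pr.mp hh), hW0, add_zero, Equiv.Perm.one_apply]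

end Machine

section CompactBounds

variable {E F : Type*} [NormedAddCommGroup E] [NormedSpace ℝ E] [NormedAddCommGroup F]
  [NormedSpace ℝ F]

lemma nd_eq_zero_of_ball {f : E → F} {R : ℝ} (hf : ∀ x, R < ‖x‖ → f x = 0) {x : E}
    (hx : R < ‖x‖) (i : ℕ) : nd i f x = 0 := by
  refine nd_eq_zero_of_eventually ?_ i
  filter_upwards [(isOpen_lt continuous_const continuous_norm).mem_nhds hx] with y hy
  exact hf y hy

lemma exists_nd_bound [FiniteDimensional ℝ E] {f : E → F} (hf : Smooth f) (K : ℕ) (R : ℝ) :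
    ∃ C, 1 ≤ C ∧ ∀ i ≤ K, ∀ x, ‖x‖ ≤ R → nd i f x ≤ C := by
  have : ProperSpace E := FiniteDimensional.proper ℝ E
  have key : ∀ i : ℕ, ∃ M, 0 ≤ M ∧ ∀ x, ‖x‖ ≤ R → nd i f x ≤ M := fun i => by
    have hcont : Continuous (nd i f) :=
      (hf.continuous_iteratedFDeriv (m := i) (by exact_mod_cast le_top)).norm
    obtain ⟨M, hM⟩ := (isCompact_closedBall (0 : E) R).bddAbove_image hcont.continuousOn
    exact ⟨max M 0, le_max_right _ _, fun x hx => (hM (mem_image_of_mem _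
      (mem_closedBall_zero_iff.mpr hx))).trans (le_max_left _ _)⟩
  choose M hM using key
  refine ⟨1 + ∑ i ∈ Finset.range (K + 1), M i,
    by linarith [Finset.sum_nonneg (s := Finset.range (K + 1)) fun i _ => (hM i).1],
    fun i hi x hx => ((hM i).2 x hx).trans ?_⟩
  have := Finset.single_le_sum (f := M) (s := Finset.range (K + 1)) (fun j _ => (hM j).1)
    (show i ∈ _ by simpa [Nat.lt_succ_iff] using hi)
  linarith

lemma exists_comp_bound [FiniteDimensional ℝ E] {G : Type*} [NormedAddCommGroup G]
    [NormedSpace ℝ G] {φ : E → F} (hφ : Smooth φ) (K : ℕ) (R : ℝ) :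
    ∃ C, 1 ≤ C ∧ ∀ (W : F → G) (ε : ℝ), Smooth W → sm K ε W → ∀ i ≤ K, ∀ x, ‖x‖ ≤ R →
      nd i (W ∘ φ) x ≤ C * ε := by
  obtain ⟨D, hD1, hD⟩ := exists_nd_bound hφ K R
  have hF : (1 : ℝ) ≤ K.factorial := by exact_mod_cast Nat.succ_le_of_lt K.factorial_pos
  refine ⟨K.factorial * D ^ K, one_le_mul_of_one_le_of_one_le hF (one_le_pow₀ hD1),
    fun W ε hW hs i hi x hx => ?_⟩
  have hε : 0 ≤ ε := (nd_nonneg _ _ _).trans (hs 0 (Nat.zero_le _) (φ x))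
  refine (norm_iteratedFDeriv_comp_le (n := i) (N := (⊤ : ℕ∞)) hW hφ (by exact_mod_cast le_top) x
    (C := ε) (D := D) (fun k hk => hs k (hk.trans hi) _)
    (fun k hk1 hk => (hD k (hk.trans hi) x hx).trans (le_self_pow₀ hD1 (by omega)))).trans ?_
  have h4 : (i.factorial : ℝ) ≤ K.factorial := by exact_mod_cast Nat.factorial_le hi
  have h5 : D ^ i ≤ D ^ K := pow_le_pow_right₀ hD1 hi
  calc (i.factorial : ℝ) * ε * D ^ i ≤ K.factorial * ε * D ^ K := by gcongr
    _ = _ := by ring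

lemma exists_mul_comp_bound [FiniteDimensional ℝ E] {φ : E → F} {g : E → ℝ} (hφ : Smooth φ)
    (hg : Smooth g) (K : ℕ) (R : ℝ) :
    ∃ C, 1 ≤ C ∧ ∀ (W : F → ℝ) (ε : ℝ), Smooth W → sm K ε W →
      (∀ x, R < ‖x‖ → g x * W (φ x) = 0) → sm K (C * ε) fun x => g x * W (φ x) := by
  obtain ⟨A, hA1, hA⟩ := exists_comp_bound (G := ℝ) hφ K R
  obtain ⟨B, hB1, hB⟩ := exists_nd_bound hg K R
  refine ⟨2 ^ K * (B * A), one_le_mul_of_one_le_of_one_le (one_le_pow₀ (by norm_num))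
    (one_le_mul_of_one_le_of_one_le hB1 hA1), fun W ε hW hs hz i hi x => ?_⟩
  have hε : 0 ≤ ε := (nd_nonneg _ _ _).trans (hs 0 (Nat.zero_le _) (φ x))
  rcases lt_or_ge R ‖x‖ with hx | hx
  · rw [nd_eq_zero_of_ball hz hx]; positivity
  · refine (nd_mul_le hg (hW.comp hφ) (fun j hj => hB j (hj.trans hi) x hx)
      (fun j hj => hA W ε hW hs j (hj.trans hi) x hx)).trans ?_
    have h5 : (2 : ℝ) ^ i ≤ 2 ^ K := pow_le_pow_right₀ (by norm_num) hi
    calc (2 : ℝ) ^ i * (B * (A * ε)) ≤ 2 ^ K * (B * (A * ε)) := by gcongr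
      _ = _ := by ring

end CompactBounds

section MachineTheorem

variable {V : Type} [NormedAddCommGroup V] [InnerProductSpace ℝ V] (e p : V)
  [he : Fact (‖e‖ = 1)] [hp : Fact (‖p‖ = 1)] [hep : Horizontal e p]

/-- The change of coordinates straightening the lines through the first site. -/
def startArg (w : V) : V := p + pr e w + (yc e w * yc p (p + pr e w)) • e

/-- The displacement in the coordinates of the first site. -/
def startU (W : V → ℝ) (w : V) : ℝ := recip (yc p (p + pr e w)) * W (startArg e p w)

/-- The box in which the displacements are supported. -/
def InBox (X : V) : Prop := ‖pr e X - p‖ ≤ 1 / 4 ∧ |yc e X - 2| ≤ 1 / 2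

/-- Diffeomorphisms supported in a ball and close to the identity. -/
def Near {V : Type} [NormedAddCommGroup V] [NormedSpace ℝ V] (R : ℝ) (K : ℕ) (η : ℝ)
    (Y : Equiv.Perm V) : Prop :=
  IsD Y ∧ (∀ x, R < ‖x‖ → Y x = x) ∧ sm K η fun x => Y x - x

lemma smooth_startArg : Smooth (startArg e p) := by
  have h1 : Smooth fun w : V => p + pr e w := contDiff_const.add (pr e).contDiff
  exact h1.add (((yc e).contDiff.mul ((yc p).contDiff.comp h1)).smul contDiff_const)

variable {e p} in
lemma startU_ne {W : V → ℝ} (hW : ∀ X, W X ≠ 0 → InBox e p X) {w : V} (h : startU e p W w ≠ 0) :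
    ‖pr e w‖ ≤ 1 / 4 ∧ 1 < yc e w ∧ yc e w < 4 := by
  have h1 := hW _ (right_ne_zero_of_mul h)
  have h2 : yc e p = 0 := by rw [← hep.out, yc_pr]
  rw [InBox, startArg, pr_add_smul, yc_add_smul, map_add, map_add, pr_pr, hep.out, yc_pr, h2,
    add_sub_cancel_left, add_zero, zero_add] at h1
  have h3 := abs_yc_base_sub (e := e) (p := p) (p + pr e w)
  rw [map_add (pr e), pr_pr, hep.out, add_sub_cancel_left] at h3
  have h4 := abs_le.mp (h3.trans h1.1)
  have h5 := abs_le.mp h1.2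
  refine ⟨h1.1, ?_, ?_⟩
  · by_contra hc; nlinarith
  · by_contra hc; nlinarith

theorem exists_machine [FiniteDimensional ℝ V] (K : ℕ) {η : ℝ} (hη : 0 < η) :
    ∃ k : ℕ, ∃ ρ > 0, ∀ W : V → ℝ, Smooth W → (∀ X, W X ≠ 0 → InBox e p X) → sm k ρ W →
      ∃ F H E S O : Equiv.Perm V, (∀ Y ∈ [F, H, E, S, O], Near 42 K η Y) ∧
        ∀ X, mword (act e (trF p 1)) (act e (trF p (1 / 2))) (act e (trF p 2 * dblF))
          (act e (trF p 4 * dblF)) (sig e * act e (trF p 3)) (sig e) F H E S O X =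
            X + W X • e := by
  obtain ⟨C, hC1, hC⟩ := exists_lift_small e p K
  have hη' : 0 < η / (2 * C) := by positivity
  obtain ⟨k, ρ, hρ, hk⟩ := exists_siteData (e := e) K (3 * K + 1) hη'
  have hg : Smooth fun w : V => recip (yc p (p + pr e w)) :=
    recip_smooth.comp ((yc p).contDiff.comp (contDiff_const.add (pr e).contDiff))
  obtain ⟨A, hA1, hA⟩ := exists_mul_comp_bound (smooth_startArg e p) hg k 5
  refine ⟨k, ρ / A, by positivity, fun W hW hs hsm => ?_⟩
  have hu : Smooth (startU e p W) := hg.mul (hW.comp (smooth_startArg e p))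
  have hus : sm k (A * (ρ / A)) (startU e p W) := hA W _ hW hsm fun x hx => by
    by_contra hc
    have h1 := startU_ne hs hc
    have h2 := norm_le_pr_add_yc e x
    rw [abs_of_pos (by linarith)] at h2
    linarith
  rw [mul_div_cancel₀ _ (by positivity)] at hus
  obtain ⟨x, y, h, E, S, O, D, hb⟩ := hk _ hu
    (fun w hw => ⟨by linarith [(startU_ne hs hw).2.1], (startU_ne hs hw).2.2⟩)
    (fun w hw => by
      by_contra hc
      have := (startU_ne hs hc).1
      norm_num at hw
      linarith)
    (hus k le_rfl)
  have near : ∀ c ∈ [y, h, E, S, O], Near 42 K η (act e (lift e p c)) := fun c hc => by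
    obtain ⟨h1, h2⟩ := hb c hc
    have hz : ∀ w, 42 < ‖w‖ → dis e (lift e p c) w = 0 := fun w hw => lift_zero h1.loc hw
    refine ⟨(lift_FSm h1).isD hz, fun w hw => by rw [act_apply, hz w hw, zero_smul, add_zero],
      fun i hi w => ?_⟩
    have h3 : (fun w => act e (lift e p c) w - w) = fun w => dis e (lift e p c) w • e := by
      funext w; rw [act_apply, add_sub_cancel_left]
    rw [h3]
    refine (nd_smul_e (lift_FSm h1).1 i w).trans ((hC c _ h1 h2 i hi w).trans (le_of_eq ?_))
    field_simp
  refine ⟨act e (lift e p y), act e (lift e p h), act e (lift e p E), act e (lift e p S),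
    act e (lift e p O), ?_, fun X => ?_⟩
  · simpa using ⟨near y (by simp), near h (by simp), near E (by simp), near S (by simp),
      near O (by simp)⟩
  · rw [mword_lift D]
    exact start_apply D (fun w => rfl) (fun X hX => (hs X hX).1) X

end MachineTheorem

section Cutoff

variable {V : Type} [NormedAddCommGroup V] [InnerProductSpace ℝ V] [FiniteDimensional ℝ V]

lemma exists_near_perm {w : V → V} (hw : Smooth w) (h : ∀ x, nd 1 w x ≤ 1 / 2) {R : ℝ}
    (hR : ∀ x, R < ‖x‖ → w x = 0) : ∃ c : Equiv.Perm V, IsD c ∧ ∀ x, c x = x + w x := by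
  have : CompleteSpace V := FiniteDimensional.complete ℝ V
  let c : Equiv.Perm V := Equiv.ofBijective _ (bijective_id_add hw h)
  have hc : ∀ x, c x = x + w x := fun x => rfl
  refine ⟨c, ⟨?_, smooth_symm_of_near_id hc hw h, R, fun x hx => by rw [hc, hR x hx, add_zero]⟩, hc⟩
  rw [show (c : V → V) = fun x => x + w x from funext hc]
  exact contDiff_id.add hw

/-- A smooth plateau function. -/
def plateau (x : V) : ℝ := Real.smoothTransition (2 - ‖x‖ ^ 2)

lemma plateau_smooth : Smooth (plateau : V → ℝ) :=
  smoothTransition_smooth.comp (contDiff_const.sub (contDiff_norm_sq ℝ))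

lemma plateau_one {x : V} (hx : ‖x‖ ≤ 1) : plateau x = 1 :=
  Real.smoothTransition.one_of_one_le (by nlinarith [norm_nonneg x])

lemma plateau_zero {x : V} (hx : 2 < ‖x‖) : plateau x = 0 :=
  Real.smoothTransition.zero_of_nonpos (by nlinarith [norm_nonneg x])

/-- The permutation agrees on every ball with a diffeomorphism that is trivial near infinity. -/
def Cut (A : Equiv.Perm V) : Prop := ∀ R : ℝ, ∃ c, IsD c ∧ ∀ x, ‖x‖ ≤ R → c x = A x

lemma exists_ball_image {c : V → V} (hc : Continuous c) (R : ℝ) :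
    ∃ R', ∀ x, ‖x‖ ≤ R → ‖c x‖ ≤ R' := by
  have : ProperSpace V := FiniteDimensional.proper ℝ V
  obtain ⟨M, hM⟩ := (isCompact_closedBall (0 : V) R).bddAbove_image hc.norm.continuousOn
  exact ⟨M, fun x hx => hM (mem_image_of_mem _ (mem_closedBall_zero_iff.mpr hx))⟩

lemma Cut.mul {A B : Equiv.Perm V} (hA : Cut A) (hB : Cut B) : Cut (A * B) := fun R => by
  obtain ⟨b, hb, hb'⟩ := hB R
  obtain ⟨R', hR'⟩ := exists_ball_image hb.1.continuous R
  obtain ⟨a, ha, ha'⟩ := hA R'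
  exact ⟨a * b, ha.mul hb, fun x hx => by
    rw [Equiv.Perm.mul_apply, Equiv.Perm.mul_apply, ha' _ (hR' x hx), hb' x hx]⟩

lemma Cut.pow {A : Equiv.Perm V} (hA : Cut A) (n : ℕ) : Cut (A ^ n) := by
  induction n with
  | zero => exact fun R => ⟨1, IsD.one, fun _ _ => rfl⟩
  | succ n ih => rw [pow_succ]; exact ih.mul hA

lemma exists_cut_of_near : ∃ δ > 0, ∀ (P : Equiv.Perm V) (L : V →L[ℝ] V) (v : V), ‖L‖ ≤ δ →
    ‖v‖ ≤ δ → (∀ x, P x = x + (L x + v)) → Cut P := by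
  obtain ⟨C, hC1, hC⟩ := exists_nd_bound (plateau_smooth (V := V)) 1 2
  refine ⟨1 / (8 * C), by positivity, fun P L v hL hv hP R => ?_⟩
  set δ := 1 / (8 * C) with hδ
  have hδC : C * δ = 1 / 8 := by rw [hδ]; field_simp
  have hδ0 : 0 < δ := by positivity
  set r := max R 1 with hr
  have hr1 : 1 ≤ r := le_max_right _ _
  have hri : 0 < r⁻¹ := by positivity
  have hχ : Smooth fun x : V => plateau (r⁻¹ • x) :=
    plateau_smooth.comp (contDiff_const.smul contDiff_id)
  have hLv : Smooth fun x => L x + v := L.contDiff.add contDiff_const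
  have hsc : ∀ x : V, ‖r⁻¹ • x‖ = ‖x‖ / r := fun x => by
    rw [norm_smul, norm_inv, Real.norm_of_nonneg (by linarith)]; ring
  have hz : ∀ x : V, 2 * r < ‖x‖ → plateau (r⁻¹ • x) • (L x + v) = 0 := fun x hx => by
    rw [plateau_zero, zero_smul]
    rw [hsc, lt_div_iff₀ (by linarith)]; linarith
  have hw : Smooth fun x => plateau (r⁻¹ • x) • (L x + v) := hχ.smul hLv
  have hnd : ∀ x, nd 1 (fun x => plateau (r⁻¹ • x) • (L x + v)) x ≤ 1 / 2 := fun x => by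
    rcases lt_or_ge (2 * r) ‖x‖ with hx | hx
    · rw [nd_eq_zero_of_ball hz hx]; norm_num
    · have h2 : ‖r⁻¹ • x‖ ≤ 2 := by rw [hsc, div_le_iff₀ (by linarith)]; exact hx
      have h3 : ‖plateau (r⁻¹ • x)‖ ≤ C := by
        have := hC 0 (Nat.zero_le _) _ h2
        rwa [nd_zero] at this
      have h4 : nd 1 (fun x : V => plateau (r⁻¹ • x)) x ≤ r⁻¹ * C := by
        rw [nd_comp_smul plateau_smooth, abs_of_pos hri, pow_one]
        exact mul_le_mul_of_nonneg_left (hC 1 le_rfl _ h2) hri.le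
      have h5 : ‖L x + v‖ ≤ 3 * r * δ := by
        have h6 := L.le_of_opNorm_le hL x
        have h7 := norm_add_le (L x) v
        nlinarith
      rw [nd_one] at h4 ⊢
      have h8 : fderiv ℝ (fun x => plateau (r⁻¹ • x) • (L x + v)) x =
          plateau (r⁻¹ • x) • L + (fderiv ℝ (fun x : V => plateau (r⁻¹ • x)) x).smulRight
            (L x + v) := by
        have h9 := ((hχ.differentiable (by simp) x).hasFDerivAt.smul
          (L.hasFDerivAt.add_const v : HasFDerivAt (fun x => L x + v) L x))
        exact h9.fderiv
      rw [h8]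
      refine (norm_add_le _ _).trans ?_
      rw [norm_smul, ContinuousLinearMap.norm_smulRight_apply]
      have h10 : ‖plateau (r⁻¹ • x)‖ * ‖L‖ ≤ C * δ := by gcongr
      have h11 : ‖fderiv ℝ (fun x : V => plateau (r⁻¹ • x)) x‖ * ‖L x + v‖ ≤
          r⁻¹ * C * (3 * r * δ) := by gcongr
      have h12 : r⁻¹ * C * (3 * r * δ) = 3 * (C * δ) := by field_simp
      linarith
  obtain ⟨c, hc, hc'⟩ := exists_near_perm hw hnd hz
  refine ⟨c, hc, fun x hx => ?_⟩
  rw [hc', hP, plateau_one, one_smul]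
  rw [hsc, div_le_one (by linarith)]
  exact hx.trans (le_max_left _ _)

lemma Cut.of_root {A : Equiv.Perm V} (h : ∀ δ > 0, ∃ (P : Equiv.Perm V) (L : V →L[ℝ] V) (v : V)
    (M : ℕ), ‖L‖ ≤ δ ∧ ‖v‖ ≤ δ ∧ (∀ x, P x = x + (L x + v)) ∧ P ^ M = A) : Cut A := by
  obtain ⟨δ, hδ, hδ'⟩ := exists_cut_of_near (V := V)
  obtain ⟨P, L, v, M, h1, h2, h3, rfl⟩ := h δ hδ
  exact (hδ' P L v h1 h2 h3).pow M

lemma exists_nat_div_le (t : ℝ) {δ : ℝ} (hδ : 0 < δ) : ∃ M : ℕ, 0 < M ∧ |t| / M ≤ δ := by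
  obtain ⟨M, hM⟩ := exists_nat_gt (|t| / δ)
  have h0 : 0 < (M : ℝ) := (by positivity : (0 : ℝ) ≤ |t| / δ).trans_lt hM
  refine ⟨M, by exact_mod_cast h0, ?_⟩
  rw [div_lt_iff₀ hδ] at hM
  rw [div_le_iff₀ h0]; linarith

lemma exists_root {b : ℝ} (hb : 0 < b) {δ : ℝ} (hδ : 0 < δ) :
    ∃ a > 0, ∃ M : ℕ, a ^ M = b ∧ |a - 1| ≤ δ := by
  have hc := Real.continuous_exp.continuousAt (x := 0)
  rw [Metric.continuousAt_iff] at hc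
  obtain ⟨ε, hε, h⟩ := hc δ hδ
  obtain ⟨M, hM, hM'⟩ := exists_nat_div_le (Real.log b) (half_pos hε)
  have hM0 : (0 : ℝ) < M := by exact_mod_cast hM
  refine ⟨Real.exp (Real.log b / M), Real.exp_pos _, M, ?_, ?_⟩
  · rw [← Real.exp_nat_mul, mul_div_cancel₀ _ hM0.ne', Real.exp_log hb]
  · have h2 : dist (Real.log b / M) 0 < ε := by
      rw [dist_zero_right, Real.norm_eq_abs, abs_div, abs_of_pos hM0]; linarith
    have := h h2
    rw [Real.exp_zero, Real.dist_eq] at this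
    exact this.le

omit [InnerProductSpace ℝ V] [FiniteDimensional ℝ V] in
lemma addRight_pow {A : Type*} [AddCommGroup A] (v : A) (n : ℕ) :
    Equiv.addRight v ^ n = Equiv.addRight (n • v) := by
  induction n with
  | zero => ext x; simp
  | succ n ih => ext x; simp [pow_succ, ih, succ_nsmul, add_assoc, add_comm]

lemma cut_translation (v : V) : Cut (Equiv.addRight v) := Cut.of_root fun δ hδ => by
  obtain ⟨M, hM, hM'⟩ := exists_nat_div_le ‖v‖ hδ
  have hM0 : (0 : ℝ) < M := by exact_mod_cast hM
  refine ⟨Equiv.addRight ((M : ℝ)⁻¹ • v), 0, (M : ℝ)⁻¹ • v, M, by simpa using hδ.le, ?_,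
    fun x => by simp, ?_⟩
  · rw [norm_smul, norm_inv, Real.norm_of_nonneg hM0.le]
    rw [abs_norm] at hM'
    rwa [inv_mul_eq_div]
  · rw [addRight_pow, ← Nat.cast_smul_eq_nsmul ℝ, smul_smul, mul_inv_cancel₀ hM0.ne',
      one_smul]

/-- Homotheties. -/
def homoth (a : ℝˣ) : Equiv.Perm V := MulAction.toPermHom ℝˣ V a

lemma homoth_apply (a : ℝˣ) (x : V) : homoth a x = (a : ℝ) • x := rfl

lemma cut_homoth {b : ℝˣ} (hb : 0 < (b : ℝ)) : Cut (homoth b : Equiv.Perm V) :=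
  Cut.of_root fun δ hδ => by
  obtain ⟨a, ha, M, hM, h1⟩ := exists_root hb hδ
  refine ⟨homoth (Units.mk0 a ha.ne'), (a - 1) • ContinuousLinearMap.id ℝ V, 0, M, ?_,
    by simpa using hδ.le, fun x => ?_, ?_⟩
  · rw [norm_smul, Real.norm_eq_abs]
    have := ContinuousLinearMap.norm_id_le (𝕜 := ℝ) (E := V)
    have h2 := abs_nonneg (a - 1)
    nlinarith
  · simp only [homoth_apply, Units.val_mk0, add_zero, smul_apply, ContinuousLinearMap.id_apply]
    module
  · rw [homoth, ← map_pow, homoth]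
    congr 1
    ext; simpa using hM

variable {e p : V} [he : Fact (‖e‖ = 1)] [hp : Fact (‖p‖ = 1)] [hep : Horizontal e p]

lemma trF_pow (t : ℝ) (M : ℕ) : trF p t ^ M = trF p (M * t) := by
  funext Z
  rw [Pi.pow_apply, trF, trF, addRight_pow, nsmul_eq_mul, mul_assoc]

lemma cut_trF (t : ℝ) : Cut (act e (trF p t)) := Cut.of_root fun δ hδ => by
  obtain ⟨M, hM, hM'⟩ := exists_nat_div_le t hδ
  have hM0 : (0 : ℝ) < M := by exact_mod_cast hM
  refine ⟨act e (trF p (t / M)), (t / M) • (yc p).smulRight e, 0, M, ?_, by simpa using hδ.le,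
    fun x => ?_, ?_⟩
  · rw [norm_smul, ContinuousLinearMap.norm_smulRight_apply, he.out, mul_one, Real.norm_eq_abs,
      abs_div, abs_of_pos hM0]
    have := norm_yc_le p
    have h2 : 0 ≤ |t| / M := by positivity
    nlinarith
  · rw [act_apply, dis, trF, yc_base_pr]
    simp [mul_smul]
  · rw [← map_pow, trF_pow, mul_div_cancel₀ _ hM0.ne']

lemma mulPerm_pow {a : ℝ} (ha : a ≠ 0) (M : ℕ) : mulPerm a ^ M = mulPerm (a ^ M) := by
  induction M with
  | zero => ext y; rw [pow_zero, pow_zero, mulPerm_apply one_ne_zero, one_mul]; rfl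
  | succ n ih => rw [pow_succ, pow_succ, ih, ← mulPerm_mul (pow_ne_zero _ ha) ha]

lemma mulPerm_two : mulPerm 2 = dbl := by
  ext y; rw [mulPerm_apply two_ne_zero, Equiv.mulLeft₀_apply]

lemma cut_dblF : Cut (act e dblF) := Cut.of_root fun δ hδ => by
  obtain ⟨a, ha, M, hM, h1⟩ := exists_root (two_pos (α := ℝ)) hδ
  refine ⟨act e fun _ => mulPerm a, (a - 1) • (yc e).smulRight e, 0, M, ?_, by simpa using hδ.le,
    fun x => ?_, ?_⟩
  · rw [norm_smul, ContinuousLinearMap.norm_smulRight_apply, he.out, mul_one, Real.norm_eq_abs]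
    have := norm_yc_le e
    have h2 := abs_nonneg (a - 1)
    nlinarith
  · rw [act_apply, dis, mulPerm_apply ha.ne']
    simp only [add_zero, smul_apply, ContinuousLinearMap.smulRight_apply]
    module
  · rw [← map_pow]
    congr 1
    funext Z
    rw [Pi.pow_apply, mulPerm_pow ha.ne', hM, mulPerm_two, dblF]

lemma cut_sig : Cut (sig e) := by
  have h : sig e = homoth (Units.mk0 (1 / 4) (by norm_num)) * act e dblF := by
    ext w
    rw [sig_apply, Equiv.Perm.mul_apply, homoth_apply, act_apply, dis, dblF,
      Units.val_mk0, show dbl (yc e w) = 2 * yc e w from rfl, two_mul, add_sub_cancel_right]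
  rw [h]
  exact (cut_homoth (by simp)).mul cut_dblF

end Cutoff

section Swarm

variable {α : Type} {t : Equiv.Perm α} {B : Set α}

/-- The images of the set under the positive powers avoid the set. -/
def Wander (t : Equiv.Perm α) (B : Set α) : Prop := ∀ m : ℕ, 1 ≤ m → ∀ x ∈ B, (t ^ m) x ∉ B

lemma Wander.eq (h : Wander t B) {m n : ℤ} {x y : α} (hx : x ∈ B) (hy : y ∈ B)
    (hxy : (t ^ m) x = (t ^ n) y) : m = n := by
  wlog hmn : m ≤ n generalizing m n x y
  · exact (this hy hx hxy.symm (not_le.mp hmn).le).symm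
  by_contra hne
  obtain ⟨k, rfl⟩ := Int.le.dest hmn
  refine h k (by omega) y hy ?_
  rw [zpow_add, Equiv.Perm.mul_apply, zpow_natCast] at hxy
  rwa [← (t ^ m).injective hxy]

/-- The translates of the set embed disjointly. -/
def swarmEmb (h : Wander t B) : (Σ _ : ℤ, B) ↪ α where
  toFun q := (t ^ q.1) q.2
  inj' := by
    rintro ⟨m, x, hx⟩ ⟨n, y, hy⟩ hxy
    obtain rfl : m = n := h.eq hx hy hxy
    obtain rfl : x = y := (t ^ m).injective hxy
    rfl

/-- Permutations of the translates of the set, acting independently. -/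
def swarm (h : Wander t B) : (ℤ → Equiv.Perm B) →* Equiv.Perm α :=
  (Equiv.Perm.viaEmbeddingHom (swarmEmb h)).comp (Equiv.Perm.sigmaCongrRightHom _)

lemma swarm_apply (h : Wander t B) (f : ℤ → Equiv.Perm B) (m : ℤ) (b : B) :
    swarm h f ((t ^ m) b) = (t ^ m) (f m b) :=
  Equiv.Perm.viaEmbedding_apply _ (swarmEmb h) ⟨m, b⟩

lemma swarm_apply_of_notMem (h : Wander t B) (f : ℤ → Equiv.Perm B) {x : α}
    (hx : ∀ (m : ℤ) (b : B), (t ^ m) b ≠ x) : swarm h f x = x :=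
  Equiv.Perm.viaEmbedding_apply_of_notMem _ (swarmEmb h) x fun ⟨q, hq⟩ => hx q.1 q.2 hq

lemma swarm_ext (h : Wander t B) {f : ℤ → Equiv.Perm B} {a : Equiv.Perm α}
    (h1 : ∀ (m : ℤ) (b : B), a ((t ^ m) b) = (t ^ m) (f m b))
    (h2 : ∀ x, (∀ (m : ℤ) (b : B), (t ^ m) b ≠ x) → a x = x) : a = swarm h f := by
  ext x
  by_cases hx : ∀ (m : ℤ) (b : B), (t ^ m) b ≠ x
  · rw [h2 x hx, swarm_apply_of_notMem h f hx]
  · push Not at hx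
    obtain ⟨m, b, rfl⟩ := hx
    rw [h1, swarm_apply]

lemma swarm_shift (h : Wander t B) (f : ℤ → Equiv.Perm B) (n : ℤ) :
    t ^ (-n) * swarm h f * t ^ n = swarm h fun m => f (m + n) := by
  have key : ∀ (m : ℤ) (x : α), (t ^ n) ((t ^ m) x) = (t ^ (m + n)) x := fun m x => by
    rw [← Equiv.Perm.mul_apply, ← zpow_add, add_comm]
  refine swarm_ext h (fun m b => ?_) fun x hx => ?_
  · rw [Equiv.Perm.mul_apply, Equiv.Perm.mul_apply, key, swarm_apply, ← Equiv.Perm.mul_apply,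
      ← zpow_add, add_comm m, neg_add_cancel_left]
  · rw [Equiv.Perm.mul_apply, Equiv.Perm.mul_apply, swarm_apply_of_notMem h f, zpow_neg, pinv_self]
    intro m b hm
    refine hx (m - n) b ((t ^ n).injective ?_)
    rw [key, sub_add_cancel, hm]

lemma Sup.mem {a : Equiv.Perm α} (h : Sup a B) (x : α) : a x ∈ B ↔ x ∈ B := by
  constructor
  · intro hx
    by_contra hc
    rw [h x hc] at hx
    exact hc hx
  · intro hx
    by_contra hc
    rw [a.injective (h _ hc)] at hc
    exact hc hx

/-- Restriction to a set containing the support. -/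
def res (a : Equiv.Perm α) (h : Sup a B) : Equiv.Perm B := a.subtypePerm h.mem

lemma swarm_single (h : Wander t B) {a : Equiv.Perm α} (ha : Sup a B) :
    swarm h (Pi.mulSingle 0 (res a ha)) = a := by
  refine (swarm_ext h (fun m b => ?_) fun x hx => ?_).symm
  · rcases eq_or_ne m 0 with rfl | hm
    · rw [Pi.mulSingle_eq_same]; rfl
    · rw [Pi.mulSingle_eq_of_ne hm, ha]
      · rfl
      · intro hc
        exact hm (h.eq b.2 hc (n := 0) rfl)
  · exact ha x fun hc => hx 0 ⟨x, hc⟩ rfl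

lemma mword_one_letters {G : Type*} [Group G] {F H E s Ω : G}
    (h : ∃ i : Fin 5, ∀ j, j ≠ i → ![F, H, E, s, Ω] j = 1) :
    mword 1 1 1 1 1 1 F H E s Ω = 1 := by
  obtain ⟨i, hi⟩ := h
  fin_cases i <;> simp [Fin.forall_fin_succ] at hi <;> simp [mword, xword, hi]

lemma mword_pi {ι G : Type*} [Group G] (T S C₂ C₄ C σ F H E s Ω : ι → G) (i : ι) :
    mword T S C₂ C₄ C σ F H E s Ω i =
      mword (T i) (S i) (C₂ i) (C₄ i) (C i) (σ i) (F i) (H i) (E i) (s i) (Ω i) :=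
  map_mword (Pi.evalMonoidHom (fun _ : ι => G) i) T S C₂ C₄ C σ F H E s Ω

lemma odd_part_unique {i j : ℕ} {u v : ℤ} (hu : u % 2 = 1) (hv : v % 2 = 1)
    (h : 2 ^ i * u = 2 ^ j * v) : i = j := by
  wlog hij : i ≤ j generalizing i j u v
  · exact (this hv hu h.symm (not_le.mp hij).le).symm
  by_contra hne
  obtain ⟨k, rfl⟩ : ∃ k, j = i + (k + 1) := ⟨j - i - 1, by omega⟩
  rw [pow_add, mul_assoc, mul_right_inj' (by positivity), pow_succ] at h
  have : (2 : ℤ) ^ k * 2 * v = 2 * (2 ^ k * v) := by ring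
  omega

/-- The positions of the letters. -/
def slot (a : Fin 5) (k : ℕ) : ℤ := 2 ^ (5 * k + a)

lemma slot_injective (a : Fin 5) : Function.Injective (slot a) := fun k l h => by
  have := Int.pow_right_injective (by norm_num : 1 < (2 : ℤ).natAbs) h
  omega

lemma slot_sub (a : Fin 5) {k l : ℕ} (h : k ≠ l) :
    ∃ i : ℕ, i % 5 = a ∧ ∃ u : ℤ, u % 2 = 1 ∧ slot a l - slot a k = 2 ^ i * u := by
  rcases lt_or_gt_of_ne h with h | h
  · obtain ⟨d, rfl⟩ : ∃ d, l = k + (d + 1) := ⟨l - k - 1, by omega⟩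
    refine ⟨5 * k + a, by omega, 2 ^ (5 * (d + 1)) - 1, ?_, by simp only [slot]; ring⟩
    rw [show 5 * (d + 1) = 5 * d + 4 + 1 by ring, pow_succ]
    omega
  · obtain ⟨d, rfl⟩ : ∃ d, k = l + (d + 1) := ⟨k - l - 1, by omega⟩
    refine ⟨5 * l + a, by omega, 1 - 2 ^ (5 * (d + 1)), ?_, by simp only [slot]; ring⟩
    rw [show 5 * (d + 1) = 5 * d + 4 + 1 by ring, pow_succ]
    omega

lemma slot_sidon {a b : Fin 5} {k l l' : ℕ} (h : slot a l - slot a k = slot b l' - slot b k)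
    (hl : l ≠ k) (hl' : l' ≠ k) : a = b := by
  obtain ⟨i, hi, u, hu, h1⟩ := slot_sub a hl.symm
  obtain ⟨j, hj, v, hv, h2⟩ := slot_sub b hl'.symm
  rw [h1, h2] at h
  have := odd_part_unique hu hv h
  apply Fin.ext; omega

/-- The letters of one kind, spread over the translates. -/
def spread (Y : ℕ → Equiv.Perm α) (hY : ∀ k, Sup (Y k) B) (a : Fin 5) : ℤ → Equiv.Perm B :=
  Function.extend (slot a) (fun k => res (Y k) (hY k)) 1

lemma swarm_word (h : Wander t B) (c : Fin 6 → Equiv.Perm α) (hc : ∀ i, Sup (c i) B)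
    (Y : Fin 5 → ℕ → Equiv.Perm α) (hY : ∀ a k, Sup (Y a k) B) (k : ℕ)
    (z : Fin 5 → Equiv.Perm α)
    (hz : ∀ a, z a = t ^ (-slot a k) * swarm h (spread (Y a) (hY a) a) * t ^ slot a k) :
    mword (c 0) (c 1) (c 2) (c 3) (c 4) (c 5) (z 0) (z 1) (z 2) (z 3) (z 4) =
      mword (c 0) (c 1) (c 2) (c 3) (c 4) (c 5) (Y 0 k) (Y 1 k) (Y 2 k) (Y 3 k) (Y 4 k) := by
  have hz' : ∀ a, z a = swarm h fun m => spread (Y a) (hY a) a (m + slot a k) := fun a => by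
    rw [hz, swarm_shift]
  have hc' : ∀ i, c i = swarm h (Pi.mulSingle 0 (res (c i) (hc i))) :=
    fun i => (swarm_single h (hc i)).symm
  have hY' : ∀ a, Y a k = swarm h (Pi.mulSingle 0 (res (Y a k) (hY a k))) :=
    fun a => (swarm_single h (hY a k)).symm
  rw [hc' 0, hc' 1, hc' 2, hc' 3, hc' 4, hc' 5, hY' 0, hY' 1, hY' 2, hY' 3, hY' 4,
    hz' 0, hz' 1, hz' 2, hz' 3, hz' 4, ← map_mword, ← map_mword]
  congr 1
  funext m
  rw [mword_pi, mword_pi]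
  rcases eq_or_ne m 0 with rfl | hm
  · have h0 : ∀ a, spread (Y a) (hY a) a (0 + slot a k) = res (Y a k) (hY a k) := fun a => by
      rw [zero_add, spread, (slot_injective a).extend_apply]
    simp only [h0, Pi.mulSingle_eq_same]
  · simp only [Pi.mulSingle_eq_of_ne hm]
    rw [show mword (1 : Equiv.Perm B) 1 1 1 1 1 1 1 1 1 1 = 1 by simp [mword, xword],
      mword_one_letters]
    · have h1 : ∀ a, spread (Y a) (hY a) a (m + slot a k) ≠ 1 →
          ∃ l, l ≠ k ∧ slot a l - slot a k = m := fun a ha => by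
        by_contra hcon
        refine ha (Function.extend_apply' _ _ _ ?_)
        rintro ⟨l, hl⟩
        refine hcon ⟨l, ?_, by omega⟩
        rintro rfl
        omega
      by_cases hall : ∀ a, spread (Y a) (hY a) a (m + slot a k) = 1
      · exact ⟨0, fun j _ => by fin_cases j <;> exact hall _⟩
      · push Not at hall
        obtain ⟨a, ha⟩ := hall
        refine ⟨a, fun j hj => ?_⟩
        have h2 : spread (Y j) (hY j) j (m + slot j k) = 1 := by
          by_contra hj'
          obtain ⟨l, hl, h3⟩ := h1 a ha
          obtain ⟨l', hl', h4⟩ := h1 j hj'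
          exact hj (slot_sidon (h4.trans h3.symm) hl' hl)
        fin_cases j <;> exact h2

end Swarm

section WordLength

variable {G : Type*} [Group G] {S T : Finset G} {a b : G} {m n : ℕ}

lemma _root_.WordLenLe.mono_len (h : WordLenLe S a m) (hmn : m ≤ n) : WordLenLe S a n := by
  obtain ⟨l, hl, h'⟩ := h
  exact ⟨l, hl.trans hmn, h'⟩

lemma _root_.WordLenLe.mono_set (h : WordLenLe S a m) (hST : S ⊆ T) : WordLenLe T a m := by
  obtain ⟨l, hl, h1, h2⟩ := h
  exact ⟨l, hl, fun x hx => (h1 x hx).imp (fun h => hST h) fun h => hST h, h2⟩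

lemma wordLenLe_one : WordLenLe S (1 : G) 0 := ⟨[], by simp⟩

lemma wordLenLe_gen (h : a ∈ S) : WordLenLe S a 1 := ⟨[a], by simp [h]⟩

lemma _root_.WordLenLe.mul (ha : WordLenLe S a m) (hb : WordLenLe S b n) :
    WordLenLe S (a * b) (m + n) := by
  obtain ⟨l, hl, h1, rfl⟩ := ha
  obtain ⟨l', hl', h1', rfl⟩ := hb
  refine ⟨l ++ l', by simp; omega, fun x hx => ?_, List.prod_append⟩
  rcases List.mem_append.mp hx with h | h
  exacts [h1 x h, h1' x h]

lemma _root_.WordLenLe.inv (ha : WordLenLe S a m) : WordLenLe S a⁻¹ m := by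
  obtain ⟨l, hl, h1, rfl⟩ := ha
  refine ⟨(l.map (·⁻¹)).reverse, by simpa using hl, fun x hx => ?_, (List.prod_inv_reverse l).symm⟩
  obtain ⟨y, hy, rfl⟩ := List.mem_map.mp (List.mem_reverse.mp hx)
  rw [inv_inv]
  exact (h1 y hy).symm

lemma _root_.WordLenLe.pow (ha : WordLenLe S a m) (n : ℕ) : WordLenLe S (a ^ n) (n * m) := by
  induction n with
  | zero => simpa using wordLenLe_one
  | succ n ih => rw [pow_succ]; exact (ih.mul ha).mono_len (by linarith)

lemma _root_.WordLenLe.zpow (ha : WordLenLe S a m) (n : ℤ) : WordLenLe S (a ^ n) (n.natAbs * m) := by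
  obtain ⟨k, rfl | rfl⟩ := n.eq_nat_or_neg
  · simpa using ha.pow k
  · simpa using (ha.pow k).inv

lemma wordLenLe_mword {T' S' C₂ C₄ C σ F H E s Ω : G}
    (h : ∀ x ∈ [T', S', C₂, C₄, C, σ, F, H, E, s, Ω], WordLenLe S x n) :
    WordLenLe S (mword T' S' C₂ C₄ C σ F H E s Ω) (24 * n) := by
  simp only [List.forall_mem_cons] at h
  obtain ⟨hT, hS, h2, h4, hC, hσ, hF, hH, hE, hs, hΩ, -⟩ := h
  refine WordLenLe.mono_len ((((hF.mul hH).mul (((hE.mul ((hΩ.inv.mul (hs.mul ((hS.mul hs).mul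
    hS.inv)).inv).mul hΩ)).mul ((h2.mul hs).mul h2.inv)).mul ((h4.mul hs).mul h4.inv))).mul
    ((hT.mul hH.inv).mul hT.inv)).mul (((hσ.mul hF).mul hσ.inv).mul ((hC.mul hE).mul hC.inv)).inv)
    (by linarith)

end WordLength

section Spread

variable {V : Type} [NormedAddCommGroup V] [InnerProductSpace ℝ V] [FiniteDimensional ℝ V]

lemma decay_of_supp {f : ℕ → V → V} {ε : ℝ} (hf : ∀ s, Smooth (f s))
    (hsupp : ∀ s, ∃ R, ∀ x, R < ‖x‖ → f s x = 0)
    (h : ∀ s, ∀ i ≤ s + 1, ∀ x, nd i (f s) x ≤ ε * (1 / 2) ^ s) (k : ℕ) :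
    ∃ M, ∀ s x, nd k (f s) x ≤ M * (1 / 2) ^ s := by
  have h1 : ∀ s, ∃ C, 0 ≤ C ∧ ∀ x, nd k (f s) x ≤ C := fun s => by
    obtain ⟨R, hR⟩ := hsupp s
    obtain ⟨C, hC, hC'⟩ := exists_nd_bound (hf s) k R
    refine ⟨C, by linarith, fun x => ?_⟩
    rcases lt_or_ge R ‖x‖ with hx | hx
    · rw [nd_eq_zero_of_ball hR hx]; linarith
    · exact hC' k le_rfl x hx
  choose C hC0 hC using h1
  have hS : ∀ s, 0 ≤ C s * 2 ^ s := fun s => mul_nonneg (hC0 s) (by positivity)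
  refine ⟨|ε| + ∑ s ∈ Finset.range k, C s * 2 ^ s, fun s x => ?_⟩
  have h2 : (0 : ℝ) < (1 / 2) ^ s := by positivity
  rcases lt_or_ge s k with hs | hs
  · have h3 := Finset.single_le_sum (fun i _ => hS i) (Finset.mem_range.mpr hs)
    have h4 : C s * 2 ^ s * (1 / 2) ^ s = C s := by
      rw [mul_assoc, mul_comm (2 ^ s), half_pow_mul, mul_one]
    have h5 := mul_le_mul_of_nonneg_right h3 h2.le
    have h6 := mul_nonneg (abs_nonneg ε) h2.le
    have := hC s x
    rw [add_mul]
    linarith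
  · refine (h s k (by omega) x).trans (mul_le_mul_of_nonneg_right ?_ h2.le)
    have := Finset.sum_nonneg fun i (_ : i ∈ Finset.range k) => hS i
    have := le_abs_self ε
    linarith

lemma exists_wander (e : V) (he : ‖e‖ = 1) {R : ℝ} (hR : 0 < R) : ∃ (c : V) (t : Equiv.Perm V),
    IsD t ∧ Wander t (Metric.closedBall 0 R) ∧
      ∀ (n : ℕ), ∀ x ∈ Metric.closedBall 0 R, (t ^ n) x = c + (1 / 4 : ℝ) ^ n • (x - c) := by
  obtain ⟨c, hcn⟩ : ∃ c : V, ‖c‖ = 4 * R :=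
    ⟨(4 * R) • e, by rw [norm_smul, he, mul_one, Real.norm_of_nonneg (by linarith)]⟩
  have hcut : Cut (Equiv.addRight c * homoth (Units.mk0 (1 / 4) (by norm_num)) *
      Equiv.addRight (-c)) :=
    ((cut_translation c).mul (cut_homoth (by simp))).mul (cut_translation (-c))
  obtain ⟨t, ht, ht'⟩ := hcut (9 * R)
  have key : ∀ (n : ℕ), ∀ x ∈ Metric.closedBall 0 R,
      (t ^ n) x = c + (1 / 4 : ℝ) ^ n • (x - c) := fun n => by
    induction n with
    | zero => intro x _; simp
    | succ n ih =>
      intro x hx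
      rw [mem_closedBall_zero_iff] at hx
      have h0 : (0 : ℝ) < (1 / 4) ^ n := by positivity
      have h1 : ‖c + (1 / 4 : ℝ) ^ n • (x - c)‖ ≤ 9 * R := by
        have h2 := norm_add_le c ((1 / 4 : ℝ) ^ n • (x - c))
        rw [norm_smul, Real.norm_of_nonneg h0.le] at h2
        have h3 : (1 / 4 : ℝ) ^ n ≤ 1 := pow_le_one₀ (by norm_num) (by norm_num)
        have h4 := norm_sub_le x c
        nlinarith [norm_nonneg (x - c)]
      rw [pow_succ', Equiv.Perm.mul_apply, ih x (mem_closedBall_zero_iff.mpr hx), ht' _ h1]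
      simp only [Equiv.Perm.mul_apply, Equiv.coe_addRight, homoth_apply, Units.val_mk0]
      module
  refine ⟨c, t, ht, fun m hm x hx hmem => ?_, key⟩
  rw [key m x hx, mem_closedBall_zero_iff] at hmem
  rw [mem_closedBall_zero_iff] at hx
  obtain ⟨k, rfl⟩ : ∃ k, m = k + 1 := ⟨m - 1, by omega⟩
  have h0 : (0 : ℝ) < (1 / 4) ^ (k + 1) := by positivity
  have h3 : (1 / 4 : ℝ) ^ (k + 1) ≤ 1 / 4 := by
    have : (1 / 4 : ℝ) ^ k ≤ 1 := pow_le_one₀ (by norm_num) (by norm_num)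
    rw [pow_succ]; linarith
  have h2 := norm_sub_norm_le c ((1 / 4 : ℝ) ^ (k + 1) • (c - x))
  rw [norm_smul, Real.norm_of_nonneg h0.le,
    show c - (1 / 4 : ℝ) ^ (k + 1) • (c - x) = c + (1 / 4 : ℝ) ^ (k + 1) • (x - c) by module] at h2
  have h4 := norm_sub_le c x
  nlinarith [norm_nonneg (c - x)]

/-- The required size of the letters. -/
def letterSize (k : ℕ) : ℝ := 1 / 4 * (1 / 2) ^ k * (1 / 4) ^ (2 ^ (5 * k + 4) * (k + 1))

lemma letterSize_pos (k : ℕ) : 0 < letterSize k := by unfold letterSize; positivity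

lemma nd_rescaled {D : V → V} (hD : Smooth D) (c : V) {q : ℝ} (hq : 1 ≤ q) (i : ℕ) {η : ℝ}
    (h : ∀ x, nd i D x ≤ η) (x : V) :
    nd i (fun x => q⁻¹ • D (c + q • (x - c))) x ≤ q ^ i * η := by
  have h1 : Smooth fun y => D (y + (c - q • c)) := hD.comp (contDiff_id.add contDiff_const)
  have h2 : (fun x => q⁻¹ • D (c + q • (x - c))) =
      fun x => q⁻¹ • (fun x => (fun y => D (y + (c - q • c))) (q • x)) x := by
    funext x
    congr 2
    module
  have h3 : Smooth fun x => (fun y => D (y + (c - q • c))) (q • x) :=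
    h1.comp (contDiff_const.smul contDiff_id)
  have hη := (nd_nonneg i D x).trans (h x)
  rw [h2, nd_const_smul h3, nd_comp_smul h1, nd_comp_add, abs_of_pos (by positivity),
    abs_of_pos (by positivity)]
  have h4 : q⁻¹ ≤ 1 := inv_le_one_of_one_le₀ hq
  have h5 := mul_le_mul_of_nonneg_left (h (q • x + (c - q • c))) (by positivity : 0 ≤ q ^ i)
  have h6 : 0 ≤ q ^ i * η := by positivity
  nlinarith [inv_pos.mpr (by linarith : 0 < q)]

lemma spread_isD {R : ℝ} {c : V} {t : Equiv.Perm V} (h : Wander t (Metric.closedBall 0 R))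
    (ht : ∀ (n : ℕ), ∀ x ∈ Metric.closedBall 0 R, (t ^ n) x = c + (1 / 4 : ℝ) ^ n • (x - c))
    {Y : ℕ → Equiv.Perm V} (hY : ∀ k, Sup (Y k) (Metric.closedBall 0 R))
    (hs : ∀ k, Smooth (Y k)) (hsm : ∀ k, sm (k + 1) (letterSize k) fun x => Y k x - x)
    (a : Fin 5) : IsD (swarm h (spread Y hY a)) := by
  set n : ℕ → ℕ := fun k => 2 ^ (5 * k + a) with hn
  have hslot : ∀ k, slot a k = (n k : ℤ) := fun k => by simp [slot, hn]
  set z : ℕ → V → V := fun k x => c + (4 : ℝ) ^ n k • (x - c) with hz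
  set f : ℕ → V → V := fun k x => ((4 : ℝ) ^ n k)⁻¹ • (Y k (z k x) - z k x) with hf
  have hinv : ∀ k, ((4 : ℝ) ^ n k)⁻¹ = (1 / 4) ^ n k := fun k => by rw [one_div, inv_pow]
  have hmul : ∀ k, (1 / 4 : ℝ) ^ n k * 4 ^ n k = 1 := fun k => by
    rw [← mul_pow]; norm_num
  have hD : ∀ k, Smooth fun x => Y k x - x := fun k => (hs k).sub contDiff_id
  have hfs : ∀ k, Smooth (f k) := fun k =>
    contDiff_const.smul ((hD k).comp (contDiff_const.add (contDiff_const.smul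
      (contDiff_id.sub contDiff_const))))
  have hfne : ∀ k x, f k x ≠ 0 → z k x ∈ Metric.closedBall (0 : V) R ∧ (t ^ slot a k) (z k x) = x :=
    fun k x hx => by
      have h1 : z k x ∈ Metric.closedBall (0 : V) R := by
        by_contra hc
        exact hx (by simp only [hf, hY k _ hc, sub_self, smul_zero])
      refine ⟨h1, ?_⟩
      rw [hslot, zpow_natCast, ht _ _ h1]
      simp only [hz, add_sub_cancel_left, smul_smul, hmul, one_smul, add_sub_cancel]
  have hsupp : ∀ x, ‖c‖ + (R + ‖c‖) < ‖x‖ → ∀ k, f k x = 0 := fun x hx k => by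
    by_contra hc
    obtain ⟨h1, h2⟩ := hfne k x hc
    rw [hslot, zpow_natCast, ht _ _ h1] at h2
    rw [mem_closedBall_zero_iff] at h1
    have h3 := norm_add_le c ((1 / 4 : ℝ) ^ n k • (z k x - c))
    rw [h2, norm_smul, Real.norm_of_nonneg (by positivity)] at h3
    have h4 : (1 / 4 : ℝ) ^ n k ≤ 1 := pow_le_one₀ (by norm_num) (by norm_num)
    have h5 := norm_sub_le (z k x) c
    nlinarith [norm_nonneg (z k x - c)]
  have hbd : ∀ k, ∀ i ≤ k + 1, ∀ x, nd i (f k) x ≤ 1 / 4 * (1 / 2) ^ k := fun k i hi x => by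
    refine (nd_rescaled (hD k) c (one_le_pow₀ (by norm_num)) i (hsm k i hi) x).trans ?_
    have h1 : n k * i ≤ 2 ^ (5 * k + 4) * (k + 1) :=
      Nat.mul_le_mul (Nat.pow_le_pow_right (by norm_num) (by omega)) hi
    have h2 : ((4 : ℝ) ^ n k) ^ i ≤ 4 ^ (2 ^ (5 * k + 4) * (k + 1)) := by
      rw [← pow_mul]; exact pow_le_pow_right₀ (by norm_num) h1
    have h3 := mul_le_mul_of_nonneg_right h2 (letterSize_pos k).le
    refine h3.trans (le_of_eq ?_)
    rw [letterSize, mul_comm, mul_assoc, ← mul_pow]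
    norm_num
  have hdec := decay_of_supp hfs (fun s => ⟨_, fun x hx => hsupp x hx s⟩) hbd
  obtain ⟨g, hg, hg'⟩ := exists_near_perm (smooth_tsum hfs hdec)
    (fun x => (nd_tsum_le hfs hdec (fun s x => hbd s 1 (by omega) x) x).trans (by norm_num))
    (R := ‖c‖ + (R + ‖c‖)) fun x hx => (tsum_congr (hsupp x hx)).trans tsum_zero
  suffices g = swarm h (spread Y hY a) by rwa [← this]
  refine swarm_ext h (fun m b => ?_) fun x hx => ?_
  · by_cases hm : ∃ k, slot a k = m
    · obtain ⟨k, rfl⟩ := hm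
      rw [spread, (slot_injective a).extend_apply, hg', tsum_eq_single k]
      · have h1 : z k ((t ^ slot a k) b) = b := by
          rw [hslot, zpow_natCast, ht _ _ b.2]
          simp only [hz, add_sub_cancel_left, smul_smul, mul_comm ((4 : ℝ) ^ n k), hmul, one_smul,
            add_sub_cancel]
        simp only [hf, h1]
        rw [hslot, zpow_natCast, ht _ _ b.2, ht _ _ (Subtype.mem _), hinv]
        change _ = c + _ • (Y k b - c)
        module
      · intro l hl
        by_contra hc
        obtain ⟨h1, h2⟩ := hfne l _ hc
        exact hl (slot_injective a (h.eq h1 b.2 h2))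
    · rw [spread, Function.extend_apply' _ _ _ hm, hg']
      have : ∀ k, f k ((t ^ m) b) = 0 := fun k => by
        by_contra hc
        obtain ⟨h1, h2⟩ := hfne k _ hc
        exact hm ⟨k, h.eq h1 b.2 h2⟩
      rw [tsum_congr this, tsum_zero, add_zero]
      rfl
  · have : ∀ k, f k x = 0 := fun k => by
      by_contra hc
      obtain ⟨h1, h2⟩ := hfne k _ hc
      exact hx _ ⟨_, h1⟩ h2
    rw [hg', tsum_congr this, tsum_zero, add_zero]

end Spread

section Encode

variable {V : Type} [NormedAddCommGroup V] [InnerProductSpace ℝ V] [FiniteDimensional ℝ V]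

lemma exists_common_support {ι : Type*} [Finite ι] {c : ι → Equiv.Perm V} (hc : ∀ i, IsD (c i))
    (R₀ : ℝ) : ∃ R, R₀ ≤ R ∧ ∀ i x, R < ‖x‖ → c i x = x := by
  choose R hR using fun i => (hc i).2.2
  obtain ⟨M, hM⟩ := (Set.finite_range R).bddAbove
  exact ⟨max R₀ M, le_max_left _ _, fun i x hx =>
    hR i x ((hM (mem_range_self i)).trans_lt ((le_max_right _ _).trans_lt hx))⟩

lemma sup_closedBall {a : Equiv.Perm V} {R : ℝ} (h : ∀ x, R < ‖x‖ → a x = x) :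
    Sup a (Metric.closedBall 0 R) := fun x hx => h x (by
  rwa [mem_closedBall_zero_iff, not_le] at hx)

variable (e p : V) [he : Fact (‖e‖ = 1)] [hp : Fact (‖p‖ = 1)] [hep : Horizontal e p]

/-- The linear conjugators of the machine. -/
def conjugators : Fin 6 → Equiv.Perm V :=
  ![act e (trF p 1), act e (trF p (1 / 2)), act e (trF p 2 * dblF), act e (trF p 4 * dblF),
    sig e * act e (trF p 3), sig e]

lemma cut_conjugators (i : Fin 6) : Cut (conjugators e p i) := by
  fin_cases i
  · exact cut_trF 1
  · exact cut_trF (1 / 2)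
  · change Cut (act e (trF p 2 * dblF)); rw [map_mul]; exact (cut_trF 2).mul cut_dblF
  · change Cut (act e (trF p 4 * dblF)); rw [map_mul]; exact (cut_trF 4).mul cut_dblF
  · exact cut_sig.mul (cut_trF 3)
  · exact cut_sig

lemma exists_machine_fin (K : ℕ) {η : ℝ} (hη : 0 < η) :
    ∃ k : ℕ, ∃ ρ > 0, ∀ W : V → ℝ, Smooth W → (∀ X, W X ≠ 0 → InBox e p X) → sm k ρ W →
      ∃ Y : Fin 5 → Equiv.Perm V, (∀ a, Near 42 K η (Y a)) ∧ ∀ c : Fin 6 → Equiv.Perm V,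
        (∀ i x, ‖x‖ ≤ 42 → c i x = conjugators e p i x) → ∀ X,
          mword (c 0) (c 1) (c 2) (c 3) (c 4) (c 5) (Y 0) (Y 1) (Y 2) (Y 3) (Y 4) X =
            X + W X • e := by
  obtain ⟨k, ρ, hρ, h⟩ := exists_machine e p K hη
  refine ⟨k, ρ, hρ, fun W hW hbox hsm => ?_⟩
  obtain ⟨F, H, E, S, O, hY, hm⟩ := h W hW hbox hsm
  simp only [List.forall_mem_cons] at hY
  obtain ⟨hF, hH, hE, hS, hO, -⟩ := hY
  refine ⟨![F, H, E, S, O], fun a => by fin_cases a <;> assumption, fun c hc X => ?_⟩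
  have hc' : ∀ i, ∀ x ∈ Metric.closedBall (0 : V) 42, c i x = conjugators e p i x :=
    fun i x hx => hc i x (mem_closedBall_zero_iff.mp hx)
  rw [← hm X]
  congr 1
  exact mword_agree (hc' 0) (hc' 1) (hc' 2) (hc' 3) (hc' 4) (hc' 5) (sup_closedBall hF.2.1)
    (sup_closedBall hH.2.1) (sup_closedBall hE.2.1) (sup_closedBall hS.2.1)

/-- The members of a sequence of sufficiently small fiberwise diffeomorphisms are words of
controlled lengths in a common finite set. -/
theorem exists_encode_fiber : ∃ (l r : ℕ → ℕ) (ρ : ℕ → ℝ), (∀ k, 0 < ρ k) ∧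
    ∀ W : ℕ → V → ℝ, (∀ k, Smooth (W k)) → (∀ k X, W k X ≠ 0 → InBox e p X) →
      (∀ k, sm (r k) (ρ k) (W k)) → ∃ S : Finset (Equiv.Perm V), (∀ s ∈ S, IsD s) ∧
        ∀ k (E : Equiv.Perm V), (∀ X, E X = X + W k X • e) → WordLenLe S E (l k) := by
  classical
  choose r ρ hρ hmach using fun k => exists_machine_fin e p (k + 1) (letterSize_pos k)
  refine ⟨fun k => 24 * (2 * 2 ^ (5 * k + 4) + 1), r, ρ, hρ, fun W hW hbox hsm => ?_⟩
  choose Y hY hword using fun k => hmach k (W k) (hW k) (hbox k) (hsm k)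
  choose c hc hc' using fun i => cut_conjugators e p i 42
  obtain ⟨R, hR, hcR⟩ := exists_common_support hc 42
  obtain ⟨v, t, htD, hwan, ht⟩ := exists_wander e he.out (by linarith : (0 : ℝ) < R)
  have hYB : ∀ a k, Sup (Y k a) (Metric.closedBall 0 R) := fun a k =>
    sup_closedBall fun x hx => (hY k a).2.1 x (hR.trans_lt hx)
  set Z : Fin 5 → Equiv.Perm V := fun a => swarm hwan (spread (fun k => Y k a) (hYB a) a) with hZ
  have hZD : ∀ a, IsD (Z a) := fun a =>
    spread_isD hwan ht (hYB a) (fun k => (hY k a).1.1) (fun k => (hY k a).2.2) a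
  refine ⟨insert t (Finset.univ.image c ∪ Finset.univ.image Z), fun s hs => ?_, fun k E hE => ?_⟩
  · rcases Finset.mem_insert.mp hs with rfl | hs
    · exact htD
    rcases Finset.mem_union.mp hs with hs | hs
    · obtain ⟨i, -, rfl⟩ := Finset.mem_image.mp hs
      exact hc i
    · obtain ⟨i, -, rfl⟩ := Finset.mem_image.mp hs
      exact hZD i
  · set S := insert t (Finset.univ.image c ∪ Finset.univ.image Z)
    have hE' : E = mword (c 0) (c 1) (c 2) (c 3) (c 4) (c 5) (Y k 0) (Y k 1) (Y k 2) (Y k 3)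
        (Y k 4) := by
      ext X
      rw [hE, hword k c hc']
    rw [hE', ← swarm_word hwan c (fun i => sup_closedBall (hcR i)) (fun a k => Y k a) hYB k
      (fun a => t ^ (-slot a k) * Z a * t ^ slot a k) fun a => rfl]
    have htS : WordLenLe S t 1 := wordLenLe_gen (Finset.mem_insert_self _ _)
    have hcS : ∀ i, WordLenLe S (c i) (2 * 2 ^ (5 * k + 4) + 1) := fun i =>
      (wordLenLe_gen (Finset.mem_insert_of_mem (Finset.mem_union_left _
        (Finset.mem_image_of_mem _ (Finset.mem_univ i))))).mono_len (by omega)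
    have hzS : ∀ a, WordLenLe S (t ^ (-slot a k) * Z a * t ^ slot a k)
        (2 * 2 ^ (5 * k + 4) + 1) := fun a => by
      have h1 : WordLenLe S (Z a) 1 :=
        wordLenLe_gen (Finset.mem_insert_of_mem (Finset.mem_union_right _
          (Finset.mem_image_of_mem _ (Finset.mem_univ a))))
      have h2 : (slot a k).natAbs ≤ 2 ^ (5 * k + 4) := by
        rw [slot, Int.natAbs_pow]
        exact Nat.pow_le_pow_right (by norm_num) (by omega)
      refine (((htS.zpow _).mul h1).mul (htS.zpow _)).mono_len ?_
      rw [Int.natAbs_neg]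
      omega
    apply wordLenLe_mword
    simp only [List.forall_mem_cons]
    exact ⟨hcS 0, hcS 1, hcS 2, hcS 3, hcS 4, hcS 5, hzS 0, hzS 1, hzS 2, hzS 3, hzS 4, by simp⟩

end Encode

section SoftEstimates

variable {E : Type} [NormedAddCommGroup E] [NormedSpace ℝ E]

lemma sm.mono {F : Type*} [NormedAddCommGroup F] [NormedSpace ℝ F] {r r' : ℕ} {ε ε' : ℝ}
    {w : E → F} (h : sm r ε w) (hr : r' ≤ r) (hε : ε ≤ ε') : sm r' ε' w :=
  fun i hi x => (h i (hi.trans hr) x).trans hε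

lemma nd_compL_le {F : Type*} [NormedAddCommGroup F] [NormedSpace ℝ F]
    {f : E → E →L[ℝ] F} {g : E → E →L[ℝ] E} (hf : Smooth f) (hg : Smooth g) {i : ℕ} {x : E}
    {C B : ℝ} (hC : ∀ j ≤ i, nd j f x ≤ C) (hB : ∀ j ≤ i, nd j g x ≤ B) :
    nd i (fun y => (f y).comp (g y)) x ≤ 2 ^ i * (C * B) := by
  have hC0 : 0 ≤ C := (nd_nonneg _ _ _).trans (hC 0 (Nat.zero_le _))
  refine (ContinuousLinearMap.norm_iteratedFDeriv_le_of_bilinear_of_le_one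
    (ContinuousLinearMap.compL ℝ E E F) hf hg x (by exact_mod_cast le_top)
    (ContinuousLinearMap.norm_compL_le ℝ E E F)).trans ?_
  have h1 : ∀ j ∈ Finset.range (i + 1), (i.choose j : ℝ) * nd j f x * nd (i - j) g x ≤
      i.choose j * (C * B) := fun j hj => by
    rw [mul_assoc]
    have := hC j (by simpa [Nat.lt_succ_iff] using hj)
    have := hB (i - j) (Nat.sub_le _ _)
    gcongr
  refine (Finset.sum_le_sum h1).trans ?_
  rw [← Finset.sum_mul]
  have h2 : ∑ j ∈ Finset.range (i + 1), (i.choose j : ℝ) = 2 ^ i := by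
    exact_mod_cast Nat.sum_range_choose i
  rw [h2]

lemma exists_comp_diff_bound (r : ℕ) : ∃ C, 0 ≤ C ∧ ∀ (F : Type) [NormedAddCommGroup F]
    [NormedSpace ℝ F] (g : E → F) (w : E → E) (A ε : ℝ), Smooth g → Smooth w → ε ≤ 1 →
    (∀ i, 1 ≤ i → i ≤ r + 1 → ∀ x, nd i g x ≤ A) → sm r ε w →
    sm r (C * (A * ε)) fun x => g (x + w x) - g x := by
  have base : ∀ (F : Type) [NormedAddCommGroup F] [NormedSpace ℝ F] (g : E → F) (w : E → E)
      (A ε : ℝ), Smooth g → (∀ x, nd 1 g x ≤ A) → (∀ x, nd 0 w x ≤ ε) →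
      ∀ x, ‖g (x + w x) - g x‖ ≤ A * ε := by
    intro F _ _ g w A ε hg hA hw x
    have h1 := norm_sub_le_of_nd_one hg hA (x + w x) x
    rw [add_sub_cancel_left] at h1
    have h2 := hw x
    rw [nd_zero] at h2
    exact h1.trans (mul_le_mul_of_nonneg_left h2 ((nd_nonneg _ _ _).trans (hA x)))
  induction r with
  | zero =>
    refine ⟨1, zero_le_one, fun F _ _ g w A ε hg hw hε hA hs i hi x => ?_⟩
    obtain rfl : i = 0 := by omega
    rw [nd_zero, one_mul]
    exact base F g w A ε hg (hA 1 le_rfl le_rfl) (hs 0 le_rfl) x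
  | succ r ih =>
    obtain ⟨C, hC0, hC⟩ := ih
    refine ⟨(C + 2 ^ r * (C + 1)) + 1, by positivity,
      fun F _ _ g w A ε hg hw hε hA hs i hi x => ?_⟩
    have hε0 : 0 ≤ ε := (nd_nonneg _ _ _).trans (hs 0 (Nat.zero_le _) x)
    have hA0 : 0 ≤ A := (nd_nonneg _ _ _).trans (hA 1 le_rfl (by omega) x)
    have hT : 0 ≤ (C + 2 ^ r * (C + 1)) * (A * ε) := by positivity
    rcases i with _ | i
    · rw [nd_zero]
      have := base F g w A ε hg (hA 1 le_rfl (by omega)) (hs 0 (Nat.zero_le _)) x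
      linarith
    have hdg : Smooth (fderiv ℝ g) := hg.fderiv_right (by simp)
    have hdw : Smooth (fderiv ℝ w) := hw.fderiv_right (by simp)
    have hφ : Smooth fun y => y + w y := contDiff_id.add hw
    have hgφ : Smooth fun y => fderiv ℝ g (y + w y) := hdg.comp hφ
    have key := hC (E →L[ℝ] F) (fderiv ℝ g) w A ε hdg hw hε
      (fun j _ hj y => by rw [nd_fderiv]; exact hA (j + 1) (by omega) (by omega) y)
      (hs.mono (Nat.le_succ _) le_rfl)
    have hfd : fderiv ℝ (fun y => g (y + w y) - g y) = fun y =>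
        (fderiv ℝ g (y + w y) - fderiv ℝ g y) + (fderiv ℝ g (y + w y)).comp (fderiv ℝ w y) := by
      funext y
      have hdiff : ∀ {G H : Type} [NormedAddCommGroup G] [NormedSpace ℝ G]
        [NormedAddCommGroup H] [NormedSpace ℝ H] {u : G → H}, Smooth u → ∀ z,
          DifferentiableAt ℝ u z := fun hu z => hu.differentiable (by simp) z
      have h2 : HasFDerivAt (fun x => x + w x)
          (ContinuousLinearMap.id ℝ E + fderiv ℝ w y) y :=
        (hasFDerivAt_id y).add (hdiff hw y).hasFDerivAt
      have h3 := ((hdiff hg (y + w y)).hasFDerivAt.comp y h2).sub (hdiff hg y).hasFDerivAt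
      refine h3.fderiv.trans ?_
      ext v
      simp
      abel
    rw [← nd_fderiv, hfd]
    refine (nd_add_le (hgφ.sub hdg) (hgφ.clm_comp hdw) i x).trans ?_
    have hb : ∀ j ≤ i, nd j (fun y => fderiv ℝ g (y + w y)) x ≤ (C + 1) * A := fun j hj => by
      have e : (fun y => fderiv ℝ g (y + w y)) =
          fun y => (fderiv ℝ g (y + w y) - fderiv ℝ g y) + fderiv ℝ g y := by
        funext y; rw [sub_add_cancel]
      rw [e]
      refine (nd_add_le (hgφ.sub hdg) hdg j x).trans ?_
      have h1 := key j (by omega) x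
      have h2 : nd j (fderiv ℝ g) x ≤ A := by
        rw [nd_fderiv]; exact hA (j + 1) (by omega) (by omega) x
      have h3 : C * (A * ε) ≤ C * (A * 1) := by gcongr
      linarith
    have h4 := nd_compL_le hgφ hdw (i := i) (x := x) (C := (C + 1) * A) (B := ε) hb
      (fun j hj => by rw [nd_fderiv]; exact hs (j + 1) (by omega) x)
    have h5 := key i (by omega) x
    have h6 : (2 : ℝ) ^ i * ((C + 1) * A * ε) ≤ 2 ^ r * ((C + 1) * A * ε) := by
      gcongr
      · norm_num
      · omega
    have h7 : 0 ≤ A * ε := by positivity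
    calc _ ≤ C * (A * ε) + 2 ^ r * ((C + 1) * A * ε) := add_le_add h5 (h4.trans h6)
      _ ≤ _ := by linarith

lemma sm.comp {F G : Type*} [NormedAddCommGroup F] [NormedSpace ℝ F] [NormedAddCommGroup G]
    [NormedSpace ℝ G] {φ : E → F} {W : F → G} (hφ : Smooth φ) (hW : Smooth W) {K : ℕ} {D ε : ℝ}
    (hD : 1 ≤ D) (hb : ∀ i, 1 ≤ i → i ≤ K → ∀ x, nd i φ x ≤ D) (hs : sm K ε W) :
    sm K (K.factorial * D ^ K * ε) fun x => W (φ x) := fun i hi x => by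
  have hε : 0 ≤ ε := (nd_nonneg _ _ _).trans (hs 0 (Nat.zero_le _) (φ x))
  refine (norm_iteratedFDeriv_comp_le (n := i) (N := (⊤ : ℕ∞)) hW hφ (by exact_mod_cast le_top) x
    (C := ε) (D := D) (fun k hk => hs k (hk.trans hi) _)
    (fun k hk1 hk => (hb k hk1 (hk.trans hi) x).trans (le_self_pow₀ hD (by omega)))).trans ?_
  have h4 : (i.factorial : ℝ) ≤ K.factorial := by exact_mod_cast Nat.factorial_le hi
  have h5 : D ^ i ≤ D ^ K := pow_le_pow_right₀ hD hi
  calc (i.factorial : ℝ) * ε * D ^ i ≤ K.factorial * ε * D ^ K := by gcongr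
    _ = _ := by ring

lemma IsD.exists_nd_bound [FiniteDimensional ℝ E] {g : Equiv.Perm E} (hg : IsD g) (K : ℕ) :
    ∃ A, 1 ≤ A ∧ ∀ i, 1 ≤ i → i ≤ K → ∀ x, nd i g x ≤ A := by
  obtain ⟨hs, -, R, hR⟩ := hg
  obtain ⟨C, hC1, hC⟩ := DiffDistortion.exists_nd_bound hs K R
  refine ⟨C, hC1, fun i hi hi' x => ?_⟩
  rcases le_or_gt ‖x‖ R with hx | hx
  · exact hC i hi' x hx
  · have e : (g : E → E) =ᶠ[nhds x] fun y => y := by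
      filter_upwards [(isOpen_lt continuous_const continuous_norm).mem_nhds hx] with y hy
      exact hR y hy
    rw [nd_congr e]
    rcases hi.lt_or_eq with h | rfl
    · rw [nd_id h]; linarith
    · exact (nd_id_one x).trans hC1

lemma Near.smooth {R : ℝ} {K : ℕ} {η : ℝ} {Y : Equiv.Perm E} (h : Near R K η Y) :
    Smooth fun x => Y x - x := h.1.1.sub contDiff_id

lemma Near.mono {R R' : ℝ} {K K' : ℕ} {η η' : ℝ} {Y : Equiv.Perm E} (h : Near R K η Y)
    (hR : R ≤ R') (hK : K' ≤ K) (hη : η ≤ η') : Near R' K' η' Y :=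
  ⟨h.1, fun x hx => h.2.1 x (hR.trans_lt hx), h.2.2.mono hK hη⟩

lemma Near.nd_le_two {R : ℝ} {K : ℕ} {Y : Equiv.Perm E} (h : Near R K 1 Y) (i : ℕ) (hi : 1 ≤ i)
    (hi' : i ≤ K) (x : E) : nd i Y x ≤ 2 := by
  have e : (Y : E → E) = fun x => x + (Y x - x) := by funext x; rw [add_sub_cancel]
  have h1 := h.2.2 i hi' x
  rw [e]
  rcases hi.lt_or_eq with h' | rfl
  · exact (nd_id_add h.smooth h' x).trans (by linarith)
  · exact (nd_id_add_one h.smooth x).trans (by linarith)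

/-- Closeness to the identity passes to products. -/
lemma Near.mul (K : ℕ) {ε : ℝ} (hε : 0 < ε) : ∃ δ, 0 < δ ∧ δ ≤ ε ∧
    ∀ (R : ℝ) (Y Z : Equiv.Perm E), Near R K δ Y → Near R K δ Z → Near R K ε (Y * Z) := by
  have hC0 : (0 : ℝ) < K.factorial * 2 ^ K + 1 := by positivity
  refine ⟨min (min 1 ε) (ε / (K.factorial * 2 ^ K + 1)), by positivity,
    (min_le_left _ _).trans (min_le_right _ _), fun R Y Z hY hZ => ⟨hY.1.mul hZ.1, fun x hx => ?_,
    fun i hi x => ?_⟩⟩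
  · rw [Equiv.Perm.mul_apply, hZ.2.1 x hx, hY.2.1 x hx]
  · have hδ1 := min_le_right (min 1 ε) (ε / (K.factorial * 2 ^ K + 1))
    have hδ2 := (min_le_left (min 1 ε) (ε / (K.factorial * 2 ^ K + 1))).trans (min_le_left _ _)
    generalize min (min 1 ε) (ε / (K.factorial * 2 ^ K + 1)) = δ at *
    have e : (fun x => (Y * Z) x - x) = fun x => (Y (Z x) - Z x) + (Z x - x) := by
      funext x; rw [Equiv.Perm.mul_apply]; abel
    have h1 := sm.comp hZ.1.1 hY.smooth one_le_two
      (hZ.mono le_rfl le_rfl hδ2).nd_le_two hY.2.2 i hi x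
    have h2 := hZ.2.2 i hi x
    have h3 : Smooth fun x => Y (Z x) - Z x := hY.smooth.comp hZ.1.1
    rw [e]
    refine (nd_add_le h3 hZ.smooth i x).trans ((add_le_add h1 h2).trans ?_)
    rw [le_div_iff₀ hC0] at hδ1
    linarith

/-- Closeness to the identity passes to inverses. -/
lemma Near.inv (K : ℕ) {ε : ℝ} (hε : 0 < ε) : ∃ δ, 0 < δ ∧ δ ≤ ε ∧
    ∀ (R : ℝ) (Y : Equiv.Perm E), Near R (K + 2) δ Y → Near R (K + 2) ε Y⁻¹ := by
  have hC := two_le_compC (K := K + 2) (by omega)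
  refine ⟨min (1 / (2 * compC (K + 2))) (ε / compC (K + 2)), by positivity,
    (min_le_right _ _).trans (div_le_self hε.le (by linarith)), fun R Y hY => ?_⟩
  have hδ0 : 0 < min (1 / (2 * compC (K + 2))) (ε / compC (K + 2)) := by positivity
  have hδ1 := min_le_left (1 / (2 * compC (K + 2))) (ε / compC (K + 2))
  have hδ2 := min_le_right (1 / (2 * compC (K + 2))) (ε / compC (K + 2))
  generalize min (1 / (2 * compC (K + 2))) (ε / compC (K + 2)) = δ at *
  have hεδ : compC (K + 2) * δ ≤ ε := by
    rw [le_div_iff₀ (by linarith)] at hδ2; linarith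
  refine ⟨hY.1.inv, fun x hx => ?_, fun i hi x => ?_⟩
  · rw [Equiv.Perm.inv_eq_iff_eq, hY.2.1 x hx]
  have hv : ∀ x, Y⁻¹ x - x = -(Y (x + (Y⁻¹ x - x)) - (x + (Y⁻¹ x - x))) := fun x => by
    rw [add_sub_cancel, pself_inv, neg_sub]
  have hT := TB.inv (K := K + 2) (by omega) hδ0 le_rfl
    (by
      rw [le_div_iff₀ (by positivity)] at hδ1
      linarith) hY.smooth (hY.1.inv.1.sub contDiff_id) hv
    (TB.of_plain (by omega) fun i _ hi x => hY.2.2 i hi x)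
  rcases Nat.eq_zero_or_pos i with rfl | h
  · have h1 := hY.2.2 0 (Nat.zero_le _) (x + (Y⁻¹ x - x))
    rw [nd_zero] at h1 ⊢
    rw [hv x, norm_neg]
    nlinarith
  · exact (hT.plain h hi x).trans hεδ

/-- Conjugation by a fixed diffeomorphism is continuous at the identity. -/
lemma Near.conj [FiniteDimensional ℝ E] {g : Equiv.Perm E} (hg : IsD g) {R : ℝ}
    (hR : ∀ x, R < ‖x‖ → g x = x) (K : ℕ) {ε : ℝ} (hε : 0 < ε) : ∃ δ, 0 < δ ∧ δ ≤ ε ∧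
    ∀ Y : Equiv.Perm E, Near R K δ Y → Near R K ε (g * Y * g⁻¹) := by
  obtain ⟨A, hA1, hA⟩ := hg.exists_nd_bound (K + 1)
  obtain ⟨D, hD1, hD⟩ := hg.inv.exists_nd_bound K
  obtain ⟨C, hC0, hC⟩ := exists_comp_diff_bound (E := E) K
  have hT : 0 < K.factorial * D ^ K * (C * A) + 1 := by positivity
  refine ⟨min (min 1 ε) (ε / (K.factorial * D ^ K * (C * A) + 1)), by positivity,
    (min_le_left _ _).trans (min_le_right _ _), fun Y hY => ⟨hg.conj hY.1, fun x hx => ?_,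
    fun i hi x => ?_⟩⟩
  · have : g⁻¹ x = x := by
      rw [Equiv.Perm.inv_eq_iff_eq, hR x hx]
    rw [Equiv.Perm.mul_apply, Equiv.Perm.mul_apply, this, hY.2.1 x hx, hR x hx]
  · have hδ1 := min_le_right (min 1 ε) (ε / (K.factorial * D ^ K * (C * A) + 1))
    have hδ2 := (min_le_left (min 1 ε)
      (ε / (K.factorial * D ^ K * (C * A) + 1))).trans (min_le_left _ _)
    have hδ0 : 0 < min (min 1 ε) (ε / (K.factorial * D ^ K * (C * A) + 1)) := by positivity
    generalize min (min 1 ε) (ε / (K.factorial * D ^ K * (C * A) + 1)) = δ at *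
    have h1 := hC E g (fun x => Y x - x) A δ hg.1 hY.smooth hδ2 hA hY.2.2
    simp only [add_sub_cancel] at h1
    have hs : Smooth fun x => g (Y x) - g x := (hg.1.comp hY.1.1).sub hg.1
    have h2 := sm.comp hg.inv.1 hs hD1 hD h1 i hi x
    have e : (fun x => (g * Y * g⁻¹) x - x) = fun x => g (Y (g⁻¹ x)) - g (g⁻¹ x) := by
      funext x
      rw [Equiv.Perm.mul_apply, Equiv.Perm.mul_apply, pself_inv]
    rw [e]
    refine h2.trans ?_
    rw [le_div_iff₀ hT] at hδ1
    linarith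

end SoftEstimates

section Encoding

variable {V : Type} [NormedAddCommGroup V] [InnerProductSpace ℝ V] [FiniteDimensional ℝ V]

/-- The members of every sequence of sufficiently small diffeomorphisms satisfying `Q` and supported
in the ball of radius `R` are words of controlled lengths in a common finite set. -/
def Encodable (R : ℝ) (Q : Equiv.Perm V → Prop) : Prop :=
  ∃ (l r : ℕ → ℕ) (ρ : ℕ → ℝ), (∀ k, 0 < ρ k) ∧ ∀ E : ℕ → Equiv.Perm V, (∀ k, Q (E k)) →
    (∀ k, Near R (r k) (ρ k) (E k)) → ∃ S : Finset (Equiv.Perm V), (∀ s ∈ S, IsD s) ∧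
      ∀ k, WordLenLe S (E k) (l k)

omit [FiniteDimensional ℝ V] in
lemma Near.norm_apply_le {R : ℝ} {K : ℕ} {η : ℝ} {Y : Equiv.Perm V} (h : Near R K η Y) {x : V}
    (hx : ‖x‖ ≤ R) : ‖Y x‖ ≤ R := by
  by_contra! hc
  rw [Y.injective (h.2.1 _ hc)] at hc
  exact absurd hx (not_le.mpr hc)

/-- A diffeomorphism that contracts a given ball affinely. -/
lemma exists_contraction (v : V) (R : ℝ) : ∃ (c : Equiv.Perm V) (b : ℝ), IsD c ∧ 0 < b ∧
    b * R ≤ 1 / 4 ∧ ∀ x, ‖x‖ ≤ R → c x = b • x + v := by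
  have hb : 0 < 1 / (4 * (|R| + 1)) := by positivity
  obtain ⟨c, hc, h⟩ := ((cut_translation v).mul (cut_homoth (b := Units.mk0 _ hb.ne') hb)) R
  refine ⟨c, 1 / (4 * (|R| + 1)), hc, hb, ?_, fun x hx => h x hx⟩
  rw [div_mul_eq_mul_div, div_le_div_iff₀ (by positivity) (by norm_num)]
  linarith [le_abs_self R]

lemma encodable_line (e p : V) [Fact (‖e‖ = 1)] [Fact (‖p‖ = 1)] [hep : Horizontal e p] (R : ℝ) :
    Encodable R fun E : Equiv.Perm V => ∀ x, E x = x + yc e (E x - x) • e := by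
  classical
  obtain ⟨l, r, ρ, hρ, henc⟩ := exists_encode_fiber e p
  obtain ⟨c, b, hc, hb, hbR, hcx⟩ := exists_contraction (p + (2 : ℝ) • e) R
  obtain ⟨R', hRR', hcR'⟩ := exists_common_support (fun _ : Unit => hc) R
  choose δ hδ _ hconj using fun k => Near.conj hc (hcR' ()) (r k) (hρ k)
  have hyp : yc e p = 0 := by rw [← hep.out, yc_pr]
  have hpe : pr e e = 0 := by rw [pr_apply, yc_self]; simp
  refine ⟨fun k => 1 + l k + 1, r, δ, hδ, fun E hQ hE => ?_⟩
  have hE' := fun k => hconj k (E k) ((hE k).mono hRR' le_rfl le_rfl)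
  have hcE : ∀ k x, (c * E k * c⁻¹) (c x) = c (E k x) := fun k x => by
    rw [Equiv.Perm.mul_apply, Equiv.Perm.mul_apply, pinv_self]
  have hline : ∀ k x, ‖x‖ ≤ R → c (E k x) = c x + (b * yc e (E k x - x)) • e := fun k x hx => by
    rw [hcx _ ((hE k).norm_apply_le hx), hcx _ hx, mul_smul]
    conv_lhs => rw [hQ k x]
    rw [smul_add]; abel
  obtain ⟨S, hS, hw⟩ := henc (fun k X => yc e ((c * E k * c⁻¹) X - X))
    (fun k => (yc e).contDiff.comp (hE' k).smooth)
    (fun k X hX => by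
      obtain ⟨x, rfl⟩ := c.surjective X
      have hx : ‖x‖ ≤ R := by
        by_contra! hx
        rw [hcE, (hE k).2.1 x hx] at hX
        simp at hX
      rw [hcx x hx]
      have h1 : ‖b • x‖ ≤ 1 / 4 := by
        rw [norm_smul, Real.norm_of_nonneg hb.le]
        exact (mul_le_mul_of_nonneg_left hx hb.le).trans hbR
      constructor
      · have : pr e (b • x + (p + (2 : ℝ) • e)) - p = pr e (b • x) := by
          rw [map_add, map_add, hep.out, map_smul (pr e) 2 e, hpe]; simp
        rw [this]
        exact (norm_pr_apply_le e _).trans h1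
      · have : yc e (b • x + (p + (2 : ℝ) • e)) - 2 = yc e (b • x) := by
          rw [map_add, map_add, hyp, map_smul (yc e) 2 e, yc_self]; simp
        rw [this]
        exact (abs_yc_le e _).trans (by linarith))
    (fun k i hi x => by
      refine (nd_clm_comp_le (yc e) (hE' k).smooth i x).trans ?_
      exact (mul_le_of_le_one_left (nd_nonneg _ _ _) (norm_yc_le e)).trans ((hE' k).2.2 i hi x))
  refine ⟨insert c S, fun s hs => ?_, fun k => ?_⟩
  · rcases Finset.mem_insert.mp hs with rfl | hs
    exacts [hc, hS s hs]
  · have h1 := hw k (c * E k * c⁻¹) fun X => by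
      obtain ⟨x, rfl⟩ := c.surjective X
      rw [hcE]
      rcases le_or_gt ‖x‖ R with hx | hx
      · rw [hline k x hx, add_sub_cancel_left, map_smul, yc_self, smul_eq_mul, mul_one]
      · rw [(hE k).2.1 x hx]; simp
    have hc1 : WordLenLe (insert c S) c 1 := wordLenLe_gen (by simp)
    have h2 := (hc1.inv.mul (h1.mono_set (Finset.subset_insert c S))).mul hc1
    convert h2 using 1
    group

end Encoding

section Fragmentation

variable {d : ℕ}

instance fact_single (i : Fin d) : Fact (‖EuclideanSpace.single i (1 : ℝ)‖ = 1) := ⟨by simp⟩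

lemma yc_single (i : Fin d) (x : EuclideanSpace ℝ (Fin d)) :
    yc (EuclideanSpace.single i (1 : ℝ)) x = x i := by simp [yc, EuclideanSpace.inner_single_left]

lemma encodable_coords (hd : 2 ≤ d) (R : ℝ) (n : ℕ) (hn : n ≤ d) :
    Encodable R fun E : Equiv.Perm (EuclideanSpace ℝ (Fin d)) =>
      ∀ x (i : Fin d), n ≤ i → E x i = x i := by
  classical
  induction n with
  | zero =>
    refine ⟨0, 0, 1, fun _ => one_pos, fun E hQ _ => ⟨∅, by simp, fun k => ?_⟩⟩
    have : E k = 1 := by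
      ext x i
      exact hQ k x i (Nat.zero_le _)
    rw [this]
    exact wordLenLe_one
  | succ n ih =>
    obtain ⟨l, r, ρ, hρ, henc⟩ := ih (by omega)
    let i : Fin d := ⟨n, hn⟩
    obtain ⟨j, hj⟩ : ∃ j : Fin d, j ≠ i := by
      have : Nontrivial (Fin d) := Fin.nontrivial_iff_two_le.mpr hd
      exact exists_ne i
    have hor : Horizontal (EuclideanSpace.single i (1 : ℝ)) (EuclideanSpace.single j (1 : ℝ)) :=
      ⟨by rw [pr_apply, yc_single]; simp [hj.symm]⟩
    obtain ⟨l', r', ρ', hρ', henc'⟩ := encodable_line (EuclideanSpace.single i (1 : ℝ))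
      (EuclideanSpace.single j (1 : ℝ)) R
    choose δ hδ hδρ hmul using fun k => Near.mul (E := EuclideanSpace ℝ (Fin d))
      (max (r k) (r' k)) (hρ k)
    choose δ' hδ' _ hinv using fun k => Near.inv (E := EuclideanSpace ℝ (Fin d))
      (max (r k) (r' k)) (hδ k)
    refine ⟨fun k => l k + l' k, fun k => max (r k) (r' k) + 2,
      fun k => min (min (δ k) (δ' k)) (min (ρ' k) (1 / 2)), fun k => ?_, fun E hQ hE => ?_⟩
    · have := hδ k; have := hδ' k; have := hρ' k
      positivity
    have hws : ∀ k, Smooth fun x => yc (EuclideanSpace.single i (1 : ℝ)) (E k x - x) •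
        EuclideanSpace.single i (1 : ℝ) := fun k =>
      ((yc (EuclideanSpace.single i (1 : ℝ))).contDiff.comp (hE k).smooth).smul contDiff_const
    have hw : ∀ k, sm (max (r k) (r' k) + 2) (min (min (δ k) (δ' k)) (min (ρ' k) (1 / 2)))
        fun x => yc (EuclideanSpace.single i (1 : ℝ)) (E k x - x) •
          EuclideanSpace.single i (1 : ℝ) := fun k m hm x => by
      refine (nd_smul_e (e := EuclideanSpace.single i (1 : ℝ))
        ((yc (EuclideanSpace.single i (1 : ℝ))).contDiff.comp (hE k).smooth) m x).trans ?_
      refine (nd_clm_comp_le (yc (EuclideanSpace.single i (1 : ℝ))) (hE k).smooth m x).trans ?_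
      exact (mul_le_of_le_one_left (nd_nonneg _ _ _) (norm_yc_le _)).trans ((hE k).2.2 m hm x)
    have hsupp : ∀ k x, R < ‖x‖ → yc (EuclideanSpace.single i (1 : ℝ)) (E k x - x) •
        EuclideanSpace.single i (1 : ℝ) = 0 := fun k x hx => by
      rw [(hE k).2.1 x hx]; simp
    choose a haD ha using fun k => exists_near_perm (hws k) (fun x => (hw k 1 (by omega) x).trans
      ((min_le_right _ _).trans (min_le_right _ _))) (hsupp k)
    have haN : ∀ k, Near R (max (r k) (r' k) + 2)
        (min (min (δ k) (δ' k)) (min (ρ' k) (1 / 2))) (a k) := fun k =>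
      ⟨haD k, fun x hx => by rw [ha, hsupp k x hx, add_zero], by
        simpa only [ha, add_sub_cancel_left] using hw k⟩
    have hai : ∀ k x, a k x i = E k x i := fun k x => by
      rw [ha, yc_single]; simp
    have hai' : ∀ k x (m : Fin d), m ≠ i → a k x m = x m := fun k x m hm => by
      rw [ha]; simp [hm]
    obtain ⟨S, hS, hSw⟩ := henc (fun k => E k * (a k)⁻¹) (fun k y m hm => by
        obtain ⟨x, rfl⟩ := (a k).surjective y
        rw [Equiv.Perm.mul_apply, pinv_self]
        by_cases hmi : m = i
        · rw [hmi, hai]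
        · have hmi' : (m : ℕ) ≠ n := fun h => hmi (Fin.ext h)
          rw [hai' k x m hmi, hQ k x m (by omega)])
      (fun k => (hmul k R _ _
        ((hE k).mono le_rfl (Nat.le_add_right _ _) ((min_le_left _ _).trans (min_le_left _ _)))
        ((hinv k R _ ((haN k).mono le_rfl le_rfl
          ((min_le_left _ _).trans (min_le_right _ _)))).mono le_rfl (by omega) le_rfl)).mono
          le_rfl (le_max_left _ _) le_rfl)
    obtain ⟨S', hS', hSw'⟩ := henc' a (fun k x => by
        rw [ha, add_sub_cancel_left, map_smul, yc_self, smul_eq_mul, mul_one])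
      (fun k => (haN k).mono le_rfl ((le_max_right _ _).trans (Nat.le_add_right _ _))
        ((min_le_right _ _).trans (min_le_left _ _)))
    refine ⟨S ∪ S', fun s hs => (Finset.mem_union.mp hs).elim (hS s) (hS' s), fun k => ?_⟩
    have := ((hSw k).mono_set Finset.subset_union_left).mul
      ((hSw' k).mono_set Finset.subset_union_right)
    rwa [inv_mul_cancel_right] at this

/-- Sufficiently small diffeomorphisms with support in a given ball can be encoded. -/
theorem encodable (hd : 2 ≤ d) (R : ℝ) :
    Encodable R fun _ : Equiv.Perm (EuclideanSpace ℝ (Fin d)) => True := by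
  obtain ⟨l, r, ρ, hρ, h⟩ := encodable_coords hd R d le_rfl
  exact ⟨l, r, ρ, hρ, fun E _ => h E fun k x i hi => absurd i.2 (not_lt.mpr hi)⟩

end Fragmentation

section StableLength

variable {G : Type*} [Group G] {S T : Finset G} {a : G} {m : ℕ}

lemma _root_.WordLenLe.wordLength_le (h : WordLenLe S a m) : wordLength S a ≤ m := Nat.sInf_le h

lemma _root_.WordLenLe.wordLength (h : WordLenLe S a m) : WordLenLe S a (wordLength S a) :=
  Nat.sInf_mem (s := {m | WordLenLe S a m}) ⟨m, h⟩

lemma exists_wordLenLe_of_mem_closure (h : a ∈ Subgroup.closure (S : Set G)) :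
    ∃ m, WordLenLe S a m := by
  induction h using Subgroup.closure_induction with
  | mem x hx => exact ⟨1, wordLenLe_gen hx⟩
  | one => exact ⟨0, wordLenLe_one⟩
  | mul x y _ _ hx hy =>
    obtain ⟨m, hm⟩ := hx
    obtain ⟨n, hn⟩ := hy
    exact ⟨m + n, hm.mul hn⟩
  | inv x _ hx =>
    obtain ⟨m, hm⟩ := hx
    exact ⟨m, hm.inv⟩

lemma isDistorted_of_arith {P : G → Prop} (hS : ∀ s ∈ S, P s) (ha : a ∈ S)
    (h : ∀ ε > (0 : ℝ), ∃ m L C : ℕ, 0 < m ∧ (L : ℝ) ≤ ε * m ∧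
      ∀ q, WordLenLe S (a ^ (m * q)) (q * L + C)) : IsDistorted P a := by
  refine ⟨S, hS, Subgroup.subset_closure ha, ?_⟩
  rw [Metric.tendsto_atTop]
  intro ε hε
  obtain ⟨m, L, C, hm, hL, hq⟩ := h (ε / 2) (by positivity)
  obtain ⟨N, hN⟩ := exists_nat_gt ((C + m) / (ε / 2))
  refine ⟨N + 1, fun n hn => ?_⟩
  have hn0 : (0 : ℝ) < n := by exact_mod_cast (by omega : 0 < n)
  have h1 : wordLength S (a ^ n) ≤ (n / m) * L + C + (n % m) * 1 := by
    have := ((hq (n / m)).mul ((wordLenLe_gen ha).pow (n % m))).wordLength_le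
    rwa [← pow_add, Nat.div_add_mod] at this
  have h2 : n % m ≤ m := (Nat.mod_lt _ hm).le
  have h3 : ((n / m : ℕ) : ℝ) * L ≤ ε / 2 * n := by
    have h4 : (m : ℝ) * (n / m : ℕ) ≤ n := by exact_mod_cast Nat.mul_div_le n m
    calc ((n / m : ℕ) : ℝ) * L ≤ (n / m : ℕ) * (ε / 2 * m) := by gcongr
      _ = ε / 2 * (m * (n / m : ℕ)) := by ring
      _ ≤ _ := by gcongr
  have h5 : (C + m : ℝ) < ε / 2 * n := by
    rw [div_lt_iff₀ (by positivity)] at hN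
    have : (N : ℝ) ≤ n := by exact_mod_cast (by omega : N ≤ n)
    nlinarith
  have h6 : (wordLength S (a ^ n) : ℝ) ≤ (n / m : ℕ) * L + C + m := by
    exact_mod_cast h1.trans (by omega)
  rw [Real.dist_eq, sub_zero, abs_of_nonneg (by positivity), div_lt_iff₀ hn0]
  linarith

end StableLength

section Displacement

/-- If `T⁻¹` moves `B` off itself, then the commutator of `h` and `T` conjugates `f` in the same way
as `h`. -/
lemma conj_eq_of_displaced {α : Type*} {B : Set α} {f h T : Equiv.Perm α} (hf : Sup f B)
    (hh : Sup h B) (hT : ∀ x ∈ B, T⁻¹ x ∉ B) :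
    (h * T * h⁻¹ * T⁻¹) * f * (h * T * h⁻¹ * T⁻¹)⁻¹ = h * f * h⁻¹ := by
  have hu : Sup (T * h⁻¹ * T⁻¹) (T '' B) := hh.inv.conj fun y hy => mem_image_of_mem _ hy
  have hc : Commute f (T * h⁻¹ * T⁻¹) := hf.commute hu <| Set.disjoint_left.mpr fun y hy hy' => by
    obtain ⟨x, hx, rfl⟩ := hy'
    exact hT _ hy (by rwa [pinv_self])
  calc _ = h * ((T * h⁻¹ * T⁻¹) * f * (T * h⁻¹ * T⁻¹)⁻¹) * h⁻¹ := by group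
    _ = _ := by rw [← hc.eq, mul_inv_cancel_right]

variable {V : Type} [NormedAddCommGroup V] [InnerProductSpace ℝ V] [FiniteDimensional ℝ V]

lemma exists_displacement {e : V} (he : ‖e‖ = 1) {R₁ : ℝ} (hR₁ : 0 ≤ R₁) : ∃ R₀, R₁ ≤ R₀ ∧
    ∀ (K : ℕ) (η : ℝ), 0 < η → ∃ (κ : Equiv.Perm V) (M : ℕ), Near R₀ K η κ ∧
      ∀ x, ‖x‖ ≤ R₁ → R₁ < ‖(κ ^ M)⁻¹ x‖ := by
  set t : ℝ := 2 * R₁ + 1 with ht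
  set R : ℝ := R₁ + 2 * t with hR
  have hR0 : 0 < R := by linarith
  have ht0 : 0 < t := by linarith
  have hU : Smooth fun x : V => plateau (R⁻¹ • x) • (t • e) :=
    (plateau_smooth.comp (contDiff_const_smul (R⁻¹ : ℝ))).smul contDiff_const
  have hU0 : ∀ x : V, 2 * R < ‖x‖ → plateau (R⁻¹ • x) • (t • e) = 0 := fun x hx => by
    rw [plateau_zero, zero_smul]
    rw [norm_smul, Real.norm_of_nonneg (by positivity), inv_mul_eq_div, lt_div_iff₀ hR0]
    exact hx
  refine ⟨2 * R, by linarith, fun K η hη => ?_⟩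
  obtain ⟨C, hC1, hC⟩ := exists_nd_bound hU (K + 1) (2 * R)
  obtain ⟨M, hM, hMC⟩ := exists_nat_div_le C (δ := min η (1 / 2)) (by positivity)
  have hM0 : (0 : ℝ) < M := by exact_mod_cast hM
  rw [abs_of_nonneg (by linarith)] at hMC
  have hws : Smooth fun x : V => (M : ℝ)⁻¹ • (plateau (R⁻¹ • x) • (t • e)) := hU.const_smul _
  have hb : ∀ i ≤ K + 1, ∀ x, nd i (fun x : V => (M : ℝ)⁻¹ • (plateau (R⁻¹ • x) • (t • e))) x ≤
      min η (1 / 2) := fun i hi x => by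
    rcases le_or_gt ‖x‖ (2 * R) with hx | hx
    · rw [nd_const_smul hU, abs_of_nonneg (by positivity)]
      refine le_trans ?_ hMC
      rw [inv_mul_eq_div]
      gcongr
      exact hC i hi x hx
    · rw [nd_eq_zero_of_ball (R := 2 * R) (fun y hy => by rw [hU0 y hy, smul_zero]) hx]
      positivity
  obtain ⟨κ, hκD, hκ⟩ := exists_near_perm hws
    (fun x => (hb 1 (by omega) x).trans (min_le_right _ _)) (R := 2 * R)
    (fun y hy => by rw [hU0 y hy, smul_zero])
  have hstep : ∀ y, ‖y‖ ≤ R → κ y = y + (M : ℝ)⁻¹ • (t • e) := fun y hy => by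
    rw [hκ, plateau_one, one_smul]
    rw [norm_smul, Real.norm_of_nonneg (by positivity), inv_mul_eq_div, div_le_one hR0]
    exact hy
  have hpow : ∀ x, ‖x‖ ≤ R₁ + t → ∀ j ≤ M, (κ ^ j) x = x + ((j : ℝ) * (M : ℝ)⁻¹) • (t • e) := by
    intro x hx j
    induction j with
    | zero => simp
    | succ j ih =>
      intro hj
      rw [pow_succ', Equiv.Perm.mul_apply, ih (by omega), hstep]
      · push_cast; rw [add_assoc, ← add_smul]; congr 2; ring
      · refine (norm_add_le _ _).trans ?_
        rw [norm_smul, norm_smul, he, mul_one, Real.norm_of_nonneg (by positivity),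
          Real.norm_of_nonneg ht0.le]
        have : (j : ℝ) * (M : ℝ)⁻¹ ≤ 1 := by
          rw [← div_eq_mul_inv, div_le_one hM0]; exact_mod_cast (by omega : j ≤ M)
        nlinarith
  refine ⟨κ, M, ⟨hκD, fun x hx => by rw [hκ, hU0 x hx, smul_zero, add_zero], ?_⟩, fun x hx => ?_⟩
  · simp only [hκ, add_sub_cancel_left]
    exact fun i hi x => (hb i (by omega) x).trans (min_le_left _ _)
  · have hte : ‖t • e‖ = t := by rw [norm_smul, he, mul_one, Real.norm_of_nonneg ht0.le]
    have h1 : (κ ^ M)⁻¹ x = x - t • e := by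
      rw [Equiv.Perm.inv_eq_iff_eq, hpow (x - t • e) ((norm_sub_le _ _).trans (by linarith)) M
        le_rfl, mul_inv_cancel₀ hM0.ne', one_smul, sub_add_cancel]
    have h2 := norm_sub_norm_le (t • e) x
    rw [h1, norm_sub_rev]
    linarith

end Displacement

section Limit

variable {E : Type} [NormedAddCommGroup E] [NormedSpace ℝ E] [FiniteDimensional ℝ E]

lemma near_pow_mul_inv_pow {g : Equiv.Perm E} (hg : IsD g) {R : ℝ} (hgR : ∀ x, R < ‖x‖ → g x = x)
    {F : ℕ → Equiv.Perm E} (hF : ∀ n, IsD (F n)) (hFR : ∀ n x, R < ‖x‖ → F n x = x)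
    (hlim : ∀ r, ∀ ε > (0 : ℝ), ∃ N, ∀ n ≥ N, sm r ε fun x => F n x - g x) (m r : ℕ) :
    ∀ ε > (0 : ℝ), ∃ N, ∀ n ≥ N, Near R r ε (F n ^ m * (g ^ m)⁻¹) := by
  have hgi : ∀ x, R < ‖x‖ → g⁻¹ x = x := fun x hx => by
    rw [Equiv.Perm.inv_eq_iff_eq, hgR x hx]
  obtain ⟨D, hD1, hD⟩ := hg.inv.exists_nd_bound r
  have hT : 0 < (r.factorial : ℝ) * D ^ r := by positivity
  have hone : ∀ ε > (0 : ℝ), ∃ N, ∀ n ≥ N, Near R r ε (F n * g⁻¹) := fun ε hε => by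
    obtain ⟨N, hN⟩ := hlim r (ε / (r.factorial * D ^ r)) (by positivity)
    refine ⟨N, fun n hn => ⟨(hF n).mul hg.inv, fun x hx => ?_, ?_⟩⟩
    · rw [Equiv.Perm.mul_apply, hgi x hx, hFR n x hx]
    · have h1 := sm.comp hg.inv.1 ((hF n).1.sub hg.1) hD1 hD (hN n hn)
      rw [mul_div_cancel₀ _ hT.ne'] at h1
      simpa only [pself_inv, Equiv.Perm.mul_apply] using h1
  induction m with
  | zero =>
    refine fun ε hε => ⟨0, fun n _ => ⟨by simpa using IsD.one, fun x _ => by simp, fun i _ x => ?_⟩⟩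
    have : (fun x => (F n ^ 0 * (g ^ 0)⁻¹) x - x) = fun _ => 0 := by funext x; simp
    rw [this, nd_eq_zero_of_eventually (Eventually.of_forall fun _ => rfl)]
    exact hε.le
  | succ m ih =>
    intro ε hε
    obtain ⟨δ, hδ, -, hmul⟩ := Near.mul (E := E) r hε
    obtain ⟨δ', hδ', -, hconj⟩ := Near.conj hg hgR r hδ
    obtain ⟨N, hN⟩ := ih δ' hδ'
    obtain ⟨N', hN'⟩ := hone δ hδ
    refine ⟨max N N', fun n hn => ?_⟩
    have := hmul R _ _ (hN' n ((le_max_right _ _).trans hn))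
      (hconj _ (hN n ((le_max_left _ _).trans hn)))
    convert this using 1
    rw [pow_succ', pow_succ']
    group

end Limit

section Main

variable {d : ℕ}

lemma isCDiffCRd_iff {f : Equiv.Perm (EuclideanSpace ℝ (Fin d))} : IsCDiffCRd f ↔ IsD f := by
  constructor
  · rintro ⟨h1, h2, K, hK, h⟩
    obtain ⟨R, hR⟩ := hK.isBounded.subset_closedBall 0
    exact ⟨h1, h2, R, fun x hx => h x fun hxK =>
      absurd (mem_closedBall_zero_iff.mp (hR hxK)) (not_le.mpr hx)⟩
  · rintro ⟨h1, h2, R, h⟩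
    exact ⟨h1, h2, Metric.closedBall 0 R, isCompact_closedBall 0 R, fun x hx => h x (by
      simpa using hx)⟩

lemma sm_of_distLtRd {r : ℕ} {ε : ℝ} {F g : Equiv.Perm (EuclideanSpace ℝ (Fin d))}
    (hF : IsD F) (hg : IsD g) (h : DistLtRd r ε F g) : sm r ε fun x => F x - g x := by
  intro i hi x
  have e : (fun x => F x - g x) = (F : EuclideanSpace ℝ (Fin d) → EuclideanSpace ℝ (Fin d)) - g :=
    rfl
  rw [nd, e, iteratedFDeriv_sub_apply (hF.1.nat i).contDiffAt (hg.1.nat i).contDiffAt]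
  exact (h i hi x).le

/-- The conclusion for conjugates converging to a distorted diffeomorphism, everything being
supported in a common ball. -/
theorem isDistorted_of_tendsto (hd : 2 ≤ d) {f g : Equiv.Perm (EuclideanSpace ℝ (Fin d))}
    (hf : IsD f) (hg : IsD g) (hgdist : IsDistorted IsCDiffCRd g) {R₁ : ℝ} (hR₁ : 0 ≤ R₁)
    (hfR : ∀ x, R₁ < ‖x‖ → f x = x) (hgR : ∀ x, R₁ < ‖x‖ → g x = x)
    {h : ℕ → Equiv.Perm (EuclideanSpace ℝ (Fin d))} (hh : ∀ n, IsD (h n))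
    (hhR : ∀ n x, R₁ < ‖x‖ → h n x = x)
    (hlim : ∀ r, ∀ ε > (0 : ℝ), ∃ N, ∀ n ≥ N, sm r ε fun x => (h n * f * (h n)⁻¹) x - g x) :
    IsDistorted IsCDiffCRd f := by
  classical
  obtain ⟨Sg, hSg, hgS, hgt⟩ := hgdist
  obtain ⟨R₀, hR₀, hdisp⟩ := exists_displacement
    (e := EuclideanSpace.single (⟨0, by omega⟩ : Fin d) (1 : ℝ)) (by simp) hR₁
  obtain ⟨l, r, ρ, hρ, henc⟩ := encodable hd R₀
  have hm : ∀ k : ℕ, ∃ m : ℕ, 0 < m ∧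
      ((l (3 * k) + wordLength Sg (g ^ m) : ℕ) : ℝ) ≤ 1 / (k + 1) * m := fun k => by
    have h1 : Tendsto (fun n : ℕ => (l (3 * k) : ℝ) / n + (wordLength Sg (g ^ n) : ℝ) / n) atTop
        (nhds (0 + 0)) := (tendsto_const_div_atTop_nhds_zero_nat _).add hgt
    rw [add_zero] at h1
    obtain ⟨m, hm1, hm2⟩ := ((h1.eventually_lt_const
      (by positivity : (0 : ℝ) < 1 / (k + 1))).and (eventually_gt_atTop 0)).exists
    refine ⟨m, hm2, ?_⟩
    rw [← add_div, div_lt_iff₀ (by exact_mod_cast hm2)] at hm1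
    push_cast
    exact hm1.le
  choose m hm0 hml using hm
  have hFR : ∀ n x, R₁ < ‖x‖ → (h n * f * (h n)⁻¹) x = x := fun n x hx => by
    have : (h n)⁻¹ x = x := by rw [Equiv.Perm.inv_eq_iff_eq, hhR n x hx]
    rw [Equiv.Perm.mul_apply, Equiv.Perm.mul_apply, this, hfR x hx, hhR n x hx]
  have hn : ∀ k : ℕ, ∃ n, Near R₀ (r (3 * k)) (ρ (3 * k))
      ((h n * f * (h n)⁻¹) ^ m k * (g ^ m k)⁻¹) := fun k => by
    obtain ⟨N, hN⟩ := near_pow_mul_inv_pow hg hgR (fun n => (hh n).conj hf) hFR hlim (m k)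
      (r (3 * k)) (ρ (3 * k)) (hρ _)
    exact ⟨N, (hN N le_rfl).mono hR₀ le_rfl le_rfl⟩
  choose n hn using hn
  have hκ : ∀ k : ℕ, ∃ (κ : Equiv.Perm (EuclideanSpace ℝ (Fin d))) (M : ℕ),
      Near R₀ (r (3 * k + 1)) (ρ (3 * k + 1)) κ ∧
      Near R₀ (r (3 * k + 2)) (ρ (3 * k + 2)) (h (n k) * κ * (h (n k))⁻¹) ∧
      ∀ x, ‖x‖ ≤ R₁ → R₁ < ‖(κ ^ M)⁻¹ x‖ := fun k => by
    obtain ⟨δ, hδ, -, hδc⟩ := Near.conj (hh (n k)) (fun x hx => hhR (n k) x (hR₀.trans_lt hx))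
      (r (3 * k + 2)) (hρ (3 * k + 2))
    obtain ⟨κ, M, h1, h2⟩ := hdisp (max (r (3 * k + 1)) (r (3 * k + 2)))
      (min (ρ (3 * k + 1)) δ) (lt_min (hρ _) hδ)
    exact ⟨κ, M, h1.mono le_rfl (le_max_left _ _) (min_le_left _ _),
      hδc κ (h1.mono le_rfl (le_max_right _ _) (min_le_right _ _)), h2⟩
  choose κ M hκ1 hκ2 hκM using hκ
  obtain ⟨S, hS, hSw⟩ := henc (fun j => if j % 3 = 0 then
      (h (n (j / 3)) * f * (h (n (j / 3)))⁻¹) ^ m (j / 3) * (g ^ m (j / 3))⁻¹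
      else if j % 3 = 1 then κ (j / 3) else h (n (j / 3)) * κ (j / 3) * (h (n (j / 3)))⁻¹)
    (fun _ => trivial) (fun j => by
      have hj := Nat.div_add_mod j 3
      have hj' := Nat.mod_lt j (by norm_num : 0 < 3)
      split_ifs with h0 h1
      · rw [h0, add_zero] at hj
        have := hn (j / 3)
        rwa [hj] at this
      · rw [h1] at hj
        have := hκ1 (j / 3)
        rwa [hj] at this
      · rw [show j % 3 = 2 by omega] at hj
        have := hκ2 (j / 3)
        rwa [hj] at this)
  have hw0 : ∀ k, WordLenLe S ((h (n k) * f * (h (n k))⁻¹) ^ m k * (g ^ m k)⁻¹) (l (3 * k)) :=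
    fun k => by
      have := hSw (3 * k)
      rwa [if_pos (by omega), Nat.mul_div_cancel_left _ (by norm_num)] at this
  have hw1 : ∀ k, WordLenLe S (κ k) (l (3 * k + 1)) := fun k => by
    have := hSw (3 * k + 1)
    rwa [if_neg (by omega), if_pos (by omega), show (3 * k + 1) / 3 = k by omega] at this
  have hw2 : ∀ k, WordLenLe S (h (n k) * κ k * (h (n k))⁻¹) (l (3 * k + 2)) := fun k => by
    have := hSw (3 * k + 2)
    rwa [if_neg (by omega), if_neg (by omega), show (3 * k + 2) / 3 = k by omega] at this
  refine isDistorted_of_arith (S := insert f (S ∪ Sg)) (fun s hs => ?_)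
    (Finset.mem_insert_self _ _) fun ε hε => ?_
  · rcases Finset.mem_insert.mp hs with rfl | hs
    · exact isCDiffCRd_iff.mpr hf
    · exact (Finset.mem_union.mp hs).elim (fun h => isCDiffCRd_iff.mpr (hS s h)) (hSg s)
  have hsub : S ⊆ insert f (S ∪ Sg) := Finset.subset_union_left.trans (Finset.subset_insert _ _)
  have hsub' : Sg ⊆ insert f (S ∪ Sg) := Finset.subset_union_right.trans (Finset.subset_insert _ _)
  obtain ⟨k, hk⟩ := exists_nat_one_div_lt hε
  set u := h (n k) * κ k ^ M k * (h (n k))⁻¹ * (κ k ^ M k)⁻¹ with hu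
  have huw : WordLenLe S u (M k * l (3 * k + 2) + M k * l (3 * k + 1)) := by
    rw [hu, ← conj_pow]
    exact ((hw2 k).pow _).mul ((hw1 k).pow _).inv
  have huf : u * f * u⁻¹ = h (n k) * f * (h (n k))⁻¹ :=
    conj_eq_of_displaced (B := Metric.closedBall 0 R₁) (sup_closedBall hfR)
      (sup_closedBall (hhR _)) fun x hx => by
        have := hκM k x (mem_closedBall_zero_iff.mp hx)
        rw [mem_closedBall_zero_iff]
        exact not_le.mpr this
  obtain ⟨j, hj⟩ := exists_wordLenLe_of_mem_closure (Subgroup.pow_mem _ hgS (m k))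
  have hfm : f ^ m k = u⁻¹ * ((h (n k) * f * (h (n k))⁻¹) ^ m k * (g ^ m k)⁻¹ * g ^ m k) * u := by
    rw [inv_mul_cancel_right, ← huf, conj_pow]
    group
  refine ⟨m k, l (3 * k) + wordLength Sg (g ^ m k),
    2 * (M k * l (3 * k + 2) + M k * l (3 * k + 1)), hm0 k, (hml k).trans (by gcongr),
    fun q => ?_⟩
  have hq : f ^ (m k * q) =
      u⁻¹ * ((h (n k) * f * (h (n k))⁻¹) ^ m k * (g ^ m k)⁻¹ * g ^ m k) ^ q * u := by
    have := conj_pow (i := q) (a := u⁻¹)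
      (b := (h (n k) * f * (h (n k))⁻¹) ^ m k * (g ^ m k)⁻¹ * g ^ m k)
    rw [inv_inv] at this
    rw [pow_mul, hfm, this]
  rw [hq]
  exact ((((huw.mono_set hsub).inv.mul ((((hw0 k).mono_set hsub).mul
    (hj.wordLength.mono_set hsub')).pow q)).mul (huw.mono_set hsub))).mono_len (by linarith)

end Main

end DiffDistortion

/-- Extension of Theorem B to `Diff^∞_c(ℝ^d)`, `d ≥ 2`: if `g` is distorted and `f` has
conjugates, by elements with a common compact support, converging to `g` in the `C^∞`
sense, then `f` is distorted. -/
theorem distorted_of_conjugates_tendsto_Rd (d : ℕ) (hd : 2 ≤ d)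
    (f g : Equiv.Perm (EuclideanSpace ℝ (Fin d)))
    (hf : IsCDiffCRd f) (hg : IsCDiffCRd g)
    (hgdist : IsDistorted IsCDiffCRd g)
    (hconj : ∃ K : Set (EuclideanSpace ℝ (Fin d)), IsCompact K ∧
      ∃ h : ℕ → Equiv.Perm (EuclideanSpace ℝ (Fin d)),
      (∀ n, IsCDiffCRd (h n)) ∧ (∀ n, ∀ x ∉ K, h n x = x) ∧
      ∀ r : ℕ, ∀ ε > (0 : ℝ), ∃ N : ℕ, ∀ n ≥ N,
        DistLtRd r ε (⇑(h n * f * (h n)⁻¹)) (⇑g)) :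
    IsDistorted IsCDiffCRd f := by
  obtain ⟨K, hK, h, hh, hhK, hlim⟩ := hconj
  have hfD := DiffDistortion.isCDiffCRd_iff.mp hf
  have hgD := DiffDistortion.isCDiffCRd_iff.mp hg
  obtain ⟨Rf, hRf⟩ := hfD.2.2
  obtain ⟨Rg, hRg⟩ := hgD.2.2
  obtain ⟨RK, hRK⟩ := hK.isBounded.subset_closedBall 0
  have hle : ∀ R ∈ [0, Rf, Rg, RK], R ≤ max 0 (max Rf (max Rg RK)) := by simp
  simp only [List.forall_mem_cons] at hle
  refine DiffDistortion.isDistorted_of_tendsto hd hfD hgD hgdist hle.1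
    (fun x hx => hRf x (hle.2.1.trans_lt hx)) (fun x hx => hRg x (hle.2.2.1.trans_lt hx))
    (fun n => DiffDistortion.isCDiffCRd_iff.mp (hh n)) (fun n x hx => hhK n x fun hxK => ?_)
    fun r ε hε => ?_
  · exact absurd (mem_closedBall_zero_iff.mp (hRK hxK))
      (not_le.mpr (hle.2.2.2.1.trans_lt hx))
  · obtain ⟨N, hN⟩ := hlim r ε hε
    exact ⟨N, fun n hn => DiffDistortion.sm_of_distLtRd
      ((DiffDistortion.isCDiffCRd_iff.mp (hh n)).conj hfD) hgD (hN n hn)⟩
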